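/- arXiv:math/0506282 — 3 statements merged into one kernel-verified Lean document; each statement's English description precedes it below -/
import Mathlib

section
/- Let D ⊂ ℂ be a bounded domain with real-analytic simple closed boundary, let α = min{Re ζ : ζ ∈ D̄}, β = max{Re ζ : ζ ∈ D̄}, and let D* = {conj ζ : ζ ∈ D}. Let λ : [α, β] → ℝ be continuous and let a, b, c, d ∈ ℝ be such that D̄ + ia and D̄* + ic are both contained in {t + is : α ≤ t ≤ β, s < λ(t)}, and D̄ + ib and D̄* + id are both contained in {t + is : α ≤ t ≤ β, s > λ(t)}. Set Q₁ = ⋃_{t ∈ [a,b]} (bD + it) and Q₂ = ⋃_{s ∈ [c,d]} (bD* + is). Let f : Q₁ ∪ Q₂ → ℂ be continuous and suppose that: (i) for each t ∈ [a,b] there is a continuous function on D̄ + it, holomorphic on D + it, agreeing with f on bD + it; and (ii) for each s ∈ [c,d] there is a continuous function on D̄* + is, holomorphic on D* + is, agreeing with f on bD* + is. Then f is holomorphic on Int Q₁ ∪ Int Q₂ (note that under these hypotheses Q₁ = ⋃_{t ∈ [a,b]} (D̄ + it) and Q₂ = ⋃_{s ∈ [c,d]} (D̄* + is)). -/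
open Complex Set

namespace TranslateAnalyticity

open MeasureTheory Topology Filter

/-- The Wirtinger derivative with respect to the conjugate variable. -/
noncomputable def dbar (u : ℂ → ℂ) (z : ℂ) : ℂ := (fderiv ℝ u z 1 + I * fderiv ℝ u z I) / 2

lemma continuous_dbar {u : ℂ → ℂ} (hu : ContDiff ℝ 1 u) : Continuous (dbar u) := by
  have h := hu.continuous_fderiv one_ne_zero
  unfold dbar
  fun_prop

lemma dbar_eq_zero_of_eventuallyEq {u : ℂ → ℂ} {z : ℂ} (h : u =ᶠ[𝓝 z] 0) : dbar u z = 0 := by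
  simp [dbar, h.fderiv_eq]

lemma dbar_eq_zero_of_notMem_tsupport {u : ℂ → ℂ} {z : ℂ} (h : z ∉ tsupport u) :
    dbar u z = 0 :=
  dbar_eq_zero_of_eventuallyEq (notMem_tsupport_iff_eventuallyEq.1 h)

lemma dbar_eq_zero_of_differentiableAt {u : ℂ → ℂ} {z : ℂ} (h : DifferentiableAt ℂ u z) :
    dbar u z = 0 := by
  have h1 : fderiv ℝ u z = (fderiv ℂ u z).restrictScalars ℝ :=
    (h.hasFDerivAt.restrictScalars ℝ).fderiv
  have h2 : fderiv ℂ u z I = I * fderiv ℂ u z 1 := by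
    rw [← smul_eq_mul, ← map_smul]; simp
  simp only [dbar, h1, ContinuousLinearMap.coe_restrictScalars', h2]
  rw [← mul_assoc, I_mul_I]; ring

lemma dbar_mul {u v : ℂ → ℂ} {z : ℂ} (hu : DifferentiableAt ℝ u z)
    (hv : DifferentiableAt ℝ v z) :
    dbar (fun w => u w * v w) z = u z * dbar v z + v z * dbar u z := by
  have := (hu.hasFDerivAt.mul hv.hasFDerivAt).fderiv
  simp only [dbar]
  rw [show (fun w => u w * v w) = u * v from rfl, this]
  simp
  ring

lemma dbar_comp_add_const (u : ℂ → ℂ) (c z : ℂ) :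
    dbar (fun w => u (w + c)) z = dbar u (z + c) := by
  simp [dbar, fderiv_comp_add_right]

lemma differentiableAt_of_dbar_eq_zero {u : ℂ → ℂ} {z : ℂ} (hu : DifferentiableAt ℝ u z)
    (h : dbar u z = 0) : DifferentiableAt ℂ u z := by
  rw [differentiableAt_complex_iff_differentiableAt_real]
  refine ⟨hu, ?_⟩
  simp only [dbar, div_eq_zero_iff, OfNat.ofNat_ne_zero, or_false] at h
  rw [smul_eq_mul]
  linear_combination (-I) * h + fderiv ℝ u z I * I_mul_I

lemma integrableOn_strip_of_compact {F : ℝ × ℝ → ℂ} (hF : Continuous F) {R : ℝ}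
    (hR : ∀ p : ℝ × ℝ, R < |p.1| → F p = 0) :
    IntegrableOn F (Ioi (0 : ℝ) ×ˢ Ioo (-Real.pi) Real.pi) := by
  have h1 : IntegrableOn F (Icc 0 R ×ˢ Icc (-Real.pi) Real.pi) :=
    hF.continuousOn.integrableOn_compact (isCompact_Icc.prod isCompact_Icc)
  refine h1.of_forall_sdiff_eq_zero (measurableSet_Ioi.prod measurableSet_Ioo) ?_
  rintro ⟨r, θ⟩ ⟨⟨h2, h3⟩, h4⟩
  apply hR
  by_contra! h5
  simp only at h2 h3 h5
  exact h4 ⟨⟨le_of_lt h2, (le_abs_self r).trans h5⟩, h3.1.le, h3.2.le⟩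

lemma hasDerivAt_polar_radius (u : ℂ → ℂ) (hu : ContDiff ℝ 1 u) (r θ : ℝ) :
    HasDerivAt (fun r : ℝ => u (r * exp (θ * I)))
      (fderiv ℝ u (r * exp (θ * I)) (exp (θ * I))) r := by
  have h1 : HasDerivAt (fun r : ℝ => (r : ℂ) * exp (θ * I)) (exp (θ * I)) r := by
    simpa using (Complex.ofRealCLM.hasDerivAt (x := r)).mul_const (exp (θ * I))
  exact ((hu.differentiable one_ne_zero _).hasFDerivAt).comp_hasDerivAt r h1

lemma hasDerivAt_polar_angle (u : ℂ → ℂ) (hu : ContDiff ℝ 1 u) (r θ : ℝ) :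
    HasDerivAt (fun θ : ℝ => u (r * exp (θ * I)))
      (r * fderiv ℝ u (r * exp (θ * I)) (I * exp (θ * I))) θ := by
  have h1 : HasDerivAt (fun θ : ℝ => (r : ℂ) * exp (θ * I)) (r * (exp (θ * I) * I)) θ := by
    have h0 : HasDerivAt (fun θ : ℝ => (θ : ℂ) * I) I θ := by
      simpa using (Complex.ofRealCLM.hasDerivAt (x := θ)).mul_const I
    exact h0.cexp.const_mul _
  refine (((hu.differentiable one_ne_zero _).hasFDerivAt).comp_hasDerivAt θ h1).congr_deriv ?_
  have h2 : (r : ℂ) * (exp (θ * I) * I) = r • (I * exp (θ * I)) := by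
    rw [real_smul, mul_comm I]
  rw [h2, map_smul, real_smul]

/-- The **Cauchy–Pompeiu formula** at the origin for compactly supported functions. -/
lemma integral_dbar_div_self {u : ℂ → ℂ} (hu : ContDiff ℝ 1 u) (hc : HasCompactSupport u) :
    ∫ z, dbar u z / z = -Real.pi * u 0 := by
  obtain ⟨R, hR⟩ : ∃ R, ∀ z : ℂ, R < ‖z‖ → z ∉ tsupport u := by
    obtain ⟨R, hR⟩ := hc.isBounded.subset_closedBall 0
    exact ⟨R, fun z hz hz' => by have := hR hz'; simp at this; linarith⟩
  have hdc := hu.continuous_fderiv one_ne_zero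
  set A : ℝ × ℝ → ℂ := fun p => fderiv ℝ u (p.1 * exp (p.2 * I)) (exp (p.2 * I)) with hA
  set B : ℝ × ℝ → ℂ := fun p => fderiv ℝ u (p.1 * exp (p.2 * I)) (I * exp (p.2 * I)) with hB
  have hf0 : ∀ p : ℝ × ℝ, R < |p.1| → fderiv ℝ u (p.1 * exp (p.2 * I)) = 0 := by
    intro p hp
    have : ↑p.1 * exp (p.2 * I) ∉ tsupport u := hR _ (by simpa [norm_exp_ofReal_mul_I] using hp)
    have h2 := (notMem_tsupport_iff_eventuallyEq.1 this).fderiv_eq (𝕜 := ℝ)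
    simpa using h2
  have hAc : Continuous A := by
    have : Continuous fun p : ℝ × ℝ => fderiv ℝ u (p.1 * exp (p.2 * I)) :=
      hdc.comp (by fun_prop)
    exact this.clm_apply (by fun_prop)
  have hBc : Continuous B := by
    have : Continuous fun p : ℝ × ℝ => fderiv ℝ u (p.1 * exp (p.2 * I)) :=
      hdc.comp (by fun_prop)
    exact this.clm_apply (by fun_prop)
  have hAi := integrableOn_strip_of_compact hAc (R := R) (fun p hp => by simp [hA, hf0 p hp])
  have hBi := integrableOn_strip_of_compact hBc (R := R) (fun p hp => by simp [hB, hf0 p hp])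
  rw [← Complex.integral_comp_polarCoord_symm]
  have e1 : ∀ p ∈ polarCoord.target, p.1 • (dbar u (Complex.polarCoord.symm p) /
      Complex.polarCoord.symm p) = (1 / 2 : ℂ) * A p + (I / 2) * B p := by
    rintro ⟨r, θ⟩ hp
    have hr : (0 : ℝ) < r := hp.1
    have hr' : (r : ℂ) ≠ 0 := by exact_mod_cast hr.ne'
    have hsym : Complex.polarCoord.symm (r, θ) = r * exp (θ * I) := by
      rw [Complex.polarCoord_symm_apply, exp_mul_I]
      push_cast; ring
    rw [hsym]
    have h1 : exp (θ * I) = Real.cos θ • (1 : ℂ) + Real.sin θ • I := by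
      rw [exp_mul_I]; simp
    have h2 : I * exp (θ * I) = (-Real.sin θ) • (1 : ℂ) + Real.cos θ • I := by
      rw [exp_mul_I, mul_add, mul_comm (sin (θ : ℂ)) I, ← mul_assoc, I_mul_I]
      simp; ring
    have h3 : exp (θ * I) * (Real.cos θ - I * Real.sin θ) = 1 := by
      rw [exp_mul_I, ofReal_cos, ofReal_sin]
      linear_combination cos_sq_add_sin_sq (θ : ℂ) - sin (θ : ℂ) ^ 2 * I_mul_I
    have hA' : A (r, θ) = Real.cos θ * fderiv ℝ u (r * exp (θ * I)) 1
        + Real.sin θ * fderiv ℝ u (r * exp (θ * I)) I := by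
      change fderiv ℝ u (r * exp (θ * I)) (exp (θ * I)) = _
      conv_lhs => arg 2; rw [h1]
      rw [map_add, map_smul, map_smul, real_smul, real_smul]
    have hB' : B (r, θ) = -Real.sin θ * fderiv ℝ u (r * exp (θ * I)) 1
        + Real.cos θ * fderiv ℝ u (r * exp (θ * I)) I := by
      change fderiv ℝ u (r * exp (θ * I)) (I * exp (θ * I)) = _
      conv_lhs => arg 2; rw [h2]
      rw [map_add, map_smul, map_smul, real_smul, real_smul]
      push_cast; ring
    rw [hA', hB', dbar, real_smul]
    have h4 : exp (θ * I) ≠ 0 := exp_ne_zero _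
    generalize fderiv ℝ u (r * exp (θ * I)) 1 = X
    generalize fderiv ℝ u (r * exp (θ * I)) I = Y
    generalize exp (θ * I) = E at h3 h4
    change (r : ℂ) * ((X + I * Y) / 2 / (r * E)) = _
    have h5 : (r : ℂ) * ((X + I * Y) / 2 / (r * E)) =
      (X + I * Y) / 2 * (Real.cos θ - I * Real.sin θ) := by
      field_simp
      linear_combination (-(X + I * Y)) * h3
    rw [h5]
    linear_combination (-(Real.sin θ * Y) / 2) * I_mul_I
  rw [setIntegral_congr_fun (polarCoord.open_target.measurableSet) e1]
  change ∫ p in Ioi (0 : ℝ) ×ˢ Ioo (-Real.pi) Real.pi, _ = _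
  rw [integral_add (hAi.const_mul _) (hBi.const_mul _), integral_const_mul, integral_const_mul]
  have iB : ∫ p in Ioi (0 : ℝ) ×ˢ Ioo (-Real.pi) Real.pi, B p = 0 := by
    rw [Measure.volume_eq_prod, setIntegral_prod _ (by rwa [← Measure.volume_eq_prod])]
    apply setIntegral_eq_zero_of_forall_eq_zero
    intro r hr
    have hr0 : (r : ℂ) ≠ 0 := by exact_mod_cast (ne_of_gt hr)
    rw [← integral_Ioc_eq_integral_Ioo, ← intervalIntegral.integral_of_le (by linarith [Real.pi_pos])]
    have h1 := intervalIntegral.integral_eq_sub_of_hasDerivAt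
      (a := -Real.pi) (b := Real.pi) (fun θ _ => hasDerivAt_polar_angle u hu r θ)
      (Continuous.intervalIntegrable (by
        have : Continuous fun θ : ℝ => B (r, θ) := hBc.comp (by fun_prop)
        exact continuous_const.mul this) _ _)
    rw [intervalIntegral.integral_const_mul] at h1
    have h2 : exp ((Real.pi : ℂ) * I) = exp (((-Real.pi : ℝ) : ℂ) * I) := by
      rw [exp_pi_mul_I, ofReal_neg, neg_mul, exp_neg, exp_pi_mul_I]; norm_num
    rw [h2, sub_self] at h1
    exact (mul_eq_zero.1 h1).resolve_left hr0
  have iA : ∫ p in Ioi (0 : ℝ) ×ˢ Ioo (-Real.pi) Real.pi, A p = -(2 * Real.pi) * u 0 := by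
    rw [Measure.volume_eq_prod] at hAi ⊢
    rw [← setIntegral_prod_swap, setIntegral_prod (fun z => A z.swap) hAi.swap]
    have h0 : ∀ θ : ℝ, ∫ r in Ioi (0 : ℝ), A (r, θ) = - u 0 := by
      intro θ
      have hcont : Continuous fun r : ℝ => A (r, θ) := hAc.comp (by fun_prop)
      have := integral_Ioi_of_hasDerivAt_of_tendsto' (a := (0 : ℝ)) (m := 0)
        (fun r _ => hasDerivAt_polar_radius u hu r θ) ?_ ?_
      · rw [show (fun r : ℝ => A (r, θ)) = fun r : ℝ =>
          fderiv ℝ u (r * exp (θ * I)) (exp (θ * I)) from rfl, this]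
        simp
      · have h3 : IntegrableOn (fun r => A (r, θ)) (Icc 0 R) :=
          hcont.continuousOn.integrableOn_compact isCompact_Icc
        refine h3.of_forall_sdiff_eq_zero measurableSet_Ioi ?_
        rintro r ⟨h4, h5⟩
        simp only [hA]
        rw [hf0 (r, θ)]; · rfl
        by_contra! h6
        exact h5 ⟨le_of_lt h4, (le_abs_self r).trans h6⟩
      · apply tendsto_const_nhds.congr'
        filter_upwards [eventually_gt_atTop R, eventually_gt_atTop 0] with r hr hr0
        symm
        apply image_eq_zero_of_notMem_tsupport
        apply hR
        simpa [norm_exp_ofReal_mul_I, abs_of_pos hr0] using hr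
    simp only [Prod.swap_prod_mk]
    simp_rw [h0]
    simp [Real.pi_pos.le]
    ring_nf
    simp
  rw [iA, iB]; ring

/-- The **Cauchy–Pompeiu formula** for compactly supported functions. -/
lemma integral_dbar_div_sub {u : ℂ → ℂ} (hu : ContDiff ℝ 1 u) (hc : HasCompactSupport u) (τ : ℂ) :
    ∫ z, dbar u z / (z - τ) = -Real.pi * u τ := by
  have h := integral_dbar_div_self (u := fun w => u (w + τ)) (by fun_prop)
    (hc.comp_homeomorph (Homeomorph.addRight τ))
  simp only [dbar_comp_add_const, zero_add] at h
  rw [← h, ← integral_add_right_eq_self _ τ]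
  simp

section

lemma integrableOn_inv_ball (R : ℝ) : IntegrableOn (fun z : ℂ => z⁻¹) (Metric.ball 0 R) := by
  have h : IntegrableOn (fun z : ℂ => ‖z‖⁻¹) (Metric.ball 0 R) := by
    rw [integrableOn_fun_norm_addHaar (μ := volume) (f := fun x : ℝ => x⁻¹)]
    have : IntegrableOn (fun _ : ℝ => (1 : ℝ)) (Ioo 0 R) := by simp
    refine this.congr_fun (fun y hy => ?_) measurableSet_Ioo
    have : y ≠ 0 := ne_of_gt hy.1
    simp [Complex.finrank_real_complex, this]
  exact (integrable_norm_iff (by fun_prop)).1 (by simpa [IntegrableOn] using h)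

lemma integrable_indicator_inv_ball (R : ℝ) :
    Integrable ((Metric.ball (0 : ℂ) R).indicator fun z : ℂ => z⁻¹) :=
  (integrableOn_inv_ball R).integrable_indicator measurableSet_ball

/-- Convolving a bounded integrable function with an integrable one gives a continuous function. -/
lemma continuous_integral_mul_comp_sub {g k : ℂ → ℂ} (hg : Integrable g) (hk : Integrable k)
    {C : ℝ} (hC : ∀ z, ‖g z‖ ≤ C) : Continuous fun τ => ∫ ζ, g ζ * k (ζ - τ) := by
  have hC0 : 0 ≤ C := (norm_nonneg _).trans (hC 0)
  have hgm : ∀ {h : ℂ → ℂ}, Integrable h → ∀ τ, Integrable fun ζ => g ζ * h (ζ - τ) := by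
    intro h hh τ
    exact (hh.comp_sub_right τ).bdd_mul hg.aestronglyMeasurable (Eventually.of_forall hC)
  refine continuous_of_uniform_approx_of_continuous fun U hU => ?_
  obtain ⟨ε, hε, hεU⟩ := Metric.mem_uniformity_dist.1 hU
  obtain ⟨h, hhc, hhe, hhcont, hhi⟩ :=
    hk.exists_hasCompactSupport_integral_sub_le (show 0 < ε / (2 * (C + 1)) by positivity)
  refine ⟨fun τ => ∫ ζ, g ζ * h (ζ - τ), ?_, fun τ => hεU ?_⟩
  · obtain ⟨M, hM⟩ := hhc.exists_bound_of_continuous hhcont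
    refine continuous_of_dominated (bound := fun ζ => ‖g ζ‖ * M) (fun τ => (hgm hhi τ).1) ?_
      (hg.norm.mul_const M) (Eventually.of_forall fun ζ => by fun_prop)
    intro τ
    refine Eventually.of_forall fun ζ => ?_
    rw [norm_mul]
    exact mul_le_mul_of_nonneg_left (hM _) (norm_nonneg _)
  · rw [dist_eq_norm, ← integral_sub (hgm hk τ) (hgm hhi τ)]
    calc ‖∫ ζ, (g ζ * k (ζ - τ) - g ζ * h (ζ - τ))‖
        ≤ ∫ ζ, C * ‖k (ζ - τ) - h (ζ - τ)‖ := by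
          refine norm_integral_le_of_norm_le ?_ (Eventually.of_forall fun ζ => ?_)
          · exact (((hk.sub hhi).comp_sub_right τ).norm).const_mul C
          · rw [← mul_sub, norm_mul]
            exact mul_le_mul_of_nonneg_right (hC ζ) (norm_nonneg _)
      _ = C * ∫ ζ, ‖k ζ - h ζ‖ := by
          rw [integral_const_mul, integral_sub_right_eq_self (fun ζ => ‖k ζ - h ζ‖)]
      _ ≤ C * (ε / (2 * (C + 1))) := mul_le_mul_of_nonneg_left hhe hC0
      _ < ε := by
          rw [mul_div_assoc', div_lt_iff₀ (by positivity)]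
          nlinarith

variable {D : Set ℂ}

lemma integrableOn_of_continuousOn_closure (hb : Bornology.IsBounded D) {w : ℂ → ℂ}
    (hw : ContinuousOn w (closure D)) : IntegrableOn w D :=
  (hw.integrableOn_compact hb.isCompact_closure).mono_set subset_closure

lemma exists_bound_of_continuousOn_closure (hb : Bornology.IsBounded D) {w : ℂ → ℂ}
    (hw : ContinuousOn w (closure D)) : ∃ C, ∀ z ∈ D, ‖w z‖ ≤ C := by
  obtain ⟨C, hC⟩ := hb.isCompact_closure.exists_bound_of_continuousOn hw
  exact ⟨C, fun z hz => hC z (subset_closure hz)⟩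

/-- The Cauchy transform over a bounded domain is continuous up to the boundary. -/
lemma continuousOn_cauchyTransform (hD : IsOpen D) (hb : Bornology.IsBounded D) {w : ℂ → ℂ}
    (hw : ContinuousOn w (closure D)) :
    ContinuousOn (fun τ => ∫ ζ in D, w ζ / (ζ - τ)) (closure D) := by
  obtain ⟨R, hR⟩ := hb.closure.subset_ball 0
  obtain ⟨C, hC⟩ := exists_bound_of_continuousOn_closure hb hw
  have h1 := continuous_integral_mul_comp_sub (g := D.indicator w)
    ((integrableOn_of_continuousOn_closure hb hw).integrable_indicator hD.measurableSet)
    (integrable_indicator_inv_ball (2 * R)) (C := max C 0) (by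
      intro z
      by_cases hz : z ∈ D
      · simpa [hz] using Or.inl (hC z hz)
      · simp [hz])
  refine h1.continuousOn.congr fun τ hτ => ?_
  simp only
  rw [← integral_indicator hD.measurableSet]
  congr 1
  ext ζ
  by_cases hz : ζ ∈ D
  · have : ζ - τ ∈ Metric.ball (0 : ℂ) (2 * R) := by
      have h2 := hR hτ
      have h3 := hR (subset_closure hz)
      simp only [Metric.mem_ball, dist_zero_right] at h2 h3 ⊢
      linarith [norm_sub_le ζ τ]
    rw [indicator_of_mem hz, indicator_of_mem hz, indicator_of_mem this, div_eq_mul_inv]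
  · simp [hz]

lemma integrableOn_cauchyKernel (hb : Bornology.IsBounded D) (hD : IsOpen D) {w : ℂ → ℂ}
    (hw : ContinuousOn w (closure D)) {τ : ℂ} (hτ : τ ∈ closure D) :
    IntegrableOn (fun ζ => w ζ / (ζ - τ)) D := by
  obtain ⟨R, hR⟩ := hb.closure.subset_ball 0
  obtain ⟨C, hC⟩ := exists_bound_of_continuousOn_closure hb hw
  have h1 : IntegrableOn (fun ζ => (Metric.ball (0 : ℂ) (2 * R)).indicator (fun z => z⁻¹) (ζ - τ))
    D := ((integrable_indicator_inv_ball (2 * R)).comp_sub_right τ).integrableOn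
  have h2 : IntegrableOn (fun ζ => w ζ *
      (Metric.ball (0 : ℂ) (2 * R)).indicator (fun z => z⁻¹) (ζ - τ)) D :=
    h1.bdd_mul (integrableOn_of_continuousOn_closure hb hw).1
      (ae_restrict_of_forall_mem hD.measurableSet hC)
  refine h2.congr_fun (fun ζ hz => ?_) hD.measurableSet
  have : ζ - τ ∈ Metric.ball (0 : ℂ) (2 * R) := by
    have h2 := hR hτ
    have h3 := hR (subset_closure hz)
    simp only [Metric.mem_ball, dist_zero_right] at h2 h3 ⊢
    linarith [norm_sub_le ζ τ]
  simp only [indicator_of_mem this, div_eq_mul_inv]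

lemma differentiableAt_cauchyTransform {g : ℂ → ℂ} (hg : Integrable g) {τ₀ : ℂ} {r : ℝ}
    (hr : 0 < r) (h0 : ∀ ζ ∈ Metric.ball τ₀ r, g ζ = 0) :
    DifferentiableAt ℂ (fun τ => ∫ ζ, g ζ / (ζ - τ)) τ₀ := by
  have key : ∀ τ ∈ Metric.ball τ₀ (r / 2), ∀ ζ, g ζ ≠ 0 → r / 2 ≤ ‖ζ - τ‖ := by
    intro τ hτ ζ hζ
    have h1 : ζ ∉ Metric.ball τ₀ r := fun h => hζ (h0 ζ h)
    simp only [Metric.mem_ball, not_lt, dist_eq_norm] at h1 hτ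
    have : ‖ζ - τ₀‖ ≤ ‖ζ - τ‖ + ‖τ - τ₀‖ := by
      simpa using norm_add_le (ζ - τ) (τ - τ₀)
    linarith
  have hm : ∀ τ, AEStronglyMeasurable (fun ζ => g ζ / (ζ - τ)) := fun τ => by
    simp_rw [div_eq_mul_inv]
    exact hg.1.mul (by fun_prop)
  refine (hasDerivAt_integral_of_dominated_loc_of_deriv_le
    (bound := fun ζ => ‖g ζ‖ * (r / 2)⁻¹ ^ 2)
    (F' := fun τ ζ => g ζ * ((ζ - τ)⁻¹) ^ 2)
    (Metric.ball_mem_nhds τ₀ (half_pos hr)) (Eventually.of_forall hm) ?_ ?_ ?_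
    (hg.norm.mul_const _) ?_).2.differentiableAt
  · refine (hg.norm.mul_const (r / 2)⁻¹).mono' (hm τ₀) (Eventually.of_forall fun ζ => ?_)
    by_cases hz : g ζ = 0
    · simp [hz]
    · rw [norm_div, div_eq_mul_inv]
      gcongr
      exact key τ₀ (Metric.mem_ball_self (half_pos hr)) ζ hz
  · exact hg.1.mul (by fun_prop)
  · refine Eventually.of_forall fun ζ τ hτ => ?_
    by_cases hz : g ζ = 0
    · simp [hz]
    · rw [norm_mul, norm_pow, norm_inv]
      gcongr
      exact key τ hτ ζ hz
  · refine Eventually.of_forall fun ζ τ hτ => ?_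
    by_cases hz : g ζ = 0
    · simpa [hz] using hasDerivAt_const τ (0 : ℂ)
    · have h1 : ζ - τ ≠ 0 := fun h => by
        have := key τ hτ ζ hz
        rw [h, norm_zero] at this
        linarith
      have h2 := ((hasDerivAt_id τ).const_sub ζ).inv h1 |>.const_mul (g ζ)
      simp only [id, neg_neg] at h2
      refine h2.congr_deriv ?_
      field_simp

/-- Solving the inhomogeneous Cauchy–Riemann equation: correcting `π G χ` by the Cauchy transform
of `G ∂χ/∂z̄` produces a holomorphic function. -/
lemma differentiableOn_cauchyTransform_add (hD : IsOpen D) (hb : Bornology.IsBounded D)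
    {G χ : ℂ → ℂ} (hG : ContinuousOn G (closure D)) (hGd : DifferentiableOn ℂ G D)
    (hχ : ContDiff ℝ 1 χ) :
    DifferentiableOn ℂ (fun τ => (∫ ζ in D, G ζ * dbar χ ζ / (ζ - τ)) + Real.pi * (G τ * χ τ)) D := by
  intro τ₀ hτ₀
  refine DifferentiableAt.differentiableWithinAt ?_
  obtain ⟨ρ, hρ, hρD⟩ := Metric.isOpen_iff.1 hD τ₀ hτ₀
  let θb : ContDiffBump τ₀ := ⟨ρ / 4, ρ / 2, by positivity, by linarith⟩
  set θ : ℂ → ℂ := fun z => ((θb z : ℝ) : ℂ) with hθ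
  have hθs : ContDiff ℝ 1 θ := Complex.ofRealCLM.contDiff.comp θb.contDiff
  have hθD : tsupport θ ⊆ D := by
    have h1 : tsupport θ ⊆ tsupport θb := by
      apply closure_mono
      intro z hz
      simpa [hθ] using hz
    rw [θb.tsupport_eq] at h1
    refine h1.trans ((Metric.closedBall_subset_ball ?_).trans hρD)
    change ρ / 2 < ρ
    linarith
  have hθ1 : ∀ z ∈ Metric.ball τ₀ (ρ / 4), θ z = 1 := fun z hz => by
    have : z ∈ Metric.closedBall τ₀ θb.rIn := Metric.ball_subset_closedBall hz
    simp [hθ, θb.one_of_mem_closedBall this]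
  have hGat : ∀ z ∈ D, DifferentiableAt ℂ G z := fun z hz => hGd.differentiableAt (hD.mem_nhds hz)
  set u : ℂ → ℂ := fun z => θ z * (G z * χ z) with hu
  have hus : tsupport u ⊆ tsupport θ := tsupport_mul_subset_left
  have huc : HasCompactSupport u := by
    have : HasCompactSupport θ := θb.hasCompactSupport.comp_left (g := fun x : ℝ => (x : ℂ)) (by simp)
    exact this.mul_right
  have huC : ContDiff ℝ 1 u := by
    rw [contDiff_iff_contDiffAt]
    intro z
    by_cases hz : z ∈ D
    · have : ContDiffAt ℂ 1 G z := (hGd.analyticAt (hD.mem_nhds hz)).contDiffAt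
      exact hθs.contDiffAt.mul ((this.restrict_scalars ℝ).mul hχ.contDiffAt)
    · have : z ∉ tsupport u := fun h => hz (hθD (hus h))
      exact contDiffAt_const.congr_of_eventuallyEq (notMem_tsupport_iff_eventuallyEq.1 this)
  have hdu : ∀ z ∈ D, dbar u z = θ z * (G z * dbar χ z) + G z * χ z * dbar θ z := by
    intro z hz
    have hχz := hχ.differentiable one_ne_zero z
    have hGz := (hGat z hz).restrictScalars ℝ
    rw [hu, dbar_mul (hθs.differentiable one_ne_zero z)
      (show DifferentiableAt ℝ (fun z => G z * χ z) z from hGz.mul hχz), dbar_mul hGz hχz,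
      dbar_eq_zero_of_differentiableAt (hGat z hz)]
    ring
  have hdu0 : ∀ z ∉ D, dbar u z = 0 := fun z hz =>
    dbar_eq_zero_of_notMem_tsupport fun h => hz (hθD (hus h))
  have hdχ := continuous_dbar hχ
  have hdθ := continuous_dbar hθs
  set w₂ : ℂ → ℂ := fun z => (1 - θ z) * (G z * dbar χ z) - G z * χ z * dbar θ z with hw₂
  have hw₂c : ContinuousOn w₂ (closure D) := by
    have := hχ.continuous
    have := hθs.continuous
    fun_prop
  set g := D.indicator w₂ with hg
  have hgi : Integrable g :=
    (integrableOn_of_continuousOn_closure hb hw₂c).integrable_indicator hD.measurableSet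
  have hg0 : ∀ ζ ∈ Metric.ball τ₀ (ρ / 4), g ζ = 0 := by
    intro ζ hζ
    have h1 : dbar θ ζ = 0 := by
      have h2 : θ =ᶠ[𝓝 ζ] fun _ => 1 := by
        filter_upwards [Metric.isOpen_ball.mem_nhds hζ] with z hz using hθ1 z hz
      simp [dbar, h2.fderiv_eq]
    by_cases hz : ζ ∈ D
    · simp [hg, hz, hw₂, h1, hθ1 ζ hζ]
    · simp [hg, hz]
  have main : (fun τ => (∫ ζ in D, G ζ * dbar χ ζ / (ζ - τ)) + Real.pi * (G τ * χ τ))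
      =ᶠ[𝓝 τ₀] fun τ => ∫ ζ, g ζ / (ζ - τ) := by
    filter_upwards [Metric.ball_mem_nhds τ₀ (show 0 < ρ / 4 by positivity)] with τ hτ
    have hτD : τ ∈ D := hρD (Metric.ball_subset_ball (by linarith) hτ)
    have h1 := integral_dbar_div_sub huC huc τ
    have h2 : ∫ ζ, dbar u ζ / (ζ - τ) = ∫ ζ in D, dbar u ζ / (ζ - τ) := by
      rw [setIntegral_eq_integral_of_forall_compl_eq_zero]
      intro z hz
      simp [hdu0 z hz]
    have h3 : ∫ ζ, g ζ / (ζ - τ) = ∫ ζ in D, w₂ ζ / (ζ - τ) := by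
      rw [← integral_indicator hD.measurableSet]
      congr 1
      ext z
      by_cases hz : z ∈ D <;> simp [hg, hz]
    have h4 : ∫ ζ in D, G ζ * dbar χ ζ / (ζ - τ) =
        (∫ ζ in D, dbar u ζ / (ζ - τ)) + ∫ ζ in D, w₂ ζ / (ζ - τ) := by
      rw [← integral_add (integrableOn_cauchyKernel hb hD (continuous_dbar huC).continuousOn
        (subset_closure hτD)) (integrableOn_cauchyKernel hb hD hw₂c (subset_closure hτD))]
      refine setIntegral_congr_fun hD.measurableSet fun z hz => ?_
      simp only [hdu z hz, hw₂]
      ring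
    rw [h4, ← h2, h1, h3, hu]
    simp only [hθ1 τ hτ]
    ring
  exact (differentiableAt_cauchyTransform hgi (by positivity) hg0).congr_of_eventuallyEq main

/-- A finite measure on the boundary of `D` representing evaluation at `p` on the algebra of
functions continuous on the closure of `D` and holomorphic on `D`. -/
structure IsRepresenting (D : Set ℂ) (p : ℂ) (μ : Measure ℂ) : Prop where
  finite : IsFiniteMeasure μ
  ae_mem : ∀ᵐ τ ∂μ, τ ∈ frontier D
  integral_eq : ∀ g : ℂ → ℂ, ContinuousOn g (closure D) → DifferentiableOn ℂ g D →
    ∫ τ, g τ ∂μ = g p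

/-- The Cauchy transform of `δ_p - μ`. -/
noncomputable def kernel (μ : Measure ℂ) (p ζ : ℂ) : ℂ := (ζ - p)⁻¹ - ∫ τ, (ζ - τ)⁻¹ ∂μ

lemma integrable_inv_sub_prod (hD : IsOpen D) (hb : Bornology.IsBounded D) {μ : Measure ℂ}
    [IsFiniteMeasure μ] (hμ : ∀ᵐ τ ∂μ, τ ∈ frontier D) :
    Integrable (fun q : ℂ × ℂ => (q.1 - q.2)⁻¹) ((volume.restrict D).prod μ) := by
  obtain ⟨R, hR⟩ := hb.closure.subset_ball 0
  have hmeas : AEStronglyMeasurable (fun q : ℂ × ℂ => (q.1 - q.2)⁻¹) ((volume.restrict D).prod μ) :=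
    (by fun_prop : Measurable fun q : ℂ × ℂ => (q.1 - q.2)⁻¹).aestronglyMeasurable
  have hfr : ∀ᵐ τ ∂μ, τ ∈ closure D := hμ.mono fun τ h => frontier_subset_closure h
  rw [integrable_prod_iff' hmeas]
  constructor
  · filter_upwards [hfr] with τ hτ
    have := integrableOn_cauchyKernel hb hD (w := fun _ => 1) continuousOn_const hτ
    simpa [div_eq_mul_inv, IntegrableOn] using this
  · refine (integrable_const (∫ z, ‖(Metric.ball (0 : ℂ) (2 * R)).indicator (fun z => z⁻¹) z‖)).mono'
      (hmeas.norm.prod_swap.integral_prod_right') ?_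
    filter_upwards [hfr] with τ hτ
    rw [Real.norm_of_nonneg (by positivity), ← integral_indicator hD.measurableSet,
      ← integral_sub_right_eq_self
        (fun z => ‖(Metric.ball (0 : ℂ) (2 * R)).indicator (fun z => z⁻¹) z‖) τ]
    refine integral_mono_of_nonneg (Eventually.of_forall fun ζ => ?_)
      ((integrable_indicator_inv_ball (2 * R)).comp_sub_right τ).norm
      (Eventually.of_forall fun ζ => ?_)
    · exact indicator_nonneg (fun _ _ => by positivity) _
    · by_cases hz : ζ ∈ D
      · have : ζ - τ ∈ Metric.ball (0 : ℂ) (2 * R) := by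
          have h2 := hR hτ
          have h3 := hR (subset_closure hz)
          simp only [Metric.mem_ball, dist_zero_right] at h2 h3 ⊢
          linarith [norm_sub_le ζ τ]
        simp only [indicator_of_mem this, indicator_of_mem hz, le_refl]
      · simp only [indicator_of_notMem hz]; positivity

lemma integrableOn_kernel (hD : IsOpen D) (hb : Bornology.IsBounded D) {μ : Measure ℂ} {p : ℂ}
    (hp : p ∈ D) (hμ : IsRepresenting D p μ) : IntegrableOn (kernel μ p) D := by
  have := hμ.finite
  refine Integrable.sub ?_ (integrable_inv_sub_prod hD hb hμ.ae_mem).integral_prod_left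
  have := integrableOn_cauchyKernel hb hD (w := fun _ => 1) continuousOn_const (subset_closure hp)
  simpa [div_eq_mul_inv, IntegrableOn] using this

lemma setIntegral_mul_dbar_mul_kernel (hD : IsOpen D) (hb : Bornology.IsBounded D)
    {μ : Measure ℂ} {p : ℂ} (hp : p ∈ D) (hμ : IsRepresenting D p μ)
    {G χ : ℂ → ℂ} (hG : ContinuousOn G (closure D)) (hGd : DifferentiableOn ℂ G D)
    (hχ : ContDiff ℝ 1 χ) :
    ∫ ζ in D, G ζ * kernel μ p ζ * dbar χ ζ =
      Real.pi * ((∫ τ, G τ * χ τ ∂μ) - G p * χ p) := by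
  have hfin := hμ.finite
  have hdχ := continuous_dbar hχ
  set w : ℂ → ℂ := fun ζ => G ζ * dbar χ ζ with hw
  have hwc : ContinuousOn w (closure D) := hG.mul hdχ.continuousOn
  have hGχ : ContinuousOn (fun τ => G τ * χ τ) (closure D) := hG.mul hχ.continuous.continuousOn
  have hψ := hμ.integral_eq (fun τ => (∫ ζ in D, w ζ / (ζ - τ)) + Real.pi * (G τ * χ τ))
    ((continuousOn_cauchyTransform hD hb hwc).add (hGχ.const_mul _))
    (differentiableOn_cauchyTransform_add hD hb hG hGd hχ)
  have hμint : ∀ {v : ℂ → ℂ}, ContinuousOn v (closure D) → Integrable v μ := by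
    intro v hv
    have h1 : IntegrableOn v (closure D) μ := hv.integrableOn_compact hb.isCompact_closure
    rwa [IntegrableOn, Measure.restrict_eq_self_of_ae_mem] at h1
    exact hμ.ae_mem.mono fun τ h => frontier_subset_closure h
  rw [integral_add (hμint (continuousOn_cauchyTransform hD hb hwc)) ((hμint hGχ).const_mul _),
    integral_const_mul] at hψ
  obtain ⟨C, hC⟩ := exists_bound_of_continuousOn_closure hb hwc
  have hwm : AEStronglyMeasurable w (volume.restrict D) :=
    (integrableOn_of_continuousOn_closure hb hwc).1
  have hprod : Integrable (fun q : ℂ × ℂ => w q.1 * (q.1 - q.2)⁻¹) ((volume.restrict D).prod μ) := by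
    refine (integrable_inv_sub_prod hD hb hμ.ae_mem).bdd_mul (c := C) hwm.comp_fst ?_
    exact (Measure.quasiMeasurePreserving_fst (μ := volume.restrict D) (ν := μ)).ae
      (ae_restrict_of_forall_mem hD.measurableSet hC)
  have hswap : ∫ ζ in D, w ζ * ∫ τ, (ζ - τ)⁻¹ ∂μ = ∫ τ, (∫ ζ in D, w ζ / (ζ - τ)) ∂μ := by
    simp_rw [← integral_const_mul, div_eq_mul_inv]
    exact integral_integral_swap hprod
  have hk : ∫ ζ in D, G ζ * kernel μ p ζ * dbar χ ζ =
      (∫ ζ in D, w ζ / (ζ - p)) - ∫ ζ in D, w ζ * ∫ τ, (ζ - τ)⁻¹ ∂μ := by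
    rw [← integral_sub (integrableOn_cauchyKernel hb hD hwc (subset_closure hp))]
    · congr 1
      ext ζ
      simp only [kernel, hw]
      ring
    · have := hprod.integral_prod_left
      simpa [integral_const_mul] using this
  rw [hk, hswap]
  linear_combination -hψ

end

open CompactlySupported in
lemma exists_measure_of_positive {X : Type*} [TopologicalSpace X] [CompactSpace X] [T2Space X]
    [MeasurableSpace X] [BorelSpace X] (F : C(X, ℝ) →ₗ[ℝ] ℝ) (hF : ∀ φ, 0 ≤ φ → 0 ≤ F φ) :
    ∃ μ : Measure X, IsFiniteMeasure μ ∧ ∀ φ : C(X, ℝ), ∫ x, φ x ∂μ = F φ := by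
  let Λ₀ : C_c(X, ℝ) →ₗ[ℝ] ℝ :=
    { toFun := fun φ => F φ.toContinuousMap
      map_add' := fun φ ψ => F.map_add φ.toContinuousMap ψ.toContinuousMap
      map_smul' := fun c φ => F.map_smul c φ.toContinuousMap }
  let Λ : C_c(X, ℝ) →ₚ[ℝ] ℝ := PositiveLinearMap.mk₀ Λ₀ fun φ hφ => hF φ.toContinuousMap hφ
  refine ⟨RealRMK.rieszMeasure Λ, ?_, fun φ => ?_⟩
  · infer_instance
  · exact RealRMK.integral_rieszMeasure Λ (CompactlySupportedContinuousMap.continuousMapEquiv φ)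

lemma re_le_of_forall_frontier {D : Set ℂ} (hb : Bornology.IsBounded D) {g : ℂ → ℂ}
    (hg : ContinuousOn g (closure D)) (hgd : DifferentiableOn ℂ g D) {C : ℝ}
    (hC : ∀ z ∈ frontier D, (g z).re ≤ C) {p : ℂ} (hp : p ∈ closure D) : (g p).re ≤ C := by
  have h : DiffContOnCl ℂ (fun z => exp (g z)) D :=
    ⟨fun z hz => (hgd z hz).cexp, continuous_exp.comp_continuousOn hg⟩
  have := Complex.norm_le_of_forall_mem_frontier_norm_le hb h (C := Real.exp C)
    (fun z hz => by rw [norm_exp]; exact Real.exp_le_exp.2 (hC z hz)) hp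
  rwa [norm_exp, Real.exp_le_exp] at this

lemma exists_isRepresenting {D : Set ℂ} (hb : Bornology.IsBounded D) {p : ℂ}
    (hp : p ∈ D) (hne : (frontier D).Nonempty) : ∃ μ : Measure ℂ, IsRepresenting D p μ := by
  let X := closure D
  have : CompactSpace X := isCompact_iff_compactSpace.1 hb.isCompact_closure
  let S : Set X := {x | x.1 ∈ frontier D}
  have hS : IsCompact S := (isClosed_frontier.preimage continuous_subtype_val).isCompact
  have hSne : S.Nonempty := by
    obtain ⟨z, hz⟩ := hne
    exact ⟨⟨z, frontier_subset_closure hz⟩, hz⟩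
  let pX : X := ⟨p, subset_closure hp⟩
  let W : Submodule ℝ C(X, ℝ) :=
    { carrier := {φ | ∃ g : ℂ → ℂ, ContinuousOn g (closure D) ∧ DifferentiableOn ℂ g D ∧
        ∀ x : X, φ x = (g x).re}
      zero_mem' := ⟨fun _ => 0, continuousOn_const, differentiableOn_const _, by simp⟩
      add_mem' := by
        rintro φ ψ ⟨g, h1, h2, h3⟩ ⟨g', h1', h2', h3'⟩
        exact ⟨fun z => g z + g' z, h1.add h1', h2.add h2', fun x => by simp [h3, h3']⟩
      smul_mem' := by
        rintro c φ ⟨g, h1, h2, h3⟩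
        exact ⟨fun z => (c : ℂ) * g z, h1.const_mul _, h2.const_mul _,
          fun x => by simp [h3]⟩ }
  let ev : C(X, ℝ) →ₗ[ℝ] ℝ :=
    { toFun := fun φ => φ pX
      map_add' := fun _ _ => rfl
      map_smul' := fun _ _ => rfl }
  let N : C(X, ℝ) → ℝ := fun φ => sSup (φ '' S)
  have hbdd : ∀ φ : C(X, ℝ), BddAbove (φ '' S) := fun φ =>
    (hS.image φ.continuous).bddAbove
  have hle : ∀ (φ : C(X, ℝ)) x, x ∈ S → φ x ≤ N φ := fun φ x hx =>
    le_csSup (hbdd φ) (mem_image_of_mem _ hx)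
  have hN : ∀ (φ : C(X, ℝ)) C, (∀ x ∈ S, φ x ≤ C) → N φ ≤ C := fun φ C h =>
    csSup_le (hSne.image _) (by rintro _ ⟨x, hx, rfl⟩; exact h x hx)
  obtain ⟨F, hF, hFN⟩ := exists_extension_of_le_sublinear ⟨W, ev.domRestrict W⟩ N
    (fun c hc φ => by
      refine le_antisymm (hN _ _ fun x hx => ?_) ?_
      · exact mul_le_mul_of_nonneg_left (hle φ x hx) hc.le
      · rw [← le_div_iff₀' hc]
        refine hN _ _ fun x hx => ?_
        rw [le_div_iff₀' hc]
        exact hle (c • φ) x hx)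
    (fun φ ψ => hN _ _ fun x hx => add_le_add (hle φ x hx) (hle ψ x hx))
    (by
      rintro ⟨φ, g, h1, h2, h3⟩
      change φ pX ≤ N φ
      rw [h3]
      refine re_le_of_forall_frontier hb h1 h2 (fun z hz => ?_) (subset_closure hp)
      have := hle φ ⟨z, frontier_subset_closure hz⟩ hz
      rwa [h3] at this)
  obtain ⟨μ, hμf, hμ⟩ := exists_measure_of_positive F (fun φ hφ => by
    have := hFN (-φ)
    have h2 : N (-φ) ≤ 0 := hN _ _ fun x hx => by simpa using hφ x
    rw [map_neg] at this
    linarith)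
  have hemb : MeasurableEmbedding (Subtype.val : X → ℂ) :=
    MeasurableEmbedding.subtype_coe isClosed_closure.measurableSet
  have hre : ∀ g : ℂ → ℂ, ContinuousOn g (closure D) → DifferentiableOn ℂ g D →
      ∫ x : X, (g x).re ∂μ = (g p).re := by
    intro g h1 h2
    let φ : C(X, ℝ) := ⟨fun x => (g x).re, continuous_re.comp h1.domRestrict⟩
    have hφ : φ ∈ W := ⟨g, h1, h2, fun _ => rfl⟩
    exact (hμ φ).trans (hF ⟨φ, hφ⟩)
  refine ⟨μ.map Subtype.val, inferInstance, ?_, fun g h1 h2 => ?_⟩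
  · rw [hemb.ae_map_iff]
    let φ : C(X, ℝ) := ⟨fun x => Metric.infDist x.1 (frontier D), by fun_prop⟩
    have hφ0 : ∀ x ∈ S, φ x = 0 := fun x hx => Metric.infDist_zero_of_mem hx
    have hFφ : F φ = 0 := by
      refine le_antisymm ((hFN φ).trans (hN _ _ fun x hx => (hφ0 x hx).le)) ?_
      have := (hFN (-φ)).trans (hN (-φ) 0 fun x hx => by simp [hφ0 x hx])
      rw [map_neg] at this
      linarith
    have h0 : ∫ x, φ x ∂μ = 0 := (hμ φ).trans hFφ
    rw [integral_eq_zero_iff_of_nonneg (f := φ) (fun x => Metric.infDist_nonneg)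
      (φ.continuous.integrable_of_hasCompactSupport (HasCompactSupport.of_compactSpace _))] at h0
    filter_upwards [h0] with x hx
    exact (isClosed_frontier.mem_iff_infDist_zero hne).2 hx
  · rw [hemb.integral_map]
    have hc : Continuous fun x : X => g x := h1.domRestrict
    have hi : Integrable (fun x : X => g x) μ :=
      hc.integrable_of_hasCompactSupport (HasCompactSupport.of_compactSpace _)
    refine Complex.ext ?_ ?_
    · rw [← hre g h1 h2]
      exact (reCLM.integral_comp_comm hi).symm
    · have := hre (fun z => -I * g z) (h1.const_mul _) (h2.const_mul _)
      simp at this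
      rw [← this]
      exact (imCLM.integral_comp_comm hi).symm

lemma IsRepresenting.conj {D : Set ℂ} (hD : IsOpen D) {p : ℂ} {μ : Measure ℂ}
    (h : IsRepresenting D p μ) :
    IsRepresenting (conjCLE '' D) (conjCLE p) (μ.map conjCLE) := by
  have hfin := h.finite
  have hm : MeasurableEmbedding conjCLE := conjCLE.toHomeomorph.measurableEmbedding
  have hcl : closure (conjCLE '' D) = conjCLE '' closure D :=
    (conjCLE.toHomeomorph.image_closure D).symm
  have hfr : frontier (conjCLE '' D) = conjCLE '' frontier D :=
    (conjCLE.toHomeomorph.image_frontier D).symm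
  refine ⟨inferInstance, ?_, fun g h1 h2 => ?_⟩
  · rw [hm.ae_map_iff, hfr]
    exact h.ae_mem.mono fun τ hτ => mem_image_of_mem _ hτ
  · rw [hm.integral_map]
    have h3 := h.integral_eq (fun z => conjCLE (g (conjCLE z))) ?_ ?_
    · have h4 : ∫ x, conjCLE (g (conjCLE x)) ∂μ = conjCLE (∫ x, g (conjCLE x) ∂μ) :=
        integral_conj
      rw [h4] at h3
      exact conjCLE.injective h3
    · rw [hcl] at h1
      exact conjCLE.continuous.comp_continuousOn
        (h1.comp conjCLE.continuous.continuousOn (mapsTo_image _ _))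
    · intro z hz
      have h4 : IsOpen (conjCLE '' D) := conjCLE.toHomeomorph.isOpenMap _ hD
      have h5 := (h2.differentiableAt (h4.mem_nhds (mem_image_of_mem _ hz))).conj_conj
      simp only [conjCLE_apply, conj_conj] at h5
      exact h5.differentiableWithinAt

section

/-- The family `G t` consists of the holomorphic extensions to `D` of the boundary functions
`ζ ↦ f (ζ + I * t)`. -/
structure IsFamily (D : Set ℂ) (a b : ℝ) (f : ℂ → ℂ) (G : ℝ → ℂ → ℂ) : Prop where
  continuousOn : ContinuousOn (fun q : ℝ × ℂ => G q.1 q.2) (Icc a b ×ˢ closure D)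
  differentiableOn : ∀ t ∈ Icc a b, DifferentiableOn ℂ (G t) D
  eq : ∀ t ∈ Icc a b, ∀ ζ ∈ frontier D, G t ζ = f (ζ + I * t)

lemma IsFamily.continuousOn_apply {D : Set ℂ} {a b : ℝ} {f : ℂ → ℂ} {G : ℝ → ℂ → ℂ}
    (h : IsFamily D a b f G) {t : ℝ} (ht : t ∈ Icc a b) : ContinuousOn (G t) (closure D) :=
  h.continuousOn.comp (f := fun ζ => (t, ζ)) (by fun_prop) fun _ hζ => ⟨ht, hζ⟩

lemma exists_isFamily {D : Set ℂ} (hb : Bornology.IsBounded D) {a b : ℝ} {f : ℂ → ℂ}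
    (hf : ContinuousOn f (⋃ t ∈ Icc a b, (fun ζ => ζ + I * (t : ℂ)) '' frontier D))
    (hext : ∀ t ∈ Icc a b, ∃ g : ℂ → ℂ,
      ContinuousOn g ((fun ζ => ζ + I * (t : ℂ)) '' closure D) ∧
      DifferentiableOn ℂ g ((fun ζ => ζ + I * (t : ℂ)) '' D) ∧
      ∀ ζ ∈ (fun ζ => ζ + I * (t : ℂ)) '' frontier D, g ζ = f ζ) :
    ∃ G, IsFamily D a b f G := by
  choose! g h1 h2 h3 using hext
  let G : ℝ → ℂ → ℂ := fun t ζ => g t (ζ + I * t)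
  have hc : ∀ t ∈ Icc a b, ContinuousOn (G t) (closure D) := fun t ht =>
    (h1 t ht).comp (by fun_prop) (mapsTo_image _ _)
  have hd : ∀ t ∈ Icc a b, DifferentiableOn ℂ (G t) D := fun t ht =>
    (h2 t ht).comp (by fun_prop) (mapsTo_image _ _)
  have he : ∀ t ∈ Icc a b, ∀ ζ ∈ frontier D, G t ζ = f (ζ + I * t) := fun t ht ζ hζ =>
    h3 t ht _ (mem_image_of_mem _ hζ)
  refine ⟨G, ?_, hd, he⟩
  have hK : IsCompact (Icc a b ×ˢ frontier D) :=
    isCompact_Icc.prod (hb.isCompact_closure.of_isClosed_subset isClosed_frontier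
      frontier_subset_closure)
  have hu : UniformContinuousOn (fun q : ℝ × ℂ => f (q.2 + I * q.1)) (Icc a b ×ˢ frontier D) := by
    refine hK.uniformContinuousOn_of_continuous (hf.comp (by fun_prop) ?_)
    rintro ⟨t, ζ⟩ ⟨ht, hζ⟩
    exact mem_iUnion₂.2 ⟨t, ht, mem_image_of_mem _ hζ⟩
  rintro ⟨t₀, ζ₀⟩ ⟨ht₀, hζ₀⟩
  rw [Metric.continuousWithinAt_iff]
  intro ε hε
  obtain ⟨δ, hδ, hδ'⟩ := Metric.uniformContinuousOn_iff.1 hu (ε / 3) (by positivity)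
  obtain ⟨δ', hδp, hδ''⟩ := Metric.continuousWithinAt_iff.1 (hc t₀ ht₀ ζ₀ hζ₀) (ε / 3)
    (by positivity)
  refine ⟨min δ δ', by positivity, ?_⟩
  rintro ⟨t, ζ⟩ ⟨ht, hζ⟩ hdist
  rw [Prod.dist_eq, max_lt_iff] at hdist
  simp only [lt_min_iff] at hdist
  have e1 : dist (G t₀ ζ) (G t₀ ζ₀) < ε / 3 := hδ'' hζ hdist.2.2
  have e2 : ‖G t ζ - G t₀ ζ‖ ≤ ε / 3 := by
    refine Complex.norm_le_of_forall_mem_frontier_norm_le hb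
      (f := fun z => G t z - G t₀ z) ⟨(hd t ht).sub (hd t₀ ht₀), (hc t ht).sub (hc t₀ ht₀)⟩
      (fun z hz => ?_) hζ
    rw [he t ht z hz, he t₀ ht₀ z hz, ← dist_eq_norm]
    exact (hδ' (t, z) ⟨ht, hz⟩ (t₀, z) ⟨ht₀, hz⟩ (by simpa [Prod.dist_eq] using hdist.1.1)).le
  calc dist (G t ζ) (G t₀ ζ₀) ≤ dist (G t ζ) (G t₀ ζ) + dist (G t₀ ζ) (G t₀ ζ₀) := dist_triangle _ _ _
    _ < ε := by rw [dist_eq_norm (G t ζ)]; linarith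

/-- The average of the translates of `G t * kernel μ p`. -/
noncomputable def average (D : Set ℂ) (a b : ℝ) (G : ℝ → ℂ → ℂ) (μ : Measure ℂ) (p z : ℂ) : ℂ :=
  ∫ t : ℝ, (Icc a b ×ˢ D).indicator (fun q : ℝ × ℂ => G q.1 q.2 * kernel μ p q.2) (t, z - I * t)

lemma average_eq_zero {D : Set ℂ} {a b : ℝ} {G : ℝ → ℂ → ℂ} {μ : Measure ℂ} {p z : ℂ}
    (hz : ∀ ζ ∈ D, ζ.re ≠ z.re) : average D a b G μ p z = 0 := by
  have : ∀ t : ℝ, (Icc a b ×ˢ D).indicator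
      (fun q : ℝ × ℂ => G q.1 q.2 * kernel μ p q.2) (t, z - I * t) = 0 := fun t =>
    indicator_of_notMem (fun h => hz _ h.2 (by simp)) _
  simp [average, this]

lemma measurePreserving_shear :
    MeasurePreserving (fun q : ℝ × ℂ => (q.1, q.2 - I * q.1)) (volume.prod volume)
      (volume.prod volume) :=
  (MeasurePreserving.id (volume : Measure ℝ)).skew_product (g := fun (t : ℝ) (z : ℂ) => z - I * t)
    (by fun_prop) (Eventually.of_forall fun t => by
      have := measurePreserving_sub_right (volume : Measure ℂ) (I * t)
      exact this.map_eq)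

variable {D : Set ℂ} {a b : ℝ} {f : ℂ → ℂ} {G : ℝ → ℂ → ℂ} {μ : Measure ℂ} {p : ℂ}

lemma integrable_family_mul_kernel (hD : IsOpen D) (hb : Bornology.IsBounded D)
    (hp : p ∈ D) (hμ : IsRepresenting D p μ) (hG : IsFamily D a b f G) :
    Integrable ((Icc a b ×ˢ D).indicator fun q : ℝ × ℂ => G q.1 q.2 * kernel μ p q.2)
      (volume.prod volume) := by
  have hms : MeasurableSet (Icc a b ×ˢ D) := measurableSet_Icc.prod hD.measurableSet
  rw [integrable_indicator_iff hms]
  have hK : IsCompact (Icc a b ×ˢ closure D) := isCompact_Icc.prod hb.isCompact_closure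
  have hsub : Icc a b ×ˢ D ⊆ Icc a b ×ˢ closure D := prod_mono_right subset_closure
  obtain ⟨C, hC⟩ := hK.exists_bound_of_continuousOn hG.continuousOn
  refine Integrable.bdd_mul (c := C) ?_
    ((hG.continuousOn.mono hsub).aestronglyMeasurable hms)
    (ae_restrict_of_forall_mem hms fun q hq => hC q (hsub hq))
  rw [← Measure.prod_restrict]
  exact (integrableOn_kernel hD hb hp hμ).comp_snd _

lemma integrable_family_mul_kernel_shear (hD : IsOpen D) (hb : Bornology.IsBounded D)
    (hp : p ∈ D) (hμ : IsRepresenting D p μ) (hG : IsFamily D a b f G) :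
    Integrable (fun q : ℝ × ℂ => (Icc a b ×ˢ D).indicator
      (fun q : ℝ × ℂ => G q.1 q.2 * kernel μ p q.2) (q.1, q.2 - I * q.1))
      (volume.prod volume) :=
  measurePreserving_shear.integrable_comp_of_integrable
    (integrable_family_mul_kernel hD hb hp hμ hG)

lemma integrable_average (hD : IsOpen D) (hb : Bornology.IsBounded D)
    (hp : p ∈ D) (hμ : IsRepresenting D p μ) (hG : IsFamily D a b f G) :
    Integrable (average D a b G μ p) :=
  (integrable_family_mul_kernel_shear hD hb hp hμ hG).integral_prod_right

lemma integral_average_mul_dbar (hD : IsOpen D) (hb : Bornology.IsBounded D)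
    (hp : p ∈ D) (hμ : IsRepresenting D p μ) (hG : IsFamily D a b f G) {χ : ℂ → ℂ}
    (hχ : ContDiff ℝ 1 χ) (hχc : HasCompactSupport χ)
    (hχab : ∀ τ ∈ closure D, ∀ t : ℝ, χ (τ + I * t) ≠ 0 → t ∈ Icc a b) :
    ∫ z, average D a b G μ p z * dbar χ z =
      Real.pi * ((∫ τ, (∫ y : ℝ, f (τ.re + I * y) * χ (τ.re + I * y)) ∂μ) -
        ∫ y : ℝ, G (y - p.im) p * χ (p.re + I * y)) := by
  have hfin := hμ.finite
  have hdχ := continuous_dbar hχ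
  have hms : MeasurableSet (Icc a b ×ˢ D) := measurableSet_Icc.prod hD.measurableSet
  set H : ℝ × ℂ → ℂ := (Icc a b ×ˢ D).indicator fun q => G q.1 q.2 * kernel μ p q.2 with hH
  obtain ⟨M, hM⟩ : ∃ M, ∀ z, ‖dbar χ z‖ ≤ M := by
    refine HasCompactSupport.exists_bound_of_continuous (hχc.mono' ?_) hdχ
    intro z hz
    by_contra h
    exact hz (dbar_eq_zero_of_notMem_tsupport h)
  have hint : Integrable (fun q : ℝ × ℂ => H (q.1, q.2 - I * q.1) * dbar χ q.2)
      (volume.prod volume) :=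
    (integrable_family_mul_kernel_shear hD hb hp hμ hG).mul_bdd (c := M)
      (by fun_prop) (Eventually.of_forall fun q => hM _)
  have step1 : ∫ z, average D a b G μ p z * dbar χ z =
      ∫ t : ℝ, ∫ z, H (t, z - I * t) * dbar χ z := by
    rw [integral_integral_swap hint]
    simp_rw [average, ← integral_mul_const]
    rfl
  have step2 : ∀ t : ℝ, ∫ z, H (t, z - I * t) * dbar χ z =
      (Icc a b).indicator (fun t : ℝ => Real.pi * ((∫ τ, G t τ * χ (τ + I * t) ∂μ) -
        G t p * χ (p + I * t))) t := by
    intro t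
    by_cases ht : t ∈ Icc a b
    · rw [indicator_of_mem ht,
        ← setIntegral_mul_dbar_mul_kernel hD hb hp hμ (hG.continuousOn_apply ht)
          (hG.differentiableOn t ht) (χ := fun z => χ (z + I * t)) (by fun_prop),
        ← integral_indicator hD.measurableSet,
        ← integral_sub_right_eq_self (D.indicator _) (I * (t : ℂ))]
      congr 1
      ext z
      by_cases hz : z - I * t ∈ D
      · simp [hH, hz, ht, dbar_comp_add_const]
      · simp [hH, hz]
    · simp [hH, ht]
  have hcl : ∀ᵐ τ ∂μ, τ ∈ closure D := hμ.ae_mem.mono fun τ h => frontier_subset_closure h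
  have hint2 : Integrable (fun q : ℝ × ℂ => G q.1 q.2 * χ (q.2 + I * q.1))
      ((volume.restrict (Icc a b)).prod μ) := by
    have hK : IsCompact (Icc a b ×ˢ closure D) := isCompact_Icc.prod hb.isCompact_closure
    have h1 : IntegrableOn (fun q : ℝ × ℂ => G q.1 q.2 * χ (q.2 + I * q.1))
        (Icc a b ×ˢ closure D) (volume.prod μ) := by
      refine ContinuousOn.integrableOn_compact hK ?_
      have := hχ.continuous
      exact hG.continuousOn.mul (by fun_prop)
    rwa [IntegrableOn, ← Measure.prod_restrict, Measure.restrict_eq_self_of_ae_mem hcl] at h1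
  have hvert : ∀ (F : ℝ → ℂ) (τ : ℂ), τ ∈ closure D →
      ∫ t in Icc a b, F t * χ (τ + I * t) = ∫ y : ℝ, F (y - τ.im) * χ (τ.re + I * y) := by
    intro F τ hτ
    rw [setIntegral_eq_integral_of_forall_compl_eq_zero, ← integral_sub_right_eq_self _ τ.im]
    · congr 1
      ext y
      congr 2
      apply Complex.ext <;> simp
    · intro t ht
      rw [not_imp_comm.1 (hχab τ hτ t) ht, mul_zero]
  have step3 : ∫ t in Icc a b, ∫ τ, G t τ * χ (τ + I * t) ∂μ =
      ∫ τ, (∫ y : ℝ, f (τ.re + I * y) * χ (τ.re + I * y)) ∂μ := by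
    rw [integral_integral_swap hint2]
    refine integral_congr_ae ?_
    filter_upwards [hμ.ae_mem] with τ hτ
    have h1 : ∫ t in Icc a b, G t τ * χ (τ + I * t) =
        ∫ t in Icc a b, (fun t : ℝ => f (τ + I * t)) t * χ (τ + I * t) :=
      setIntegral_congr_fun measurableSet_Icc fun t ht => by
        simp only [hG.eq t ht τ hτ]
    rw [h1, hvert _ τ (frontier_subset_closure hτ)]
    congr 1
    ext y
    congr 2
    apply Complex.ext <;> simp
  rw [step1]
  simp_rw [step2]
  rw [integral_indicator measurableSet_Icc, integral_const_mul, integral_sub, step3,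
    hvert (fun t => G t p) p (subset_closure hp)]
  · exact hint2.integral_prod_left
  · have := hχ.continuous
    exact ContinuousOn.integrableOn_compact isCompact_Icc
      ((hG.continuousOn.comp (f := fun t => (t, p)) (by fun_prop)
        fun t ht => ⟨ht, subset_closure hp⟩).mul (by fun_prop))

end

section WeaklyHolomorphic

variable {m : ℂ → ℂ}

/-- The mollification of `m` by a bump function. -/
noncomputable def mollify (φ : ContDiffBump (0 : ℂ)) (m : ℂ → ℂ) (z : ℂ) : ℂ :=
  ∫ w, (φ.normed volume (z - w) : ℂ) * m w

lemma mollify_eq_convolution (φ : ContDiffBump (0 : ℂ)) (m : ℂ → ℂ) (z : ℂ) :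
    mollify φ m z = (MeasureTheory.convolution (φ.normed volume) m
      (ContinuousLinearMap.lsmul ℝ ℝ) volume) z := by
  rw [convolution_eq_swap]
  simp [mollify]

lemma tsupport_bump_sub (φ : ContDiffBump (0 : ℂ)) (z : ℂ) :
    tsupport (fun w => (φ.normed volume (z - w) : ℂ)) ⊆ Metric.closedBall z φ.rOut := by
  refine closure_minimal (fun w hw => ?_) Metric.isClosed_closedBall
  have h1 : φ.normed volume (z - w) ≠ 0 := by
    intro h
    exact hw (by simp [h])
  have h2 : z - w ∈ Function.support (φ.normed volume) := h1
  rw [φ.support_normed_eq, Metric.mem_ball, dist_zero_right] at h2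
  rw [Metric.mem_closedBall, dist_comm, dist_eq_norm]
  exact h2.le

lemma mollify_eq_zero {φ : ContDiffBump (0 : ℂ)} {z : ℂ} {r : ℝ} {z₀ : ℂ}
    (h : ∀ᵐ w, w ∈ Metric.ball z₀ r → m w = 0) (hz : dist z z₀ + φ.rOut < r) :
    mollify φ m z = 0 := by
  refine integral_eq_zero_of_ae ?_
  filter_upwards [h] with w hw
  by_cases h0 : (φ.normed volume (z - w) : ℂ) = 0
  · simp [h0]
  · have := tsupport_bump_sub φ z (subset_tsupport _ h0)
    rw [Metric.mem_closedBall] at this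
    have h2 : dist w z₀ ≤ dist w z + dist z z₀ := dist_triangle _ _ _
    simp [hw (Metric.mem_ball.2 (by linarith))]

lemma differentiableAt_mollify (hm : Integrable m) (φ : ContDiffBump (0 : ℂ)) {z : ℂ}
    (h : ∫ w, m w * dbar (fun w => (φ.normed volume (z - w) : ℂ)) w = 0) :
    DifferentiableAt ℂ (mollify φ m) z := by
  have hφ : ContDiff ℝ 1 (φ.normed (volume : Measure ℂ)) := φ.contDiff_normed
  have hφc : HasCompactSupport (φ.normed (volume : Measure ℂ)) := φ.hasCompactSupport_normed
  let L : ℂ →L[ℝ] ℝ →L[ℝ] ℂ := (ContinuousLinearMap.lsmul ℝ ℝ).flip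
  have hL : mollify φ m = MeasureTheory.convolution m (φ.normed volume) L volume := by
    ext z
    rw [mollify_eq_convolution, convolution_flip]
  have hd := hφc.hasFDerivAt_convolution_right L hm.locallyIntegrable hφ z
  rw [← hL] at hd
  have hdv : ∀ v : ℂ, fderiv ℝ (mollify φ m) z v =
      ∫ w, (fderiv ℝ (φ.normed volume) (z - w) v : ℂ) * m w := by
    intro v
    rw [hd.fderiv, convolution_precompR_apply L hm.locallyIntegrable (hφc.fderiv ℝ)
      (hφ.continuous_fderiv one_ne_zero)]
    simp [convolution, L]
  refine differentiableAt_of_dbar_eq_zero hd.differentiableAt ?_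
  have hfc := hφ.continuous_fderiv one_ne_zero
  obtain ⟨C, hC⟩ := (hφc.fderiv ℝ).exists_bound_of_continuous hfc
  have hint : ∀ v : ℂ, Integrable fun w => (fderiv ℝ (φ.normed volume) (z - w) v : ℂ) * m w := by
    intro v
    refine hm.bdd_mul (c := C * ‖v‖) (by fun_prop) (Eventually.of_forall fun w => ?_)
    rw [norm_real]
    exact (ContinuousLinearMap.le_opNorm _ _).trans
      (mul_le_mul_of_nonneg_right (hC _) (norm_nonneg _))
  rw [dbar, hdv, hdv, ← integral_const_mul, ← integral_add (hint _) ((hint _).const_mul _),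
    ← integral_div, ← neg_eq_zero, ← integral_neg]
  refine Eq.trans ?_ h
  congr 1
  ext w
  have h1 : ∀ v, fderiv ℝ (fun w => (φ.normed volume (z - w) : ℂ)) w v =
      -(fderiv ℝ (φ.normed volume) (z - w) v : ℂ) := by
    intro v
    have e1 : HasFDerivAt (fun w : ℂ => z - w) (-ContinuousLinearMap.id ℝ ℂ) w := by
      simpa using (hasFDerivAt_id (𝕜 := ℝ) w).const_sub z
    have e2 := (hφ.differentiable one_ne_zero (z - w)).hasFDerivAt.comp w e1
    have e3 := ofRealCLM.hasFDerivAt.comp w e2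
    rw [show (fun w => (φ.normed volume (z - w) : ℂ)) =
      ofRealCLM ∘ (φ.normed volume ∘ fun w => z - w) from rfl, e3.fderiv]
    simp
  rw [dbar, h1, h1]
  ring

lemma ae_eq_zero_ball_of_dbar {V : Set ℂ} (hm : Integrable m)
    (h : ∀ χ : ℂ → ℂ, ContDiff ℝ 1 χ → HasCompactSupport χ → tsupport χ ⊆ V →
      ∫ z, m z * dbar χ z = 0) {z : ℂ} {R : ℝ} (hR : Metric.ball z R ⊆ V) {z' : ℂ} {r : ℝ}
    (hr : 0 < r) (hz' : z' ∈ Metric.ball z (R / 2)) (h0 : ∀ᵐ w, w ∈ Metric.ball z' r → m w = 0) :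
    ∀ᵐ w, w ∈ Metric.ball z (R / 2) → m w = 0 := by
  have hR0 : 0 < R / 2 := Metric.pos_of_mem_ball hz'
  let φ : ℕ → ContDiffBump (0 : ℂ) := fun n =>
    { rIn := min r (R / 2) / 2 / (n + 2)
      rOut := min r (R / 2) / (n + 2)
      rIn_pos := by positivity
      rIn_lt_rOut := by
        have : 0 < min r (R / 2) := by positivity
        gcongr
        linarith }
  have hφ0 : ∀ n, (φ n).rOut ≤ min r (R / 2) / 2 := by
    intro n
    have : 0 < min r (R / 2) := by positivity
    change min r (R / 2) / (n + 2) ≤ _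
    gcongr
    linarith [n.cast_nonneg (α := ℝ)]
  have hφr : ∀ n, (φ n).rOut ≤ r / 2 := fun n =>
    (hφ0 n).trans (by linarith [min_le_left r (R / 2)])
  have hφR : ∀ n, (φ n).rOut < R / 2 := fun n =>
    (hφ0 n).trans_lt (by linarith [min_le_right r (R / 2)])
  have key : ∀ n, ∀ w ∈ Metric.ball z (R / 2), mollify (φ n) m w = 0 := by
    intro n
    have hd : DifferentiableOn ℂ (mollify (φ n) m) (Metric.ball z (R / 2)) := by
      intro w hw
      refine (differentiableAt_mollify hm (φ n) (h _ ?_ ?_ ?_)).differentiableWithinAt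
      · exact ofRealCLM.contDiff.comp ((φ n).contDiff_normed.comp (contDiff_const.sub contDiff_id))
      · exact HasCompactSupport.of_support_subset_isCompact (isCompact_closedBall w (φ n).rOut)
          ((subset_tsupport _).trans (tsupport_bump_sub _ _))
      · refine (tsupport_bump_sub _ _).trans (Subset.trans ?_ hR)
        refine (Metric.closedBall_subset_ball (hφR n)).trans (Metric.ball_subset_ball' ?_)
        rw [Metric.mem_ball] at hw
        linarith
    refine (hd.analyticOnNhd Metric.isOpen_ball).eqOn_zero_of_preconnected_of_eventuallyEq_zero
      (convex_ball _ _).isPreconnected hz' ?_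
    filter_upwards [Metric.ball_mem_nhds z' (half_pos hr)] with w hw
    refine mollify_eq_zero h0 ?_
    rw [Metric.mem_ball] at hw
    linarith [hφr n]
  have hlim : Tendsto (fun n => (φ n).rOut) atTop (𝓝 0) := by
    refine Tendsto.div_atTop tendsto_const_nhds ?_
    exact tendsto_atTop_add_const_right _ _ tendsto_natCast_atTop_atTop
  have hae := ContDiffBump.ae_convolution_tendsto_right_of_locallyIntegrable (K := 2) hlim
    (Eventually.of_forall fun n => by
      change min r (R / 2) / (n + 2) ≤ 2 * (min r (R / 2) / 2 / (n + 2))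
      apply le_of_eq
      ring) hm.locallyIntegrable
  filter_upwards [hae] with w hw hwb
  refine tendsto_nhds_unique hw ?_
  refine tendsto_const_nhds.congr fun n => ?_
  rw [← mollify_eq_convolution, key n w hwb]

/-- An integrable function which is weakly holomorphic on a connected open set and vanishes on a
nonempty open subset vanishes almost everywhere. -/
lemma ae_eq_zero_of_dbar {V : Set ℂ} (hV : IsOpen V) (hVc : IsPreconnected V) (hm : Integrable m)
    (h : ∀ χ : ℂ → ℂ, ContDiff ℝ 1 χ → HasCompactSupport χ → tsupport χ ⊆ V →
      ∫ z, m z * dbar χ z = 0) {W : Set ℂ} (hW : IsOpen W) (hWV : (V ∩ W).Nonempty)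
    (h0 : ∀ z ∈ W, m z = 0) : ∀ᵐ w, w ∈ V → m w = 0 := by
  let A : Set ℂ := {z | ∃ r > 0, ∀ᵐ w, w ∈ Metric.ball z r → m w = 0}
  have hA : IsOpen A := by
    rw [Metric.isOpen_iff]
    rintro z ⟨r, hr, hz⟩
    refine ⟨r / 2, half_pos hr, fun w hw => ⟨r / 2, half_pos hr, ?_⟩⟩
    filter_upwards [hz] with y hy hyw
    refine hy (Metric.ball_subset_ball' ?_ hyw)
    rw [Metric.mem_ball] at hw
    linarith
  have hWA : W ⊆ A := by
    intro z hz
    obtain ⟨r, hr, h1⟩ := Metric.isOpen_iff.1 hW z hz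
    exact ⟨r, hr, Eventually.of_forall fun w hw => h0 w (h1 hw)⟩
  have hVA : V ⊆ A := by
    refine hVc.subset_of_closure_inter_subset hA (hWV.mono (inter_subset_inter_right _ hWA)) ?_
    rintro z ⟨hzA, hzV⟩
    obtain ⟨R, hR, hRV⟩ := Metric.isOpen_iff.1 hV z hzV
    obtain ⟨z', ⟨r, hr, hz'⟩, hd⟩ := Metric.mem_closure_iff.1 hzA (R / 2) (half_pos hR)
    rw [dist_comm] at hd
    exact ⟨R / 2, half_pos hR, ae_eq_zero_ball_of_dbar hm h hRV hr hd hz'⟩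
  choose! r hr hr0 using fun z (hz : z ∈ V) => hVA hz
  obtain ⟨T, hTV, hTc, hT⟩ := TopologicalSpace.countable_cover_nhdsWithin
    (f := fun z => Metric.ball z (r z)) (s := V)
    (fun z hz => mem_nhdsWithin_of_mem_nhds (Metric.ball_mem_nhds _ (hr z hz)))
  have : ∀ᵐ w, ∀ z ∈ T, w ∈ Metric.ball z (r z) → m w = 0 :=
    (ae_ball_iff hTc).2 fun z hz => hr0 z (hTV hz)
  filter_upwards [this] with w hw hwV
  obtain ⟨z, hz, hwz⟩ := mem_iUnion₂.1 (hT hwV)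
  exact hw z hz hwz

end WeaklyHolomorphic

section

/-- The position of the domain with respect to the graph of `lam`, with a uniform margin `δ`. -/
structure Setting (D : Set ℂ) (α β a b c d : ℝ) (lam : ℝ → ℝ) (δ : ℝ) : Prop where
  isOpen : IsOpen D
  isBounded : Bornology.IsBounded D
  isConnected : IsConnected D
  continuous : Continuous lam
  pos : 0 < δ
  re_mem : ∀ ζ ∈ closure D, ζ.re ∈ Icc α β
  below : ∀ ζ ∈ closure D, ζ.im + a + δ ≤ lam ζ.re
  above : ∀ ζ ∈ closure D, lam ζ.re + δ ≤ ζ.im + b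
  below_conj : ∀ ζ ∈ closure D, -ζ.im + c + δ ≤ lam ζ.re
  above_conj : ∀ ζ ∈ closure D, lam ζ.re + δ ≤ -ζ.im + d

variable {D : Set ℂ} {α β a b c d δ : ℝ} {lam : ℝ → ℝ}

lemma closure_conj (D : Set ℂ) : closure (conjCLE '' D) = conjCLE '' closure D :=
  (conjCLE.toHomeomorph.image_closure D).symm

lemma frontier_conj (D : Set ℂ) : frontier (conjCLE '' D) = conjCLE '' frontier D :=
  (conjCLE.toHomeomorph.image_frontier D).symm

lemma isPreconnected_graph_neighborhood (hlam : Continuous lam) (δ : ℝ) {s : Set ℝ}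
    (hs : Convex ℝ s) : IsPreconnected {z : ℂ | z.re ∈ s ∧ |z.im - lam z.re| < δ} := by
  have : {z : ℂ | z.re ∈ s ∧ |z.im - lam z.re| < δ} =
      (fun q : ℝ × ℝ => (q.1 : ℂ) + I * ((lam q.1 + q.2 : ℝ) : ℂ)) '' (s ×ˢ Ioo (-δ) δ) := by
    ext z
    constructor
    · rintro ⟨h1, h2⟩
      refine ⟨(z.re, z.im - lam z.re), ⟨h1, abs_lt.1 h2⟩, ?_⟩
      apply Complex.ext <;> simp
    · rintro ⟨⟨x, r⟩, ⟨h1, h2⟩, rfl⟩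
      simp only [mem_ofPred_eq, add_re, ofReal_re, mul_re, I_re, I_im, ofReal_im, add_im, mul_im]
      simpa [abs_lt] using ⟨h1, h2⟩
  rw [this]
  have hc : Continuous fun q : ℝ × ℝ => (q.1 : ℂ) + I * ((lam q.1 + q.2 : ℝ) : ℂ) := by fun_prop
  exact (hs.prod (convex_Ioo _ _)).isPreconnected.image _ hc.continuousOn

lemma isOpen_graph_neighborhood (hlam : Continuous lam) (δ : ℝ) {s : Set ℝ}
    (hs : IsOpen s) : IsOpen {z : ℂ | z.re ∈ s ∧ |z.im - lam z.re| < δ} :=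
  (hs.preimage continuous_re).inter
    (isOpen_lt (f := fun z : ℂ => |z.im - lam z.re|) (by fun_prop) continuous_const)

lemma Setting.mem_Icc (h : Setting D α β a b c d lam δ) {ζ : ℂ} (hζ : ζ ∈ closure D) {t : ℝ}
    (ht : |ζ.im + t - lam ζ.re| < δ) : t ∈ Icc a b := by
  have := h.below ζ hζ
  have := h.above ζ hζ
  rw [abs_lt] at ht
  constructor <;> linarith

lemma Setting.mem_Icc_conj (h : Setting D α β a b c d lam δ) {ζ : ℂ} (hζ : ζ ∈ closure D) {t : ℝ}
    (ht : |-ζ.im + t - lam ζ.re| < δ) : t ∈ Icc c d := by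
  have := h.below_conj ζ hζ
  have := h.above_conj ζ hζ
  rw [abs_lt] at ht
  constructor <;> linarith

lemma exists_test_function (hlam : Continuous lam) (x₀ : ℝ) {g : ℝ → ℝ}
    (hg : ContDiff ℝ 1 g) (hgc : HasCompactSupport g)
    (hgs : tsupport g ⊆ Ioo (lam x₀ - δ) (lam x₀ + δ)) :
    ∃ χ : ℂ → ℂ, ContDiff ℝ 1 χ ∧ HasCompactSupport χ ∧
      tsupport χ ⊆ {z | |z.im - lam z.re| < δ} ∧ ∀ y : ℝ, χ (x₀ + I * y) = g y := by
  obtain ⟨ρ, hρ, hρ'⟩ : ∃ ρ > 0, ∀ x ∈ Metric.closedBall x₀ ρ, ∀ y ∈ tsupport g,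
      |y - lam x| < δ := by
    have h1 : ∀ᶠ x in 𝓝 x₀, ∀ y ∈ tsupport g, |y - lam x| < δ := by
      refine hgc.isCompact.eventually_forall_of_forall_eventually fun y hy => ?_
      have h2 := hgs hy
      have h3 : |y - lam x₀| < δ := by
        rw [abs_lt]
        constructor <;> linarith [h2.1, h2.2]
      have h4 : ContinuousAt (fun q : ℝ × ℝ => |q.2 - lam q.1|) (x₀, y) := by fun_prop
      exact h4.eventually (gt_mem_nhds h3)
    obtain ⟨ρ, hρ, h2⟩ := Metric.eventually_nhds_iff_ball.1 h1
    exact ⟨ρ / 2, half_pos hρ, fun x hx => h2 x (Metric.closedBall_subset_ball (half_lt_self hρ) hx)⟩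
  let φ : ContDiffBump x₀ := ⟨ρ / 2, ρ, half_pos hρ, half_lt_self hρ⟩
  have hsub : tsupport (fun z : ℂ => (φ z.re * g z.im : ℂ)) ⊆
      {z | z.re ∈ Metric.closedBall x₀ ρ ∧ z.im ∈ tsupport g} := by
    refine closure_minimal (fun z hz => ?_) ((Metric.isClosed_closedBall.preimage continuous_re).inter
      ((isClosed_tsupport g).preimage continuous_im))
    have hz' : (φ z.re : ℂ) ≠ 0 ∧ (g z.im : ℂ) ≠ 0 := mul_ne_zero_iff.1 hz
    constructor
    · have : z.re ∈ tsupport φ := subset_tsupport _ fun h => hz'.1 (by simp [h])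
      rwa [φ.tsupport_eq] at this
    · exact subset_tsupport _ fun h => hz'.2 (by simp [h])
  refine ⟨fun z => φ z.re * g z.im, ?_, ?_, fun z hz => ?_, fun y => ?_⟩
  · exact (ofRealCLM.contDiff.comp (φ.contDiff.comp reCLM.contDiff)).mul
      (ofRealCLM.contDiff.comp (hg.comp imCLM.contDiff))
  · refine HasCompactSupport.of_support_subset_isCompact
      ((isCompact_closedBall x₀ ρ).reProdIm hgc.isCompact) ((subset_tsupport _).trans hsub)
  · exact hρ' _ (hsub hz).1 _ (hsub hz).2
  · have : φ x₀ = 1 := φ.one_of_mem_closedBall (Metric.mem_closedBall_self (half_pos hρ).le)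
    simp [this]

variable {f : ℂ → ℂ} {G G' : ℝ → ℂ → ℂ}

lemma Setting.integral_difference (h : Setting D α β a b c d lam δ) (hG : IsFamily D a b f G)
    (hG' : IsFamily (conjCLE '' D) c d f G') {p : ℂ} (hp : p ∈ D) {μ : Measure ℂ}
    (hμ : IsRepresenting D p μ) {χ : ℂ → ℂ} (hχ : ContDiff ℝ 1 χ) (hχc : HasCompactSupport χ)
    (hχU : tsupport χ ⊆ {z | |z.im - lam z.re| < δ}) :
    ∫ z, (average D a b G μ p z - average (conjCLE '' D) c d G' (μ.map conjCLE) (conjCLE p) z) *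
      dbar χ z = Real.pi * ∫ y : ℝ, (G' (y + p.im) (conjCLE p) - G (y - p.im) p) *
        χ (p.re + I * y) := by
  have hD' : IsOpen (conjCLE '' D) := conjCLE.toHomeomorph.isOpenMap _ h.isOpen
  have hb' : Bornology.IsBounded (conjCLE '' D) :=
    h.isBounded.image (conjCLE : ℂ →L[ℝ] ℂ)
  have hp' : conjCLE p ∈ conjCLE '' D := mem_image_of_mem _ hp
  have hpc := subset_closure hp
  have hχU' : ∀ z, χ z ≠ 0 → |z.im - lam z.re| < δ := fun z hz => hχU (subset_tsupport _ hz)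
  have hm : MeasurableEmbedding conjCLE := conjCLE.toHomeomorph.measurableEmbedding
  have hdχ := continuous_dbar hχ
  obtain ⟨M, hM⟩ : ∃ M, ∀ z, ‖dbar χ z‖ ≤ M := by
    refine HasCompactSupport.exists_bound_of_continuous (hχc.mono' ?_) hdχ
    intro z hz
    by_contra h
    exact hz (dbar_eq_zero_of_notMem_tsupport h)
  have hK : IsCompact {y : ℝ | (p.re + I * y : ℂ) ∈ tsupport χ} := by
    refine (hχc.isCompact.image continuous_im).of_isClosed_subset
      ((isClosed_tsupport χ).preimage (by fun_prop)) fun y hy => ⟨_, hy, by simp⟩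
  have hint : ∀ F : ℝ → ℂ, ContinuousOn F {y : ℝ | (p.re + I * y : ℂ) ∈ tsupport χ} →
      Integrable fun y : ℝ => F y * χ (p.re + I * y) := by
    intro F hF
    have := hχ.continuous
    rw [← integrableOn_iff_integrable_of_support_subset
      (s := {y : ℝ | (p.re + I * y : ℂ) ∈ tsupport χ})]
    · exact (hF.mul (by fun_prop)).integrableOn_compact hK
    · intro y hy
      exact subset_tsupport _ (right_ne_zero_of_mul hy)
  simp_rw [sub_mul]
  rw [integral_sub, integral_sub,
    integral_average_mul_dbar h.isOpen h.isBounded hp hμ hG hχ hχc,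
    integral_average_mul_dbar hD' hb' hp' (hμ.conj h.isOpen) hG' hχ hχc, hm.integral_map]
  · simp
    ring
  · rw [closure_conj]
    rintro _ ⟨τ, hτ, rfl⟩ t ht
    exact h.mem_Icc_conj hτ (by simpa using hχU' _ ht)
  · exact fun τ hτ t ht => h.mem_Icc hτ (by simpa using hχU' _ ht)
  · refine hint (fun y => G' (y + p.im) (conjCLE p)) (hG'.continuousOn.comp
      (f := fun y : ℝ => (y + p.im, conjCLE p)) (by fun_prop)
      fun y hy => ⟨?_, subset_closure hp'⟩)
    exact h.mem_Icc_conj hpc (by simpa using hχU hy)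
  · refine hint (fun y => G (y - p.im) p) (hG.continuousOn.comp
      (f := fun y : ℝ => (y - p.im, p)) (by fun_prop) fun y hy => ⟨?_, hpc⟩)
    exact h.mem_Icc hpc (by simpa using hχU hy)
  · exact (integrable_average h.isOpen h.isBounded hp hμ hG).mul_bdd (c := M)
      (by fun_prop) (Eventually.of_forall hM)
  · exact (integrable_average hD' hb' hp' (hμ.conj h.isOpen) hG').mul_bdd (c := M)
      (by fun_prop) (Eventually.of_forall hM)

lemma Setting.families_agree (h : Setting D α β a b c d lam δ) (hG : IsFamily D a b f G)
    (hG' : IsFamily (conjCLE '' D) c d f G') {p : ℂ} (hp : p ∈ D)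
    (hfr : (frontier D).Nonempty) {y : ℝ}
    (hy : |y - lam p.re| < δ) : G (y - p.im) p = G' (y + p.im) (conjCLE p) := by
  obtain ⟨μ, hμ⟩ := exists_isRepresenting h.isBounded hp hfr
  have hD' : IsOpen (conjCLE '' D) := conjCLE.toHomeomorph.isOpenMap _ h.isOpen
  have hb' : Bornology.IsBounded (conjCLE '' D) :=
    h.isBounded.image (conjCLE : ℂ →L[ℝ] ℂ)
  have hp' : conjCLE p ∈ conjCLE '' D := mem_image_of_mem _ hp
  set n : ℂ → ℂ := fun z => average D a b G μ p z -
    average (conjCLE '' D) c d G' (μ.map conjCLE) (conjCLE p) z with hn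
  have hni : Integrable n := (integrable_average h.isOpen h.isBounded hp hμ hG).sub
    (integrable_average hD' hb' hp' (hμ.conj h.isOpen) hG')
  have hn0 : ∀ z : ℂ, z.re ∉ Icc α β → n z = 0 := by
    intro z hz
    have h1 : ∀ ζ ∈ D, ζ.re ≠ z.re := fun ζ hζ he =>
      hz (he ▸ h.re_mem ζ (subset_closure hζ))
    rw [hn]
    simp only
    rw [average_eq_zero h1, average_eq_zero, sub_zero]
    rintro _ ⟨ζ, hζ, rfl⟩
    simpa using h1 ζ hζ
  have side : ∀ (s : Set ℝ) (x : ℝ), IsOpen s → Convex ℝ s → p.re ∉ s → x ∈ s → x ∉ Icc α β →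
      ∀ᵐ z : ℂ, z ∈ {z : ℂ | z.re ∈ s ∧ |z.im - lam z.re| < δ} → n z = 0 := by
    intro s x hs hsc hps hxs hx
    refine ae_eq_zero_of_dbar (W := {z | z.re ∈ (Icc α β)ᶜ}) (isOpen_graph_neighborhood h.continuous δ hs)
      (isPreconnected_graph_neighborhood h.continuous δ hsc) hni (fun χ hχ hχc hχs => ?_)
      (isClosed_Icc.isOpen_compl.preimage continuous_re)
      ⟨x + I * (lam x), ⟨by simpa using ⟨hxs, h.pos⟩, by simpa using hx⟩⟩ (fun z hz => hn0 z hz)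
    rw [h.integral_difference hG hG' hp hμ hχ hχc fun z hz => (hχs hz).2]
    have h1 : ∀ y : ℝ, χ (p.re + I * y) = 0 := fun y =>
      image_eq_zero_of_notMem_tsupport fun hm => hps (by simpa using (hχs hm).1)
    simp [h1]
  have hnU : ∀ᵐ z : ℂ, z ∈ {z : ℂ | |z.im - lam z.re| < δ} → n z = 0 := by
    have hpI := h.re_mem p (subset_closure hp)
    have h1 := side (Iio p.re) (α - 1) isOpen_Iio (convex_Iio _) (by simp)
      (show α - 1 < p.re by linarith [hpI.1]) (fun h => by linarith [h.1])
    have h2 := side (Ioi p.re) (β + 1) isOpen_Ioi (convex_Ioi _) (by simp)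
      (show p.re < β + 1 by linarith [hpI.2]) (fun h => by linarith [h.2])
    have h3 : ∀ᵐ z : ℂ, z.re ≠ p.re := by
      have e1 : ∀ᵐ q : ℝ × ℝ, q.1 ≠ p.re :=
        Measure.quasiMeasurePreserving_fst.ae (compl_mem_ae_iff.2 (measure_singleton p.re))
      exact volume_preserving_equiv_real_prod.quasiMeasurePreserving.ae e1
    filter_upwards [h1, h2, h3] with z hz1 hz2 hz3 hz
    rcases lt_or_gt_of_ne hz3 with h4 | h4
    · exact hz1 ⟨h4, hz⟩
    · exact hz2 ⟨h4, hz⟩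
  set Δ : ℝ → ℂ := fun y => G' (y + p.im) (conjCLE p) - G (y - p.im) p with hΔ
  have hJ : ∀ {y}, y ∈ Ioo (lam p.re - δ) (lam p.re + δ) → |y - lam p.re| < δ := by
    intro y hy
    rw [abs_lt]
    constructor <;> linarith [hy.1, hy.2]
  have hΔc : ContinuousOn Δ (Ioo (lam p.re - δ) (lam p.re + δ)) := by
    refine ContinuousOn.sub ?_ ?_
    · refine hG'.continuousOn.comp (f := fun y : ℝ => (y + p.im, conjCLE p)) (by fun_prop)
        fun y hy => ⟨?_, subset_closure hp'⟩
      exact h.mem_Icc_conj (subset_closure hp) (by simpa using hJ hy)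
    · refine hG.continuousOn.comp (f := fun y : ℝ => (y - p.im, p)) (by fun_prop)
        fun y hy => ⟨?_, subset_closure hp⟩
      exact h.mem_Icc (subset_closure hp) (by simpa using hJ hy)
  have hae : ∀ᵐ y : ℝ, y ∈ Ioo (lam p.re - δ) (lam p.re + δ) → Δ y = 0 := by
    refine isOpen_Ioo.ae_eq_zero_of_integral_contDiff_smul_eq_zero
      (hΔc.locallyIntegrableOn measurableSet_Ioo) fun g hg hgc hgs => ?_
    obtain ⟨χ, h1, h2, h3, h4⟩ := exists_test_function h.continuous p.re (hg.of_le (by simp)) hgc hgs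
    have h5 := h.integral_difference hG hG' hp hμ h1 h2 h3
    rw [integral_eq_zero_of_ae] at h5
    · simp_rw [h4] at h5
      have h6 : (Real.pi : ℂ) ≠ 0 := by simp [Real.pi_ne_zero]
      have h7 := (mul_eq_zero.1 h5.symm).resolve_left h6
      rw [← h7]
      congr 1
      ext y
      rw [real_smul, mul_comm]
    · filter_upwards [hnU] with z hz
      by_cases hz' : z ∈ tsupport χ
      · have := hz (h3 hz')
        simp only [hn] at this
        simp only [this, zero_mul, Pi.zero_apply]
      · simp [dbar_eq_zero_of_notMem_tsupport hz']
  have := Measure.eqOn_open_of_ae_eq (μ := volume) (f := Δ) (g := 0)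
    ((ae_restrict_iff' measurableSet_Ioo).2 hae) isOpen_Ioo hΔc continuousOn_const
    (show y ∈ Ioo (lam p.re - δ) (lam p.re + δ) by
      rw [abs_lt] at hy
      constructor <;> linarith [hy.1, hy.2])
  exact (sub_eq_zero.1 this).symm

end

lemma differentiableOn_intervalIntegral {V : Set ℂ} (hV : IsOpen V) {s₁ s₂ : ℝ} {u : ℂ → ℝ → ℂ}
    (hu : ContinuousOn (fun q : ℂ × ℝ => u q.1 q.2) (V ×ˢ uIcc s₁ s₂))
    (hd : ∀ t ∈ uIcc s₁ s₂, DifferentiableOn ℂ (fun z => u z t) V) :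
    DifferentiableOn ℂ (fun z => ∫ t in s₁..s₂, u z t) V := by
  intro z₁ hz₁
  obtain ⟨R, hR, hRV⟩ := Metric.isOpen_iff.1 hV z₁ hz₁
  set ρ := R / 4 with hρ
  have hρ0 : 0 < ρ := by positivity
  have hsub : Metric.closedBall z₁ (2 * ρ) ⊆ V :=
    (Metric.closedBall_subset_ball (by linarith)).trans hRV
  obtain ⟨C, hC⟩ := ((isCompact_closedBall z₁ (2 * ρ)).prod (isCompact_uIcc (a := s₁)
    (b := s₂))).exists_bound_of_continuousOn (hu.mono (prod_mono_left hsub))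
  have hslice : ∀ z ∈ V, ContinuousOn (u z) (uIcc s₁ s₂) := fun z hz =>
    hu.comp (f := fun t => (z, t)) (by fun_prop) fun t ht => ⟨hz, ht⟩
  have hmeas : ∀ z ∈ V, AEStronglyMeasurable (u z) (volume.restrict (uIoc s₁ s₂)) := fun z hz =>
    ((hslice z hz).mono uIoc_subset_uIcc).aestronglyMeasurable measurableSet_uIoc
  have hdiff : ∀ t ∈ uIcc s₁ s₂, ∀ z ∈ V, HasDerivAt (fun z => u z t) (deriv (fun z => u z t) z) z :=
    fun t ht z hz => ((hd t ht).differentiableAt (hV.mem_nhds hz)).hasDerivAt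
  have hball : Metric.ball z₁ ρ ⊆ V := (Metric.ball_subset_ball (by linarith)).trans hRV
  have := intervalIntegral.hasDerivAt_integral_of_dominated_loc_of_deriv_le (μ := volume)
    (F := u) (F' := fun z t => deriv (fun z => u z t) z) (bound := fun _ => C / ρ)
    (a := s₁) (b := s₂) (Metric.ball_mem_nhds z₁ hρ0)
    (eventually_of_mem (hV.mem_nhds hz₁) hmeas)
    ((hslice z₁ hz₁).intervalIntegrable) ?_ ?_ (by simp) ?_
  · exact this.2.differentiableAt.differentiableWithinAt
  · have hw : Tendsto (fun n : ℕ => z₁ + ((ρ / (n + 2) : ℝ) : ℂ)) atTop (𝓝[≠] z₁) := by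
      refine tendsto_nhdsWithin_iff.2 ⟨?_, Eventually.of_forall fun n => ?_⟩
      · have h1 : Tendsto (fun n : ℕ => ρ / ((n : ℝ) + 2)) atTop (𝓝 0) :=
          tendsto_const_nhds.div_atTop
            (tendsto_atTop_add_const_right _ _ tendsto_natCast_atTop_atTop)
        simpa using ((continuous_ofReal.tendsto 0).comp h1).const_add z₁
      · have h1 : ρ / ((n : ℝ) + 2) ≠ 0 := by positivity
        intro h
        exact h1 (ofReal_eq_zero.1 (add_eq_left.1 h))
    refine aestronglyMeasurable_of_tendsto_ae atTop
      (f := fun (n : ℕ) t => slope (fun z => u z t) z₁ (z₁ + ((ρ / (n + 2) : ℝ) : ℂ))) (fun n => ?_) ?_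
    · simp only [slope_def_field]
      refine ((hmeas _ (hball ?_)).sub (hmeas _ hz₁)).mul aestronglyMeasurable_const
      have h1 : ρ / ((n : ℝ) + 2) < ρ :=
        div_lt_self hρ0 (by linarith [n.cast_nonneg (α := ℝ)])
      have h2 : 0 ≤ ρ / ((n : ℝ) + 2) := by positivity
      rw [Metric.mem_ball, dist_self_add_left, norm_real, Real.norm_of_nonneg h2]
      exact h1
    · filter_upwards [ae_restrict_mem measurableSet_uIoc] with t ht
      exact (hasDerivAt_iff_tendsto_slope.1 (hdiff t (uIoc_subset_uIcc ht) z₁ hz₁)).comp hw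
  · refine Eventually.of_forall fun t ht z hz => ?_
    have hsub2 : Metric.closedBall z ρ ⊆ Metric.closedBall z₁ (2 * ρ) :=
      Metric.closedBall_subset_closedBall' (by linarith [Metric.mem_ball.1 hz])
    refine norm_deriv_le_of_forall_mem_sphere_norm_le hρ0 ?_ fun w hw =>
      hC (w, t) ⟨hsub2 (Metric.sphere_subset_closedBall hw), uIoc_subset_uIcc ht⟩
    refine DifferentiableOn.diffContOnCl ?_
    refine (hd t (uIoc_subset_uIcc ht)).mono ?_
    exact Metric.closure_ball_subset_closedBall.trans (hsub2.trans hsub)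
  · exact Eventually.of_forall fun t ht z hz => hdiff t (uIoc_subset_uIcc ht) z (hball hz)

/-- If `u (z, t)` and `u (z, 2 * z.im - s)` are both holomorphic in `z`, then `u` does not depend
on the real variable. -/
lemma eq_of_reflection {z₀ : ℂ} {V : Set ℂ} (hV : IsOpen V) (hz₀ : z₀ ∈ V) {T S : Set ℝ}
    (hT : IsOpen T) (hTc : T.OrdConnected) (hSc : S.OrdConnected) {u v : ℂ → ℝ → ℂ}
    (hu : ContinuousOn (fun q : ℂ × ℝ => u q.1 q.2) (V ×ˢ T))
    (hud : ∀ t ∈ T, DifferentiableOn ℂ (fun z => u z t) V)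
    (hv : ContinuousOn (fun q : ℂ × ℝ => v q.1 q.2) (V ×ˢ S))
    (hvd : ∀ t ∈ S, DifferentiableOn ℂ (fun z => v z t) V)
    (huv : ∀ z ∈ V, ∀ t ∈ T, ∀ s ∈ S, t + s = 2 * z.im → u z t = v z s)
    {r₁ r₂ : ℝ} (hr₁ : r₁ ∈ T) (hr₂ : r₂ ∈ T) (hs₁ : 2 * z₀.im - r₁ ∈ S)
    (hs₂ : 2 * z₀.im - r₂ ∈ S) : u z₀ r₁ = u z₀ r₂ := by
  have hr : uIcc r₁ r₂ ⊆ T := hTc.uIcc_subset hr₁ hr₂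
  have hs : uIcc (2 * z₀.im - r₂) (2 * z₀.im - r₁) ⊆ S := hSc.uIcc_subset hs₂ hs₁
  set J : ℂ → ℂ := fun z => ∫ t in r₁..r₂, u z t with hJ
  set B : ℂ → ℂ := fun z => ∫ t in (2 * z₀.im - r₂)..(2 * z₀.im - r₁), v z t with hB
  have hJd : DifferentiableOn ℂ J V := differentiableOn_intervalIntegral hV
    (hu.mono (prod_mono_right hr)) fun t ht => hud t (hr ht)
  have hBd : DifferentiableOn ℂ B V := differentiableOn_intervalIntegral hV
    (hv.mono (prod_mono_right hs)) fun t ht => hvd t (hs ht)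
  have hrel : ∀ z ∈ V, uIcc (r₁ + 2 * (z.im - z₀.im)) (r₂ + 2 * (z.im - z₀.im)) ⊆ T →
      B z = ∫ t in (r₁ + 2 * (z.im - z₀.im))..(r₂ + 2 * (z.im - z₀.im)), u z t := by
    intro z hz hsub
    have h1 : ∫ t in (r₁ + 2 * (z.im - z₀.im))..(r₂ + 2 * (z.im - z₀.im)), u z t =
        ∫ t in (r₁ + 2 * (z.im - z₀.im))..(r₂ + 2 * (z.im - z₀.im)), v z (2 * z.im - t) := by
      refine intervalIntegral.integral_congr fun t ht => huv z hz t (hsub ht) _ ?_ (by ring)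
      refine hs ?_
      have h2 : 2 * z.im - t ∈ (fun x => 2 * z.im - x) ''
        uIcc (r₁ + 2 * (z.im - z₀.im)) (r₂ + 2 * (z.im - z₀.im)) := mem_image_of_mem _ ht
      rw [image_const_sub_uIcc, uIcc_comm] at h2
      rwa [show 2 * z.im - (r₂ + 2 * (z.im - z₀.im)) = 2 * z₀.im - r₂ by ring,
        show 2 * z.im - (r₁ + 2 * (z.im - z₀.im)) = 2 * z₀.im - r₁ by ring] at h2
    rw [h1, intervalIntegral.integral_comp_sub_left (fun t => v z t)]
    simp only [hB]
    congr 1 <;> ring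
  have hE : ∀ᶠ z in 𝓝 z₀, B z - J z = 0 := by
    have han : AnalyticAt ℂ (fun z => B z - J z) z₀ := (hBd.sub hJd).analyticAt (hV.mem_nhds hz₀)
    refine han.frequently_zero_iff_eventually_zero.1 ?_
    have hc : ContinuousAt (fun x : ℝ => z₀ + (x : ℂ)) 0 := by fun_prop
    have ht : Tendsto (fun x : ℝ => z₀ + (x : ℂ)) (𝓝[≠] 0) (𝓝[≠] z₀) := by
      refine tendsto_nhdsWithin_iff.2 ⟨?_, ?_⟩
      · simpa [ContinuousAt] using hc.tendsto.mono_left (nhdsWithin_le_nhds (s := {0}ᶜ))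
      · filter_upwards [self_mem_nhdsWithin] with x hx
        simpa using hx
    have hVe : ∀ᶠ x : ℝ in 𝓝[≠] 0, z₀ + (x : ℂ) ∈ V :=
      nhdsWithin_le_nhds (hc.preimage_mem_nhds (hV.mem_nhds (by simpa using hz₀)))
    refine ht.frequently (Eventually.frequently ?_)
    filter_upwards [hVe] with x hx
    rw [hrel _ hx (by simpa using hr)]
    simp [hJ]
  have hcont : ∀ r ∈ T, ∀ ε > 0, ∀ᶠ h : ℝ in 𝓝 0, z₀ + I * h ∈ V ∧ uIcc r (r + 2 * h) ⊆ T ∧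
      ∀ t ∈ uIcc r (r + 2 * h), ‖u (z₀ + I * h) t - u z₀ r‖ ≤ ε := by
    intro r hrT ε hε
    have h1 := hu.continuousAt ((hV.prod hT).mem_nhds (show (z₀, r) ∈ V ×ˢ T from ⟨hz₀, hrT⟩))
    have h2 : ∀ᶠ q : ℂ × ℝ in 𝓝 (z₀, r), (q.1 ∈ V ∧ q.2 ∈ T) ∧ ‖u q.1 q.2 - u z₀ r‖ ≤ ε := by
      filter_upwards [(hV.prod hT).mem_nhds (show (z₀, r) ∈ V ×ˢ T from ⟨hz₀, hrT⟩),
        h1.eventually (Metric.closedBall_mem_nhds _ hε)] with q hq1 hq2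
      exact ⟨hq1, by rw [← dist_eq_norm]; exact hq2⟩
    obtain ⟨ρ, hρ, h3⟩ := Metric.eventually_nhds_iff_ball.1 h2
    filter_upwards [Metric.ball_mem_nhds (0 : ℝ) (show 0 < ρ / 2 by positivity)] with h hh
    rw [Metric.mem_ball, dist_zero_right, Real.norm_eq_abs] at hh
    have h4 : ∀ t ∈ uIcc r (r + 2 * h), (z₀ + I * h, t) ∈ Metric.ball (z₀, r) ρ := by
      intro t ht
      have h5 := abs_sub_left_of_mem_uIcc ht
      rw [add_sub_cancel_left, abs_mul, abs_two] at h5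
      rw [Metric.mem_ball, Prod.dist_eq, max_lt_iff]
      constructor
      · simp
        linarith [abs_nonneg h]
      · rw [Real.dist_eq]
        linarith
    exact ⟨(h3 _ (h4 r left_mem_uIcc)).1.1, fun t ht => (h3 _ (h4 t ht)).1.2,
      fun t ht => (h3 _ (h4 t ht)).2⟩
  refine eq_of_forall_dist_le fun ε hε => ?_
  have hE' : ∀ᶠ h : ℝ in 𝓝 0, B (z₀ + I * h) - J (z₀ + I * h) = 0 := by
    have hc : ContinuousAt (fun h : ℝ => z₀ + I * (h : ℂ)) 0 := by fun_prop
    exact hc.eventually (by simpa using hE)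
  have e0 : ∀ᶠ h : ℝ in 𝓝[>] 0, 0 < h := self_mem_nhdsWithin
  have e1 := (hcont r₁ hr₁ (ε / 2) (by positivity)).filter_mono
    (nhdsWithin_le_nhds (s := Ioi 0))
  have e2 := (hcont r₂ hr₂ (ε / 2) (by positivity)).filter_mono
    (nhdsWithin_le_nhds (s := Ioi 0))
  have e3 := hE'.filter_mono (nhdsWithin_le_nhds (s := Ioi 0))
  obtain ⟨h, hh, ⟨hzV, hT1, hb1⟩, ⟨-, hT2, hb2⟩, hEh⟩ :=
    (e0.and (e1.and (e2.and e3))).exists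
  set z : ℂ := z₀ + I * h with hz
  have him : z.im - z₀.im = h := by simp [hz]
  have hrel' := hrel z hzV (by
    rw [him]; exact hTc.uIcc_subset (hT1 right_mem_uIcc) (hT2 right_mem_uIcc))
  rw [him] at hrel'
  have huz : ContinuousOn (fun t => u z t) T :=
    hu.comp (f := fun t : ℝ => (z, t)) (by fun_prop) fun t ht => ⟨hzV, ht⟩
  have hint : ∀ x ∈ T, ∀ y ∈ T, IntervalIntegrable (fun t => u z t) volume x y := fun x hx y hy =>
    (huz.mono (hTc.uIcc_subset hx hy)).intervalIntegrable
  have hmem₁ := hT1 right_mem_uIcc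
  have hmem₂ := hT2 right_mem_uIcc
  have hA : ∫ t in r₁..(r₁ + 2 * h), u z t = ∫ t in r₂..(r₂ + 2 * h), u z t := by
    have h1 := intervalIntegral.integral_add_adjacent_intervals (hint _ hr₁ _ hr₂)
      (hint _ hr₂ _ hmem₂)
    have h2 := intervalIntegral.integral_add_adjacent_intervals (hint _ hr₁ _ hmem₁)
      (hint _ hmem₁ _ hmem₂)
    rw [hrel'] at hEh
    have h3 : ∫ t in r₁..r₂, u z t = ∫ t in (r₁ + 2 * h)..(r₂ + 2 * h), u z t :=
      (sub_eq_zero.1 hEh).symm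
    rw [h3] at h1
    linear_combination h2 - h1
  have hclose : ∀ r ∈ T, r + 2 * h ∈ T →
      (∀ t ∈ uIcc r (r + 2 * h), ‖u z t - u z₀ r‖ ≤ ε / 2) →
      ‖(∫ t in r..(r + 2 * h), u z t) - (2 * h : ℝ) * u z₀ r‖ ≤ ε / 2 * (2 * h) := by
    intro r hr hr' hb
    have h1 := intervalIntegral.norm_integral_le_of_norm_le_const
      (f := fun t => u z t - u z₀ r) (C := ε / 2) (a := r) (b := r + 2 * h)
      fun t ht => hb t (uIoc_subset_uIcc ht)
    rw [intervalIntegral.integral_sub (hint _ hr _ hr') intervalIntegrable_const,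
      intervalIntegral.integral_const, add_sub_cancel_left, abs_of_pos (by positivity)] at h1
    simpa using h1
  have c1 := hclose r₁ hr₁ hmem₁ hb1
  have c2 := hclose r₂ hr₂ hmem₂ hb2
  rw [hA] at c1
  have h5 : ‖((2 * h : ℝ) : ℂ) * (u z₀ r₁ - u z₀ r₂)‖ ≤ ε * (2 * h) := by
    have := norm_sub_le_of_le c2 c1
    rw [sub_sub_sub_cancel_left, ← mul_sub] at this
    linarith
  rw [norm_mul, norm_real, Real.norm_of_nonneg (by positivity), mul_comm] at h5
  rw [dist_eq_norm]
  exact le_of_mul_le_mul_right h5 (by positivity)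

section

/-- Near `p + I t`, the functions `z ↦ G t' (z - I t')` with `t'` near `t` coincide. -/
def IsStationary (G : ℝ → ℂ → ℂ) (a b : ℝ) (p : ℂ) (t : ℝ) : Prop :=
  ∃ ε > 0, ∀ z ∈ Metric.ball (p + I * t) ε, ∀ t' ∈ Icc a b, |t' - t| < ε →
    G t' (z - I * t') = G t (z - I * t)

variable {D : Set ℂ} {α β a b c d δ : ℝ} {lam : ℝ → ℝ} {f : ℂ → ℂ} {G G' : ℝ → ℂ → ℂ}

lemma Setting.isStationary (h : Setting D α β a b c d lam δ) (hG : IsFamily D a b f G)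
    (hG' : IsFamily (conjCLE '' D) c d f G') (hfr : (frontier D).Nonempty) {p : ℂ} (hp : p ∈ D)
    {t : ℝ} (ht : |p.im + t - lam p.re| < δ) : IsStationary G a b p t := by
  set z₀ : ℂ := p + I * t with hz₀
  have hz₀im : z₀.im = p.im + t := by simp [hz₀]
  have hz₀re : z₀.re = p.re := by simp [hz₀]
  have hconj : ∀ z : ℂ, ∀ s : ℝ, z - I * s ∈ conjCLE '' D ↔ z - I * (2 * z.im - s : ℝ) ∈ D := by
    intro z s
    have h1 : z - I * s = conjCLE (z - I * (2 * z.im - s : ℝ)) := by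
      apply Complex.ext <;> simp
      ring
    rw [h1]
    exact (conjCLE.injective).mem_set_image
  have hlam := h.continuous
  have hev : ∀ᶠ q : ℂ × ℝ in 𝓝 (z₀, t), |q.1.im - lam q.1.re| < δ ∧ q.1 - I * q.2 ∈ D := by
    have c1 : Continuous fun q : ℂ × ℝ => |q.1.im - lam q.1.re| := by fun_prop
    have c2 : Continuous fun q : ℂ × ℝ => q.1 - I * q.2 := by fun_prop
    exact ((isOpen_lt c1 continuous_const).inter (h.isOpen.preimage c2)).mem_nhds
      ⟨by simpa [hz₀] using ht, by simpa [hz₀] using hp⟩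
  obtain ⟨ρ, hρ, hball⟩ := Metric.eventually_nhds_iff_ball.1 hev
  have hball' : ∀ z ∈ Metric.ball z₀ (ρ / 8), ∀ r : ℝ, |r - t| < ρ →
      |z.im - lam z.re| < δ ∧ z - I * r ∈ D := by
    intro z hz r hr
    refine hball (z, r) ?_
    rw [Metric.mem_ball, Prod.dist_eq, max_lt_iff]
    exact ⟨by linarith [Metric.mem_ball.1 hz], hr⟩
  have him : ∀ z ∈ Metric.ball z₀ (ρ / 8), |z.im - z₀.im| < ρ / 8 := by
    intro z hz
    rw [Metric.mem_ball, dist_eq_norm] at hz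
    exact (abs_im_le_norm (z - z₀)).trans_lt hz
  set V := Metric.ball z₀ (ρ / 8)
  set T := Metric.ball t (ρ / 4)
  set S := Metric.ball (2 * z₀.im - t) (ρ / 2)
  have hS : ∀ z ∈ V, ∀ s ∈ S, |2 * z.im - s - t| < ρ := by
    intro z hz s hs
    have h1 := him z hz
    rw [Metric.mem_ball, Real.dist_eq] at hs
    rw [abs_lt] at *
    constructor <;> linarith
  have hT : ∀ r ∈ T, |r - t| < ρ := by
    intro r hr
    rw [Metric.mem_ball, Real.dist_eq] at hr
    linarith
  have hVT : ∀ z ∈ V, ∀ r ∈ T, r ∈ Icc a b := by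
    intro z hz r hr
    obtain ⟨h1, h2⟩ := hball' z hz r (hT r hr)
    refine h.mem_Icc (subset_closure h2) ?_
    simpa using h1
  have hVS : ∀ z ∈ V, ∀ s ∈ S, s ∈ Icc c d := by
    intro z hz s hs
    obtain ⟨h1, h2⟩ := hball' z hz _ (hS z hz s hs)
    refine h.mem_Icc_conj (subset_closure h2) ?_
    have h3 : -(z - I * (2 * z.im - s : ℝ)).im + s = z.im := by simp; ring
    have h4 : (z - I * (2 * z.im - s : ℝ)).re = z.re := by simp
    rwa [h3, h4]
  have hz₀V : z₀ ∈ V := Metric.mem_ball_self (by positivity)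
  have htT : t ∈ T := Metric.mem_ball_self (by positivity)
  have hu : ContinuousOn (fun q : ℂ × ℝ => G q.2 (q.1 - I * q.2)) (V ×ˢ T) :=
    hG.continuousOn.comp (f := fun q : ℂ × ℝ => (q.2, q.1 - I * q.2)) (by fun_prop)
      fun q hq => ⟨hVT _ hq.1 _ hq.2, subset_closure (hball' _ hq.1 _ (hT _ hq.2)).2⟩
  have hv : ContinuousOn (fun q : ℂ × ℝ => G' q.2 (q.1 - I * q.2)) (V ×ˢ S) :=
    hG'.continuousOn.comp (f := fun q : ℂ × ℝ => (q.2, q.1 - I * q.2)) (by fun_prop)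
      fun q hq => ⟨hVS _ hq.1 _ hq.2, subset_closure ((hconj _ _).2
        (hball' _ hq.1 _ (hS _ hq.1 _ hq.2)).2)⟩
  have hud : ∀ r ∈ T, DifferentiableOn ℂ (fun z => G r (z - I * r)) V := fun r hr =>
    (hG.differentiableOn r (hVT _ hz₀V r hr)).comp (by fun_prop)
      fun z hz => (hball' z hz r (hT r hr)).2
  have hvd : ∀ s ∈ S, DifferentiableOn ℂ (fun z => G' s (z - I * s)) V := fun s hs =>
    (hG'.differentiableOn s (hVS _ hz₀V s hs)).comp (by fun_prop)
      fun z hz => (hconj _ _).2 (hball' z hz _ (hS z hz s hs)).2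
  refine ⟨ρ / 8, by positivity, fun z hz t' _ ht' => ?_⟩
  replace ht' : t' ∈ T := ht'.trans (by linarith)
  have hmem : ∀ r ∈ T, 2 * z.im - r ∈ S := by
    intro r hr
    have h1 := him z hz
    rw [Metric.mem_ball, Real.dist_eq] at *
    rw [abs_lt] at *
    constructor <;> linarith
  refine eq_of_reflection (u := fun z r => G r (z - I * r)) (v := fun z s => G' s (z - I * s))
    Metric.isOpen_ball hz Metric.isOpen_ball (convex_ball t _).ordConnected
    (convex_ball _ _).ordConnected hu hud hv hvd ?_ ht' htT (hmem _ ht') (hmem _ htT)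
  intro z hz r hr s hs hrs
  obtain ⟨h1, h2⟩ := hball' z hz r (hT r hr)
  have h3 := h.families_agree hG hG' h2 hfr (y := z.im) (by simpa using h1)
  have h4 : conjCLE (z - I * r) = z - I * s := by
    apply Complex.ext <;> simp
    linarith
  rw [h4] at h3
  convert h3 using 2
  · simp
  · simp
    linarith

lemma IsStationary.spread (hD : IsOpen D) (hDc : IsPreconnected D) 
    (hd : ∀ t ∈ Icc a b, DifferentiableOn ℂ (G t) D) {t : ℝ} (ht : t ∈ Icc a b) {p q : ℂ}
    (hp : p ∈ D) (hq : q ∈ D) (h : IsStationary G a b p t) : IsStationary G a b q t := by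
  have hball : ∀ {p q : ℂ} {ε : ℝ}, q ∈ Metric.ball p ε → q + I * t ∈ Metric.ball (p + I * t) ε := by
    intro p q ε hq
    simpa [Metric.mem_ball] using hq
  have hopen : IsOpen {p | IsStationary G a b p t} := by
    refine Metric.isOpen_iff.2 ?_
    rintro p ⟨ε, hε, h⟩
    refine ⟨ε / 2, by positivity, fun q hq => ⟨ε / 2, by positivity, fun z hz t' ht' htt => ?_⟩⟩
    refine h z ?_ t' ht' (by linarith)
    have := Metric.ball_subset_ball' (ε₁ := ε / 2) (ε₂ := ε) (x := q + I * t) (y := p + I * t)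
      (by linarith [Metric.mem_ball.1 (hball hq)])
    exact this hz
  refine hDc.subset_of_closure_inter_subset hopen ⟨p, hp, h⟩ ?_ hq
  rintro p ⟨hpc, hpD⟩
  obtain ⟨r, hr, hrD⟩ := Metric.isOpen_iff.1 hD p hpD
  obtain ⟨q, ⟨ε, hε, hqs⟩, hqp⟩ := Metric.mem_closure_iff.1 hpc (r / 2) (by positivity)
  have hmaps : ∀ t', |t' - t| < r / 2 → ∀ z ∈ Metric.ball (p + I * t) (r / 2), z - I * t' ∈ D := by
    intro t' ht' z hz
    refine hrD ?_
    rw [Metric.mem_ball, dist_eq_norm] at hz ⊢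
    have h1 : z - I * t' - p = (z - (p + I * t)) - I * ((t' - t : ℝ) : ℂ) := by
      push_cast; ring
    rw [h1]
    refine (norm_sub_le _ _).trans_lt ?_
    rw [norm_mul, norm_I, one_mul, norm_real, Real.norm_eq_abs]
    linarith
  have hdiff : ∀ t' ∈ Icc a b, |t' - t| < r / 2 →
      AnalyticOnNhd ℂ (fun z => G t' (z - I * t')) (Metric.ball (p + I * t) (r / 2)) :=
    fun t' ht' htt => ((hd t' ht').comp (by fun_prop) (hmaps t' htt)).analyticOnNhd
      Metric.isOpen_ball
  refine ⟨min ε (r / 2), by positivity, fun z hz t' ht' htt => ?_⟩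
  refine (hdiff t' ht' (htt.trans_le (min_le_right _ _))).eqOn_of_preconnected_of_eventuallyEq
    (hdiff t ht (by simpa using hr)) (convex_ball _ _).isPreconnected
    (hball (p := p) (q := q) (by rwa [Metric.mem_ball, dist_comm])) ?_
    (Metric.ball_subset_ball (min_le_right _ _) hz)
  filter_upwards [Metric.ball_mem_nhds (q + I * t) hε] with w hw
  exact hqs w hw t' ht' (htt.trans_le (min_le_left _ _))

lemma IsStationary.exists_forall {p : ℂ} {t : ℝ} (h : IsStationary G a b p t) :
    ∃ ε > 0, ∀ t' ∈ Icc a b, |t' - t| < ε → IsStationary G a b p t' := by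
  obtain ⟨ε, hε, h⟩ := h
  refine ⟨ε / 2, by positivity, fun t' ht' htt => ⟨ε / 2, by positivity, fun z hz s hs hst => ?_⟩⟩
  have h1 : z ∈ Metric.ball (p + I * t) ε := by
    refine Metric.ball_subset_ball' (x := p + I * t') (ε₁ := ε / 2) ?_ hz
    rw [dist_add_left, dist_eq_norm, ← mul_sub, norm_mul, norm_I, one_mul, ← ofReal_sub, norm_real,
      Real.norm_eq_abs]
    linarith
  rw [h z h1 s hs (by rw [abs_lt] at *; constructor <;> linarith), h z h1 t' ht' (by linarith)]

lemma IsFamily.neg (hG : IsFamily D a b f G) :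
    IsFamily (-D) (-b) (-a) (fun z => f (-z)) (fun t ζ => G (-t) (-ζ)) := by
  have hcl : closure (-D) = -closure D := by
    simpa using ((Homeomorph.neg ℂ).preimage_closure D).symm
  have hfr : frontier (-D) = -frontier D := by
    simpa using ((Homeomorph.neg ℂ).preimage_frontier D).symm
  refine ⟨?_, ?_, ?_⟩
  · refine hG.continuousOn.comp (f := fun q : ℝ × ℂ => (-q.1, -q.2)) (by fun_prop) ?_
    rintro ⟨t, ζ⟩ ⟨ht, hζ⟩
    rw [hcl] at hζ
    exact ⟨⟨by linarith [ht.2], by linarith [ht.1]⟩, hζ⟩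
  · intro t ht
    exact (hG.differentiableOn (-t) ⟨by linarith [ht.2], by linarith [ht.1]⟩).comp (by fun_prop)
      fun z hz => hz
  · intro t ht ζ hζ
    rw [hfr] at hζ
    rw [hG.eq (-t) ⟨by linarith [ht.2], by linarith [ht.1]⟩ (-ζ) hζ]
    congr 1
    push_cast
    ring

lemma isStationary_neg {p : ℂ} {t : ℝ} (h : IsStationary G a b p t) :
    IsStationary (fun t ζ => G (-t) (-ζ)) (-b) (-a) (-p) (-t) := by
  obtain ⟨ε, hε, h⟩ := h
  refine ⟨ε, hε, fun z hz t' ht' htt => ?_⟩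
  have h1 := h (-z) (by
    rw [Metric.mem_ball, dist_eq_norm] at *
    rw [← norm_neg, show -(-z - (p + I * t)) = z - (-p + I * (-t : ℝ)) by push_cast; ring]
    exact hz) (-t') ⟨by linarith [ht'.2], by linarith [ht'.1]⟩ (by
      rw [← abs_neg]
      convert htt using 2
      ring)
  convert h1 using 2
  · push_cast; ring
  · simp
  · push_cast; ring

lemma IsFamily.eq_of_exit_below (hG : IsFamily D a b f G) {z : ℂ}
    {t₁ t₀ : ℝ} (ht₁ : t₁ ∈ Icc a b) (ht₀ : t₀ ∈ Icc a b) (hle : t₁ ≤ t₀) (h₀ : z - I * t₀ ∈ D)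
    (hD : IsOpen D)
    (h₁ : z - I * t₁ ∉ D)
    (hst : ∀ t ∈ Icc t₁ t₀, z - I * t ∈ D → IsStationary G a b (z - I * t) t) :
    G t₀ (z - I * t₀) = f z := by
  set K : Set ℝ := Icc t₁ t₀ ∩ {t | z - I * t ∉ D} with hK
  have hKc : IsCompact K := by
    refine isCompact_Icc.inter_right ?_
    exact hD.isClosed_compl.preimage (f := fun t : ℝ => z - I * (t : ℂ)) (by fun_prop)
  have hKne : K.Nonempty := ⟨t₁, left_mem_Icc.2 hle, h₁⟩
  obtain ⟨s, ⟨⟨hs1, hs0⟩, hsD⟩, hsmax⟩ := hKc.exists_isGreatest hKne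
  have hin : ∀ t ∈ Ioc s t₀, z - I * t ∈ D := by
    intro t ht
    by_contra hcon
    exact absurd (hsmax ⟨⟨hs1.trans ht.1.le, ht.2⟩, hcon⟩) (not_le.2 ht.1)
  have hlt : s < t₀ := lt_of_le_of_ne hs0 fun h => hsD (by rwa [h])
  have hcl : ∀ t ∈ Icc s t₀, z - I * t ∈ closure D := by
    have hc : ContinuousOn (fun t : ℝ => z - I * (t : ℂ)) (closure (Ioc s t₀)) := by fun_prop
    intro t ht
    rw [← closure_Ioc hlt.ne] at ht
    exact closure_mono (image_subset_iff.2 hin) (hc.image_closure (mem_image_of_mem _ ht))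
  have hIcc : ∀ t ∈ Icc s t₀, t ∈ Icc a b := fun t ht =>
    ⟨ht₁.1.trans (hs1.trans ht.1), ht.2.trans ht₀.2⟩
  have hcont : ContinuousOn (fun t : ℝ => G t (z - I * t)) (Icc s t₀) :=
    hG.continuousOn.comp (f := fun t : ℝ => (t, z - I * (t : ℂ))) (by fun_prop)
      fun t ht => ⟨hIcc t ht, hcl t ht⟩
  have hcont' : ContinuousOn (fun r : ℝ => G (-r) (z - I * (-r : ℝ))) (Icc (-t₀) (-s)) :=
    hcont.comp (f := fun r : ℝ => -r) (by fun_prop) fun r hr =>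
      ⟨by linarith [hr.2], by linarith [hr.1]⟩
  have hconst := constant_of_has_deriv_right_zero hcont' (fun r hr => ?_) (-s)
    ⟨by linarith, le_rfl⟩
  · simp only [neg_neg] at hconst
    rw [← hconst, hG.eq s (hIcc s (left_mem_Icc.2 hs0)), sub_add_cancel]
    rw [hD.frontier_eq]
    exact ⟨hcl s (left_mem_Icc.2 hs0), hsD⟩
  · have hr' : -r ∈ Ioc s t₀ := ⟨by linarith [hr.2], by linarith [hr.1]⟩
    obtain ⟨ε, hε, h⟩ := hst (-r) ⟨hs1.trans hr'.1.le, hr'.2⟩ (hin _ hr')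
    refine (hasDerivWithinAt_const r (Ici r) (G (-r) (z - I * (-r : ℝ)))).congr_of_eventuallyEq
      ?_ rfl
    have e1 : ∀ᶠ r' in 𝓝[≥] r, r' ∈ Ico r (-s) := Ico_mem_nhdsGE hr.2
    have e2 : ∀ᶠ r' in 𝓝[≥] r, |r' - r| < ε :=
      nhdsWithin_le_nhds (Metric.ball_mem_nhds r hε)
    filter_upwards [e1, e2] with r' h1 h2
    refine h z ?_ (-r') (hIcc _ ⟨by linarith [h1.2], by linarith [h1.1, hr.1]⟩) ?_
    · simpa using hε
    · rw [← abs_neg]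
      convert h2 using 2
      ring

end

lemma exists_pow_mul_near {N : ℕ} (hN : 0 < N) {w v : ℂ} (hwv : ‖w‖ = ‖v‖) :
    ∃ k ∈ Finset.range N, ‖exp (2 * Real.pi * I / N) ^ k * w - v‖ ≤ ‖v‖ * (2 * Real.pi / N) := by
  set ω := exp (2 * Real.pi * I / N) with hω
  have hN' : (0 : ℝ) < N := by exact_mod_cast hN
  have hNc : (N : ℂ) ≠ 0 := by exact_mod_cast hN.ne'
  have hNz : (N : ℤ) ≠ 0 := by exact_mod_cast hN.ne'
  have hωN : ω ^ N = 1 := by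
    rw [hω, ← exp_nat_mul, mul_div_cancel₀ _ hNc, exp_two_pi_mul_I]
  set y : ℝ := (v.arg - w.arg) * (N / (2 * Real.pi)) with hy
  set m : ℤ := ⌊y⌋ with hm
  have hmk : ω ^ (m % N).toNat = exp (I * ((2 * Real.pi / N * m : ℝ) : ℂ)) := by
    have h1 : (((m % N).toNat : ℕ) : ℤ) = m % N := Int.toNat_of_nonneg (Int.emod_nonneg _ hNz)
    have h2 : ω ^ (m % N).toNat = ω ^ m := by
      rw [← zpow_natCast, h1]
      conv_rhs => rw [← Int.emod_add_mul_ediv m N]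
      rw [zpow_add₀ (exp_ne_zero _), zpow_mul, zpow_natCast ω N, hωN, one_zpow, mul_one]
    rw [h2, hω, ← exp_int_mul]
    congr 1
    push_cast
    ring
  refine ⟨(m % N).toNat, ?_, ?_⟩
  · rw [Finset.mem_range]
    have := Int.emod_lt_of_pos m (show (0 : ℤ) < N by exact_mod_cast hN)
    omega
  · set τ : ℝ := 2 * Real.pi / N * (m - y) with hτ
    have hw : exp (I * ((2 * Real.pi / N * m : ℝ) : ℂ)) * w = exp (I * τ) * v := by
      conv_lhs => rw [← norm_mul_exp_arg_mul_I w, hwv]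
      conv_rhs => rw [← norm_mul_exp_arg_mul_I v]
      rw [mul_left_comm, mul_left_comm (exp _), ← exp_add, ← exp_add]
      congr 2
      have : τ + v.arg = 2 * Real.pi / N * m + w.arg := by
        rw [hτ, hy]
        field_simp
        ring
      have h2 := congrArg (fun x : ℝ => I * (x : ℂ)) this
      simp only [ofReal_add] at h2
      linear_combination -h2
    have h3 : exp (I * τ) * v - v = (exp (I * τ) - 1) * v := by ring
    rw [hmk, hw, h3, norm_mul, mul_comm]
    refine mul_le_mul_of_nonneg_left ((Real.norm_exp_I_mul_ofReal_sub_one_le).trans ?_)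
      (norm_nonneg _)
    rw [hτ, Real.norm_eq_abs, abs_mul, abs_of_pos (by positivity)]
    refine mul_le_of_le_one_right (by positivity) ?_
    rw [abs_le]
    constructor <;> linarith [Int.floor_le y, Int.lt_floor_add_one y]

/-- A local uniqueness theorem: a holomorphic function with zero boundary values near a boundary
point which is a limit of exterior points vanishes near that point. -/
lemma eq_zero_of_frontier {D : Set ℂ} (hD : IsOpen D) {u : ℂ → ℂ} {q : ℂ} {r : ℝ}
    (hr : 0 < r) (hq : q ∈ closure (closure D)ᶜ)
    (hc : ContinuousOn u (closure D ∩ Metric.ball q r))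
    (hd : DifferentiableOn ℂ u (D ∩ Metric.ball q r))
    (h0 : ∀ ζ ∈ frontier D ∩ Metric.ball q r, u ζ = 0) {p : ℂ} (hp : p ∈ D)
    (hpq : p ∈ Metric.ball q (r / 8)) : u p = 0 := by
  obtain ⟨e, he, hqe⟩ := Metric.mem_closure_iff.1 hq (r / 8) (by positivity)
  obtain ⟨η, hη, hηD⟩ := Metric.isOpen_iff.1 isClosed_closure.isOpen_compl e he
  set R : ℝ := ‖e - p‖ with hR
  have hep : e - p ≠ 0 := by
    intro h
    rw [sub_eq_zero] at h
    exact he (h ▸ subset_closure hp)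
  have hR0 : 0 < R := norm_pos_iff.2 hep
  have hRr : R < r / 4 := by
    rw [hR, ← dist_eq_norm]
    have := dist_triangle e q p
    rw [Metric.mem_ball, dist_comm] at hpq
    rw [dist_comm] at hqe
    linarith
  obtain ⟨N, hN⟩ := exists_nat_gt (R * (2 * Real.pi) / η)
  have hN0 : (0 : ℝ) < N := lt_trans (by positivity) hN
  have hNpos : 0 < N := by exact_mod_cast hN0
  set ω := exp (2 * Real.pi * I / N) with hω
  have hω1 : ‖ω‖ = 1 := by
    rw [hω, show 2 * Real.pi * I / N = ((2 * Real.pi / N : ℝ) : ℂ) * I by push_cast; ring]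
    exact norm_exp_ofReal_mul_I _
  set ρ : ℕ → ℂ → ℂ := fun k z => p + ω ^ k * (z - p) with hρ
  have hρc : ∀ k, Continuous (ρ k) := fun k => by fun_prop
  have hρn : ∀ k z, dist (ρ k z) p = dist z p := fun k z => by
    simp [hρ, dist_eq_norm, hω1]
  set V : Set ℂ := Metric.ball p R ∩ ⋂ k ∈ Finset.range N, ρ k ⁻¹' D with hV
  have hVo : IsOpen V := Metric.isOpen_ball.inter
    (isOpen_biInter_finset fun k _ => hD.preimage (hρc k))
  have hVcl : closure V ⊆ Metric.closedBall p R ∩ ⋂ k ∈ Finset.range N, ρ k ⁻¹' closure D := by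
    refine closure_minimal ?_ (Metric.isClosed_closedBall.inter
      (isClosed_biInter fun k _ => isClosed_closure.preimage (hρc k)))
    exact inter_subset_inter Metric.ball_subset_closedBall
      (iInter₂_mono fun k _ => preimage_mono subset_closure)
  have hball : ∀ z, dist z p ≤ R → ∀ k, ρ k z ∈ Metric.ball q r := by
    intro z hz k
    rw [Metric.mem_ball] at *
    have := dist_triangle (ρ k z) p q
    rw [hρn] at this
    linarith
  set P : ℂ → ℂ := fun z => ∏ k ∈ Finset.range N, u (ρ k z) with hP
  have hPc : DiffContOnCl ℂ P V := by
    constructor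
    · refine DifferentiableOn.fun_finsetProd fun k hk => hd.comp (by fun_prop) fun z hz => ?_
      exact ⟨(mem_iInter₂.1 hz.2) k hk, hball z (Metric.mem_ball.1 hz.1).le k⟩
    · refine continuousOn_finsetProd _ fun k hk => hc.comp (hρc k).continuousOn fun z hz => ?_
      have h1 := hVcl hz
      exact ⟨(mem_iInter₂.1 h1.2) k hk, hball z h1.1 k⟩
  have hfr : ∀ z ∈ frontier V, ‖P z‖ ≤ 0 := by
    intro z hz
    rw [hVo.frontier_eq] at hz
    have h1 := hVcl hz.1
    have h2 : dist z p < R := by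
      refine lt_of_le_of_ne h1.1 fun h => ?_
      obtain ⟨k, hk, hkn⟩ := exists_pow_mul_near hNpos (w := z - p) (v := e - p)
        (by rw [← dist_eq_norm, h])
      refine hηD ?_ (mem_iInter₂.1 h1.2 k hk)
      rw [Metric.mem_ball, dist_eq_norm]
      have h3 : ρ k z - e = ω ^ k * (z - p) - (e - p) := by simp only [hρ]; ring
      rw [h3]
      refine hkn.trans_lt ?_
      rw [← hR, ← mul_div_assoc, div_lt_comm₀ hN0 hη]
      exact hN
    have h3 : ∃ k ∈ Finset.range N, ρ k z ∉ D := by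
      by_contra! hcon
      exact hz.2 ⟨h2, mem_iInter₂.2 hcon⟩
    obtain ⟨k, hk, hkD⟩ := h3
    have h4 : u (ρ k z) = 0 := h0 _ ⟨by
      rw [hD.frontier_eq]
      exact ⟨mem_iInter₂.1 h1.2 k hk, hkD⟩, hball z h1.1 k⟩
    rw [hP, norm_le_zero_iff]
    exact Finset.prod_eq_zero hk h4
  have hpV : p ∈ V := by
    refine ⟨Metric.mem_ball_self hR0, mem_iInter₂.2 fun k _ => ?_⟩
    simpa [hρ] using hp
  have h5 := norm_le_of_forall_mem_frontier_norm_le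
    (Metric.isBounded_ball.subset inter_subset_left) hPc hfr (subset_closure hpV)
  have h6 : P p = u p ^ N := by simp [hP, hρ]
  rw [h6, norm_le_zero_iff] at h5
  exact eq_zero_of_pow_eq_zero h5

section

variable {D : Set ℂ} {α β a b c d δ : ℝ} {lam : ℝ → ℝ} {f : ℂ → ℂ} {G G' : ℝ → ℂ → ℂ}

lemma dist_sub_I_mul (z p : ℂ) (t s : ℝ) :
    dist (z - I * t) p ≤ dist z (p + I * s) + |t - s| := by
  rw [dist_eq_norm, dist_eq_norm,
    show z - I * t - p = (z - (p + I * s)) - I * ((t - s : ℝ) : ℂ) by push_cast; ring]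
  refine (norm_sub_le _ _).trans ?_
  rw [norm_mul, norm_I, one_mul, norm_real, Real.norm_eq_abs]

lemma IsFamily.isStationary_of_boundary (hD : IsOpen D) (hG : IsFamily D a b f G) {q : ℂ}
    (hqc : q ∈ closure D) (hqe : q ∈ closure (closure D)ᶜ) {t₁ t₂ r : ℝ} (ht₁ : t₁ ∈ Icc a b)
    (ht₂ : t₂ ∈ Icc a b) (hr : 0 < r)
    (hf : ∀ z ∈ Metric.ball (q + I * t₁) r, z - I * t₂ ∈ D ∧ G t₂ (z - I * t₂) = f z) :
    ∃ p ∈ D, IsStationary G a b p t₁ := by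
  have key : ∀ t ∈ Icc a b, |t - t₁| < r / 2 → ∀ p ∈ D, p ∈ Metric.ball q (r / 16) →
      G t p = f (p + I * t) := by
    intro t ht htt p hp hpq
    have hball : ∀ ζ ∈ Metric.ball q (r / 2), ζ + I * t ∈ Metric.ball (q + I * t₁) r := by
      intro ζ hζ
      rw [Metric.mem_ball] at *
      have h3 : dist (ζ + I * t) (q + I * t₁) ≤ dist ζ q + |t - t₁| := by
        rw [dist_eq_norm, dist_eq_norm,
          show ζ + I * t - (q + I * t₁) = (ζ - q) + I * ((t - t₁ : ℝ) : ℂ) by push_cast; ring]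
        refine (norm_add_le _ _).trans ?_
        rw [norm_mul, norm_I, one_mul, norm_real, Real.norm_eq_abs]
      linarith
    have hmaps : MapsTo (fun ζ : ℂ => ζ + I * t - I * t₂) (Metric.ball q (r / 2)) D :=
      fun ζ hζ => (hf _ (hball ζ hζ)).1
    have hd₂ : DifferentiableOn ℂ (fun ζ : ℂ => G t₂ (ζ + I * t - I * t₂))
        (Metric.ball q (r / 2)) := (hG.differentiableOn t₂ ht₂).comp (by fun_prop) hmaps
    have h1 := eq_zero_of_frontier hD (u := fun ζ => G t ζ - G t₂ (ζ + I * t - I * t₂))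
      (half_pos hr) hqe
      (((hG.continuousOn_apply ht).mono inter_subset_left).sub
        (hd₂.continuousOn.mono inter_subset_right))
      (((hG.differentiableOn t ht).mono inter_subset_left).sub (hd₂.mono inter_subset_right))
      (fun ζ hζ => by rw [hG.eq t ht ζ hζ.1, (hf _ (hball ζ hζ.2)).2, sub_self]) hp
      (by rwa [show r / 2 / 8 = r / 16 by ring])
    rw [sub_eq_zero.1 h1]
    exact (hf _ (hball p (Metric.ball_subset_ball (by linarith) hpq))).2
  obtain ⟨p, hp, hpq⟩ := Metric.mem_closure_iff.1 hqc (r / 32) (by positivity)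
  obtain ⟨ρ, hρ, hρD⟩ := Metric.isOpen_iff.1 hD p hp
  refine ⟨p, hp, min (ρ / 2) (r / 64), by positivity, fun z hz t ht htt => ?_⟩
  rw [Metric.mem_ball, lt_min_iff] at hz
  rw [lt_min_iff] at htt
  have h2 : ∀ t ∈ Icc a b, |t - t₁| < ρ / 2 → |t - t₁| < r / 64 → G t (z - I * t) = f z := by
    intro t ht h1 h2
    have h3 := dist_sub_I_mul z p t t₁
    have h4 := dist_triangle (z - I * t) p q
    rw [dist_comm] at hpq
    rw [key t ht (by linarith) (z - I * t)
      (hρD (by rw [Metric.mem_ball]; linarith)) (by rw [Metric.mem_ball]; linarith),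
      sub_add_cancel]
  rw [h2 t ht htt.1 htt.2, h2 t₁ ht₁ (by simpa using hρ) (by simpa using hr)]

lemma isStationary_of_le (hD : IsOpen D) (hDc : IsPreconnected D) (hlam : Continuous lam)
    (hδ : 0 < δ) (hbelow : ∀ ζ ∈ closure D, ζ.im + a + δ ≤ lam ζ.re)
    (hG : IsFamily D a b f G)
    (hst : ∀ p ∈ D, ∀ t : ℝ, |p.im + t - lam p.re| < δ → IsStationary G a b p t) {q : ℂ}
    (hq : q ∈ closure D) (hq' : ∀ κ : ℝ, 0 < κ → q - I * κ ∉ closure D)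
    (hq'' : ∀ ε > 0, ∃ κ ∈ Ioo (0 : ℝ) ε, q + I * κ ∈ D) {ζ₀ : ℂ} (hζ₀ : ζ₀ ∈ D) {t : ℝ}
    (ht : t ∈ Icc a b) (hle : lam ζ₀.re - ζ₀.im ≤ t) {p : ℂ} (hp : p ∈ D) :
    IsStationary G a b p t := by
  set w : ℂ → ℝ := fun ζ => lam ζ.re - ζ.im with hw
  have hwc : Continuous w := by fun_prop
  have hbdd : BddBelow (w '' D) := by
    refine ⟨a + δ, ?_⟩
    rintro _ ⟨ζ, hζ, rfl⟩
    have := hbelow ζ (subset_closure hζ)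
    simp only [hw]
    linarith
  have hne : (w '' D).Nonempty := ⟨_, mem_image_of_mem _ hζ₀⟩
  set m := sInf (w '' D) with hm
  have hmle : ∀ ζ ∈ closure D, m ≤ w ζ := by
    intro ζ hζ
    have : closure D ⊆ {ζ | m ≤ w ζ} := closure_minimal
      (fun ζ hζ => csInf_le hbdd (mem_image_of_mem _ hζ)) (isClosed_le continuous_const hwc)
    exact this hζ
  have hma : a + δ ≤ m := le_csInf hne (by
    rintro _ ⟨ζ, hζ, rfl⟩
    have := hbelow ζ (subset_closure hζ)
    simp only [hw]
    linarith)
  set t₀ := m - δ / 2 with ht₀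
  have ht₀t : t₀ ≤ t := by
    have := hmle ζ₀ (subset_closure hζ₀)
    simp only [hw] at this
    linarith
  have hspread : ∀ s ∈ Icc a b, ∀ p ∈ D, IsStationary G a b p s → ∀ p' ∈ D,
      IsStationary G a b p' s := fun s hs p hp h p' hp' =>
    h.spread hD hDc hG.differentiableOn hs hp hp'
  obtain ⟨_, ⟨ζ₁, hζ₁, rfl⟩, hζ₁m⟩ := exists_lt_of_csInf_lt hne (show m < m + δ / 2 by linarith)
  have hζ₁m' := hmle ζ₁ (subset_closure hζ₁)
  have ht₀mem : t₀ ∈ Icc a b := ⟨by linarith, ht₀t.trans ht.2⟩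
  have hgood₀ : IsStationary G a b ζ₁ t₀ := by
    refine hst ζ₁ hζ₁ t₀ ?_
    simp only [hw] at hζ₁m hζ₁m'
    rw [abs_lt]
    constructor <;> linarith
  refine hspread t ht ζ₁ hζ₁ ?_ p hp
  by_contra hbad
  set B : Set ℝ := {s | s ∈ Icc t₀ t ∧ ¬ IsStationary G a b ζ₁ s} with hB
  have hBne : B.Nonempty := ⟨t, ⟨ht₀t, le_rfl⟩, hbad⟩
  have hBbdd : BddBelow B := ⟨t₀, fun s hs => hs.1.1⟩
  set t₁ := sInf B with ht₁
  have hmem : ∀ s ∈ Icc t₀ t, s ∈ Icc a b := fun s hs =>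
    ⟨ht₀mem.1.trans hs.1, hs.2.trans ht.2⟩
  have ht₁I : t₁ ∈ Icc t₀ t :=
    ⟨le_csInf hBne fun s hs => hs.1.1, csInf_le hBbdd ⟨⟨ht₀t, le_rfl⟩, hbad⟩⟩
  have hbad₁ : ¬ IsStationary G a b ζ₁ t₁ := by
    intro h
    obtain ⟨ε, hε, hεs⟩ := h.exists_forall
    obtain ⟨s, hs, hsε⟩ := exists_lt_of_csInf_lt hBne (show sInf B < t₁ + ε by linarith)
    refine hs.2 (hεs s (hmem s hs.1) ?_)
    have := csInf_le hBbdd hs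
    rw [abs_lt]
    constructor <;> linarith
  have hlt : t₀ < t₁ := lt_of_le_of_ne ht₁I.1 fun h => hbad₁ (h ▸ hgood₀)
  have hgood : ∀ s, t₀ ≤ s → s < t₁ → ∀ p ∈ D, IsStationary G a b p s := by
    intro s h1 h2
    have h3 := notMem_of_lt_csInf h2 hBbdd
    simp only [hB, mem_ofPred_eq, not_and, not_not] at h3
    have h4 : s ∈ Icc t₀ t := ⟨h1, h2.le.trans ht₁I.2⟩
    exact hspread s (hmem s h4) ζ₁ hζ₁ (h3 h4)
  have hbad' : ∀ p ∈ D, ¬ IsStationary G a b p t₁ := fun p hp h =>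
    hbad₁ (hspread t₁ (hmem _ ht₁I) p hp h ζ₁ hζ₁)
  have hfar : ∀ ζ ∈ D, ¬ |w ζ - t₁| < δ := by
    intro ζ hζ h
    refine hbad' ζ hζ (hst ζ hζ t₁ ?_)
    rw [← abs_neg]
    convert h using 2
    simp only [hw]
    ring
  have hw₁ : ∀ ζ ∈ D, w ζ ≤ t₁ - δ := by
    intro ζ hζ
    by_contra! hcon
    have h1 : w ζ ≥ t₁ := by
      by_contra! h2
      exact hfar ζ hζ (by rw [abs_lt]; constructor <;> linarith)
    have h2 : w ζ₁ ≤ t₁ := by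
      by_contra! h2
      exact hfar ζ₁ hζ₁ (by rw [abs_lt]; constructor <;> linarith)
    obtain ⟨ζ', hζ', hζ't⟩ := (hDc.image w hwc.continuousOn).ordConnected.out
      (mem_image_of_mem _ hζ₁) (mem_image_of_mem _ hζ) ⟨h2, h1⟩
    exact hfar ζ' hζ' (by rw [hζ't]; simpa using hδ)
  have hwq : w q ≤ t₁ - δ := by
    have : closure D ⊆ {ζ | w ζ ≤ t₁ - δ} :=
      closure_minimal hw₁ (isClosed_le hwc continuous_const)
    exact this hq
  obtain ⟨κ, ⟨hκ0, hκ⟩, hκD⟩ := hq'' (t₁ - t₀) (by linarith)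
  set t₂ := t₁ - κ with ht₂
  have ht₂mem : t₂ ∈ Icc a b := hmem _ ⟨by linarith, by linarith [ht₁I.2]⟩
  have hev : ∀ᶠ z in 𝓝 (q + I * t₁), z - I * t₂ ∈ D ∧ lam z.re < z.im := by
    have c1 : Continuous fun z : ℂ => z - I * t₂ := by fun_prop
    have c2 : Continuous fun z : ℂ => lam z.re := by fun_prop
    refine ((hD.preimage c1).inter (isOpen_lt c2 continuous_im)).mem_nhds ⟨?_, ?_⟩
    · have : q + I * t₁ - I * t₂ = q + I * κ := by rw [ht₂]; push_cast; ring
      rw [mem_preimage, this]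
      exact hκD
    · simp only [hw] at hwq
      simp
      linarith
  obtain ⟨r, hr, hball⟩ := Metric.eventually_nhds_iff_ball.1 hev
  have hqe : q ∈ closure (closure D)ᶜ := by
    refine Metric.mem_closure_iff.2 fun ε hε => ⟨q - I * (ε / 2 : ℝ), hq' _ (by positivity), ?_⟩
    rw [dist_eq_norm, sub_sub_cancel, norm_mul, norm_I, one_mul, norm_real, Real.norm_eq_abs,
      abs_of_pos (by positivity)]
    linarith
  obtain ⟨p', hp', hp's⟩ := hG.isStationary_of_boundary hD hq hqe (hmem _ ht₁I) ht₂mem hr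
    fun z hz => ⟨(hball z hz).1, hG.eq_of_exit_below ht₀mem ht₂mem (by linarith) (hball z hz).1 hD
      (fun h => by
        have h1 := hmle _ (subset_closure h)
        have h2 := (hball z hz).2
        simp only [hw, sub_re, mul_re, I_re, ofReal_re, I_im, ofReal_im, sub_im, mul_im] at h1
        ring_nf at h1
        linarith)
      fun s hs hsD => hgood s hs.1 (hs.2.trans_lt (by linarith)) _ hsD⟩
  exact hbad' p' hp' hp's

end

section

variable {D : Set ℂ} {α β a b c d δ : ℝ} {lam : ℝ → ℝ} {f : ℂ → ℂ} {G G' : ℝ → ℂ → ℂ}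

lemma IsStationary.of_neg {p : ℂ} {t : ℝ}
    (h : IsStationary (fun t ζ => G (-t) (-ζ)) (-b) (-a) (-p) (-t)) : IsStationary G a b p t := by
  simpa using isStationary_neg h

lemma IsFamily.eq_of_exit_above (hG : IsFamily D a b f G) {z : ℂ}
    {t₁ t₀ : ℝ} (ht₁ : t₁ ∈ Icc a b) (ht₀ : t₀ ∈ Icc a b) (hle : t₀ ≤ t₁) (h₀ : z - I * t₀ ∈ D)
    (hD : IsOpen D) (h₁ : z - I * t₁ ∉ D)
    (hst : ∀ t ∈ Icc t₀ t₁, z - I * t ∈ D → IsStationary G a b (z - I * t) t) :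
    G t₀ (z - I * t₀) = f z := by
  have e : ∀ t : ℝ, -(-z - I * (t : ℂ)) = z - I * (-t : ℝ) := fun t => by push_cast; ring
  have h := hG.neg.eq_of_exit_below (z := -z) (t₁ := -t₁) (t₀ := -t₀)
    ⟨by linarith [ht₁.2], by linarith [ht₁.1]⟩ ⟨by linarith [ht₀.2], by linarith [ht₀.1]⟩
    (by linarith) (by rw [Set.mem_neg, e, neg_neg]; exact h₀) hD.neg
    (by rw [Set.mem_neg, e, neg_neg]; exact h₁) ?_
  · simp only [e, neg_neg] at h
    exact h
  · intro t ht htD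
    rw [Set.mem_neg, e] at htD
    have := isStationary_neg (hst (-t) ⟨by linarith [ht.2], by linarith [ht.1]⟩ htD)
    rw [← e] at this
    rwa [neg_neg, neg_neg] at this

/-- The holomorphic extensions from the translates of the boundary curve are restrictions of `f`. -/
lemma IsFamily.apply_eq (hD : IsOpen D) (hDc : IsConnected D) (hlam : Continuous lam)
    (hδ : 0 < δ) (hbelow : ∀ ζ ∈ closure D, ζ.im + a + δ ≤ lam ζ.re)
    (habove : ∀ ζ ∈ closure D, lam ζ.re + δ ≤ ζ.im + b) (hG : IsFamily D a b f G)
    (hst : ∀ p ∈ D, ∀ t : ℝ, |p.im + t - lam p.re| < δ → IsStationary G a b p t)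
    (hlow : ∃ q ∈ closure D, (∀ κ : ℝ, 0 < κ → q - I * κ ∉ closure D) ∧
      ∀ ε > 0, ∃ κ ∈ Ioo (0 : ℝ) ε, q + I * κ ∈ D)
    (hhigh : ∃ q ∈ closure D, (∀ κ : ℝ, 0 < κ → q + I * κ ∉ closure D) ∧
      ∀ ε > 0, ∃ κ ∈ Ioo (0 : ℝ) ε, q - I * κ ∈ D)
    {t : ℝ} (ht : t ∈ Icc a b) {p : ℂ} (hp : p ∈ D) : G t p = f (p + I * t) := by
  obtain ⟨ζ₀, hζ₀⟩ := hDc.nonempty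
  have hcl : closure (-D) = -closure D := by
    simpa using ((Homeomorph.neg ℂ).preimage_closure D).symm
  have hall : ∀ t ∈ Icc a b, ∀ p ∈ D, IsStationary G a b p t := by
    intro t ht p hp
    rcases le_total (lam ζ₀.re - ζ₀.im) t with hle | hle
    · obtain ⟨q, h1, h2, h3⟩ := hlow
      exact isStationary_of_le hD hDc.isPreconnected hlam hδ hbelow hG hst h1 h2 h3 hζ₀ ht hle hp
    · obtain ⟨q, h1, h2, h3⟩ := hhigh
      refine IsStationary.of_neg ?_
      have hpre : IsPreconnected (-D) := by
        rw [← image_neg_eq_neg]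
        exact hDc.isPreconnected.image _ continuous_neg.continuousOn
      refine isStationary_of_le hD.neg hpre
        (lam := fun x => -lam (-x)) (by fun_prop) hδ ?_ hG.neg ?_ (q := -q) (ζ₀ := -ζ₀) ?_ ?_ ?_
        (by simpa using hζ₀) ⟨by linarith [ht.2], by linarith [ht.1]⟩ ?_ (by simpa using hp)
      · intro ζ hζ
        rw [hcl] at hζ
        have := habove _ hζ
        simp only [neg_re, neg_im] at this
        linarith
      · intro p hp t ht
        have h4 := hst (-p) hp (-t) (by
          rw [← abs_neg]
          convert ht using 2
          simp
          ring)
        simpa using isStationary_neg h4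
      · rw [hcl]
        simpa using h1
      · intro κ hκ
        rw [hcl, Set.mem_neg]
        convert h2 κ hκ using 2
        ring
      · intro ε hε
        obtain ⟨κ, hκ, hκD⟩ := h3 ε hε
        refine ⟨κ, hκ, ?_⟩
        rw [Set.mem_neg]
        convert hκD using 1
        ring
      · simp
        linarith
  set z : ℂ := p + I * t with hz
  have hpz : p = z - I * t := by rw [hz]; ring
  rw [hpz] at hp ⊢
  have hout : z - I * a ∉ D ∨ z - I * b ∉ D := by
    by_contra! hcon
    have h1 := hbelow _ (subset_closure hcon.1)
    have h2 := habove _ (subset_closure hcon.2)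
    simp only [sub_re, mul_re, I_re, ofReal_re, I_im, ofReal_im, sub_im, mul_im] at h1 h2
    ring_nf at h1 h2
    linarith
  rcases hout with h | h
  · exact hG.eq_of_exit_below (left_mem_Icc.2 (ht.1.trans ht.2)) ht ht.1 hp hD h
      fun s hs hsD => hall s ⟨hs.1, hs.2.trans ht.2⟩ _ hsD
  · exact hG.eq_of_exit_above (right_mem_Icc.2 (ht.1.trans ht.2)) ht ht.2 hp hD h
      fun s hs hsD => hall s ⟨ht.1.trans hs.1, hs.2⟩ _ hsD

end

lemma differentiableOn_ball_of_off_line {f : ℂ → ℂ} {c : ℂ} {r x₀ : ℝ}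
    (hf : ContinuousOn f (Metric.ball c r))
    (hd : ∀ z ∈ Metric.ball c r, z.re ≠ x₀ → DifferentiableAt ℂ f z) :
    DifferentiableOn ℂ f (Metric.ball c r) := by
  have hrect : ∀ z w : ℂ, Rectangle z w ⊆ Metric.ball c r →
      x₀ ∉ Ioo (min z.re w.re) (max z.re w.re) →
      (∫ x : ℝ in z.re..w.re, f (x + z.im * I)) - (∫ x : ℝ in z.re..w.re, f (x + w.im * I)) +
      I • (∫ y : ℝ in z.im..w.im, f (re w + y * I)) -
      I • (∫ y : ℝ in z.im..w.im, f (re z + y * I)) = 0 := by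
    intro z w hsub hx
    refine integral_boundary_rect_eq_zero_of_continuousOn_of_differentiableOn f z w
      (hf.mono hsub) fun u hu => (hd u (hsub ?_) ?_).differentiableWithinAt
    · exact ⟨Ioo_subset_Icc_self hu.1, Ioo_subset_Icc_self hu.2⟩
    · rintro rfl
      exact hx hu.1
  refine IsExactOn.differentiableOn Metric.isOpen_ball
    (IsConservativeOn.isExactOn_ball hf fun z w hsub => ?_)
  rw [← add_eq_zero_iff_eq_neg, wedgeIntegral_add_wedgeIntegral_eq]
  by_cases hx : x₀ ∈ Ioo (min z.re w.re) (max z.re w.re)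
  · have hx' : x₀ ∈ uIcc z.re w.re := Ioo_subset_Icc_self hx
    have hs₁ : uIcc z.re x₀ ⊆ uIcc z.re w.re := uIcc_subset_uIcc_left hx'
    have hs₂ : uIcc x₀ w.re ⊆ uIcc z.re w.re := uIcc_subset_uIcc_right hx'
    have h1 := hrect z ⟨x₀, w.im⟩ ((reProdIm_subset_iff.2 (prod_mono hs₁ le_rfl)).trans hsub)
      (by
        simp only
        rintro ⟨h1, h2⟩
        rcases le_total z.re x₀ with h | h
        · rw [max_eq_right h] at h2; exact h2.false
        · rw [min_eq_right h] at h1; exact h1.false)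
    have h2 := hrect ⟨x₀, z.im⟩ w ((reProdIm_subset_iff.2 (prod_mono hs₂ le_rfl)).trans hsub)
      (by
        simp only
        rintro ⟨h1, h2⟩
        rcases le_total w.re x₀ with h | h
        · rw [max_eq_left h] at h2; exact h2.false
        · rw [min_eq_left h] at h1; exact h1.false)
    have hint : ∀ y ∈ uIcc z.im w.im, ∀ x₁ x₂ : ℝ, uIcc x₁ x₂ ⊆ uIcc z.re w.re →
        IntervalIntegrable (fun x : ℝ => f (x + y * I)) volume x₁ x₂ := by
      intro y hy x₁ x₂ hsub'
      refine ContinuousOn.intervalIntegrable (hf.comp (f := fun x : ℝ => (x + y * I : ℂ))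
        (by fun_prop) fun x hx => hsub ?_)
      refine mem_reProdIm.2 ⟨?_, ?_⟩
      · simpa using hsub' hx
      · simpa using hy
    have e1 := intervalIntegral.integral_add_adjacent_intervals
      (hint z.im left_mem_uIcc _ _ hs₁) (hint z.im left_mem_uIcc _ _ hs₂)
    have e2 := intervalIntegral.integral_add_adjacent_intervals
      (hint w.im right_mem_uIcc _ _ hs₁) (hint w.im right_mem_uIcc _ _ hs₂)
    rw [← e1, ← e2]
    simp only at h1 h2
    linear_combination h1 + h2
  · exact hrect z w hsub hx

lemma differentiableOn_of_off_finite {f : ℂ → ℂ} {W : Set ℂ} (hW : IsOpen W)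
    (hf : ContinuousOn f W) {C : Set ℝ} (hC : C.Finite)
    (hd : ∀ z ∈ W, z.re ∉ C → DifferentiableAt ℂ f z) : DifferentiableOn ℂ f W := by
  intro z hz
  have h1 : ∀ᶠ w : ℂ in 𝓝 z, w.re ∉ C \ {z.re} :=
    (((hC.subset sdiff_subset).isClosed.isOpen_compl).preimage continuous_re).mem_nhds (by simp)
  obtain ⟨r, hr, hball⟩ := Metric.eventually_nhds_iff_ball.1 (h1.and (hW.mem_nhds hz))
  have h2 := differentiableOn_ball_of_off_line (f := f) (c := z) (r := r) (x₀ := z.re)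
    (hf.mono fun w hw => (hball w hw).2) fun w hw hne =>
      hd w (hball w hw).2 fun hC => (hball w hw).1 ⟨hC, hne⟩
  exact (h2.differentiableAt (Metric.ball_mem_nhds z hr)).differentiableWithinAt

/-- Boundary points on the vertical line over `x` are vertical limits of points of `D`. -/
def IsVerticallyAccessible (D : Set ℂ) (x : ℝ) : Prop :=
  ∀ ζ ∈ frontier D, ζ.re = x → ∀ ε > 0, ∃ κ : ℝ, |κ| < ε ∧ ζ + I * κ ∈ D

lemma IsVerticallyAccessible.conj {D : Set ℂ} {x : ℝ} (h : IsVerticallyAccessible D x) :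
    IsVerticallyAccessible (conjCLE '' D) x := by
  intro ζ hζ hx ε hε
  rw [frontier_conj] at hζ
  obtain ⟨ζ', hζ', rfl⟩ := hζ
  obtain ⟨κ, hκ, hD⟩ := h ζ' hζ' (by simpa using hx) ε hε
  refine ⟨-κ, by rwa [abs_neg], ζ' + I * κ, hD, ?_⟩
  apply Complex.ext <;> simp

lemma IsVerticallyAccessible.neg {D : Set ℂ} {x : ℝ} (h : IsVerticallyAccessible D x) :
    IsVerticallyAccessible (-D) (-x) := by
  intro ζ hζ hx ε hε
  have hfr : frontier (-D) = -frontier D := by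
    simpa using ((Homeomorph.neg ℂ).preimage_frontier D).symm
  rw [hfr] at hζ
  obtain ⟨κ, hκ, hD⟩ := h (-ζ) hζ (by simp [hx]) ε hε
  refine ⟨-κ, by rwa [abs_neg], ?_⟩
  rw [Set.mem_neg]
  convert hD using 1
  push_cast
  ring

lemma IsVerticallyAccessible.exists_lowest {D : Set ℂ} (hD : IsOpen D)
    (hb : Bornology.IsBounded D) {p : ℂ} (hp : p ∈ D) (h : IsVerticallyAccessible D p.re) :
    ∃ q ∈ closure D, (∀ κ : ℝ, 0 < κ → q - I * κ ∉ closure D) ∧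
      ∀ ε > 0, ∃ κ ∈ Ioo (0 : ℝ) ε, q + I * κ ∈ D := by
  have hK : IsCompact (closure D ∩ re ⁻¹' {p.re}) :=
    hb.isCompact_closure.inter_right (isClosed_singleton.preimage continuous_re)
  obtain ⟨q, ⟨hq, hqre⟩, hmin⟩ := hK.exists_isMinOn ⟨p, subset_closure hp, rfl⟩
    continuous_im.continuousOn
  have hlow : ∀ κ : ℝ, 0 < κ → q - I * κ ∉ closure D := by
    intro κ hκ hcon
    have := hmin ⟨hcon, show (q - I * κ).re = p.re by simpa using hqre⟩
    simp at this
    linarith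
  have hqD : q ∉ D := by
    intro hqD
    have h1 : ∀ᶠ κ : ℝ in 𝓝[>] 0, q - I * κ ∈ D := by
      have hc : ContinuousAt (fun κ : ℝ => q - I * (κ : ℂ)) 0 := by fun_prop
      exact nhdsWithin_le_nhds (hc.preimage_mem_nhds (hD.mem_nhds (by simpa using hqD)))
    obtain ⟨κ, h2, h3⟩ := (h1.and self_mem_nhdsWithin).exists
    exact hlow κ h3 (subset_closure h2)
  refine ⟨q, hq, hlow, fun ε hε => ?_⟩
  obtain ⟨κ, hκ, hκD⟩ := h q (by rw [hD.frontier_eq]; exact ⟨hq, hqD⟩) hqre ε hε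
  refine ⟨κ, ⟨?_, (abs_lt.1 hκ).2⟩, hκD⟩
  rcases lt_trichotomy κ 0 with h0 | h0 | h0
  · refine absurd (subset_closure hκD) ?_
    convert hlow (-κ) (by linarith) using 2
    push_cast
    ring
  · subst h0
    exact absurd (by simpa using hκD) hqD
  · exact h0

lemma IsVerticallyAccessible.exists_highest {D : Set ℂ} (hD : IsOpen D)
    (hb : Bornology.IsBounded D) {p : ℂ} (hp : p ∈ D) (h : IsVerticallyAccessible D p.re) :
    ∃ q ∈ closure D, (∀ κ : ℝ, 0 < κ → q + I * κ ∉ closure D) ∧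
      ∀ ε > 0, ∃ κ ∈ Ioo (0 : ℝ) ε, q - I * κ ∈ D := by
  have hcl : closure (-D) = -closure D := by
    simpa using ((Homeomorph.neg ℂ).preimage_closure D).symm
  obtain ⟨q, h1, h2, h3⟩ := IsVerticallyAccessible.exists_lowest hD.neg hb.neg (p := -p)
    (by simpa using hp) (by simpa using h.neg)
  rw [hcl] at h1 h2
  refine ⟨-q, h1, fun κ hκ hcon => h2 κ hκ ?_, fun ε hε => ?_⟩
  · rw [Set.mem_neg]
    convert hcon using 1
    ring
  · obtain ⟨κ, hκ, hκD⟩ := h3 ε hε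
    refine ⟨κ, hκ, ?_⟩
    rw [Set.mem_neg] at hκD
    convert hκD using 1
    ring

lemma finite_zeros_of_analyticAt {h : ℝ → ℝ} (hh : ∀ s, AnalyticAt ℝ h s) (hne : ∃ s, h s ≠ 0)
    (u v : ℝ) : {s ∈ Icc u v | h s = 0}.Finite := by
  by_contra hinf
  obtain ⟨x, -, hx⟩ := Set.Infinite.exists_accPt_of_subset_isCompact hinf
    (isCompact_Icc (a := u) (b := v)) fun s hs => hs.1
  obtain ⟨s, hs⟩ := hne
  refine hs (AnalyticOnNhd.eqOn_zero_of_preconnected_of_frequently_eq_zero (U := univ)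
    (fun s _ => hh s) isPreconnected_univ (mem_univ x) ?_ (mem_univ s))
  exact (accPt_iff_frequently_nhdsNE.1 hx).mono fun s hs => hs.2

section Curve

variable {D : Set ℂ} {γ : ℝ → ℂ}

lemma exists_int_of_apply_eq (hper : Function.Periodic γ (2 * Real.pi))
    (hinj : InjOn γ (Ico 0 (2 * Real.pi))) {s t : ℝ} (h : γ s = γ t) :
    ∃ n : ℤ, s - t = n * (2 * Real.pi) := by
  obtain ⟨m, hm, -⟩ := existsUnique_zsmul_near_of_pos' Real.two_pi_pos s
  obtain ⟨n, hn, -⟩ := existsUnique_zsmul_near_of_pos' Real.two_pi_pos t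
  have := hinj hm hn (by rw [hper.sub_zsmul_eq, hper.sub_zsmul_eq, h])
  refine ⟨m - n, ?_⟩
  simp only [zsmul_eq_mul] at this
  push_cast
  linarith

lemma exists_near_parameter (hc : Continuous γ) (hper : Function.Periodic γ (2 * Real.pi))
    (hinj : InjOn γ (Ico 0 (2 * Real.pi))) (s₀ : ℝ) {η : ℝ} (hη : 0 < η) :
    ∃ ε > 0, ∀ s, dist (γ s) (γ s₀) < ε → ∃ s' ∈ Metric.ball s₀ η, γ s' = γ s := by
  have hK : IsCompact (Icc (s₀ - Real.pi) (s₀ + Real.pi) \ Metric.ball s₀ η) :=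
    isCompact_Icc.diff Metric.isOpen_ball
  have hmem : (γ '' (Icc (s₀ - Real.pi) (s₀ + Real.pi) \ Metric.ball s₀ η))ᶜ ∈ 𝓝 (γ s₀) := by
    refine (hK.image hc).isClosed.isOpen_compl.mem_nhds ?_
    rintro ⟨s, ⟨hs, hsη⟩, hs'⟩
    obtain ⟨n, hn⟩ := exists_int_of_apply_eq hper hinj hs'
    have hn0 : n = 0 := by
      by_contra h0
      have h1 : (1 : ℝ) ≤ |(n : ℝ)| := by exact_mod_cast Int.one_le_abs h0
      have h2 : |s - s₀| ≤ Real.pi := abs_le.2 ⟨by linarith [hs.1], by linarith [hs.2]⟩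
      rw [hn, abs_mul, abs_of_pos Real.two_pi_pos] at h2
      nlinarith [Real.pi_pos]
    rw [hn0] at hn
    refine hsη ?_
    rw [show s = s₀ by simpa [sub_eq_zero] using hn]
    exact Metric.mem_ball_self hη
  obtain ⟨ε, hε, hball⟩ := Metric.mem_nhds_iff.1 hmem
  refine ⟨ε, hε, fun s hs => ?_⟩
  obtain ⟨s', hs', he⟩ := hper.exists_mem_Ico Real.two_pi_pos s (s₀ - Real.pi)
  refine ⟨s', ?_, he.symm⟩
  by_contra hcon
  exact hball (Metric.mem_ball.2 hs) ⟨s', ⟨⟨hs'.1, by linarith [hs'.2]⟩, hcon⟩, he.symm⟩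

lemma hasStrictDerivAt_re (han : ∀ s, AnalyticAt ℝ γ s) (s : ℝ) :
    HasStrictDerivAt (fun s => (γ s).re) (deriv γ s).re s :=
  reCLM.hasStrictFDerivAt.comp_hasStrictDerivAt s (han s).hasStrictDerivAt

lemma isVerticallyAccessible_of_forall_deriv_re_ne_zero (hD : IsOpen D)
    (han : ∀ s, AnalyticAt ℝ γ s) (hper : Function.Periodic γ (2 * Real.pi))
    (hinj : InjOn γ (Ico 0 (2 * Real.pi))) (hrange : range γ = frontier D) {x : ℝ}
    (hx : ∀ s, (γ s).re = x → (deriv γ s).re ≠ 0) : IsVerticallyAccessible D x := by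
  have hc : Continuous γ := continuous_iff_continuousAt.2 fun s => (han s).continuousAt
  intro ζ hζ hζx ε hε
  rw [← hrange] at hζ
  obtain ⟨s₀, rfl⟩ := hζ
  have hne := hx s₀ hζx
  have hdc : ContinuousAt (fun s => (deriv γ s).re) s₀ :=
    continuous_re.continuousAt.comp (han s₀).deriv.continuousAt
  obtain ⟨η, hη, hηne⟩ := Metric.eventually_nhds_iff_ball.1 (hdc.eventually_ne hne)
  have hρinj : InjOn (fun s => (γ s).re) (Metric.ball s₀ η) := by
    have key : ∀ u ∈ Metric.ball s₀ η, ∀ v ∈ Metric.ball s₀ η, u < v → (γ u).re ≠ (γ v).re := by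
      intro u hu v hv huv he
      obtain ⟨w, hw, hw0⟩ := exists_deriv_eq_zero (f := fun s => (γ s).re) huv
        (continuous_re.comp hc).continuousOn he
      rw [(hasStrictDerivAt_re han w).hasDerivAt.deriv] at hw0
      refine hηne w ?_ hw0
      rw [Real.ball_eq_Ioo] at *
      exact ⟨by linarith [hu.1, hw.1], by linarith [hv.2, hw.2]⟩
    intro u hu v hv he
    rcases lt_trichotomy u v with h | h | h
    · exact absurd he (key u hu v hv h)
    · exact h
    · exact absurd he.symm (key v hv u hu h)
  obtain ⟨ε₁, hε₁, hnear⟩ := exists_near_parameter hc hper hinj s₀ hη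
  set r := min ε ε₁ / 4 with hr
  have hr0 : 0 < r := by positivity
  have hrε : 4 * r ≤ ε := by linarith [min_le_left ε ε₁]
  have hrε₁ : 4 * r ≤ ε₁ := by linarith [min_le_right ε ε₁]
  obtain ⟨η', hη', hsmall⟩ := Metric.continuousAt_iff.1 (hc.continuousAt (x := s₀)) r hr0
  set N := Metric.ball s₀ (min η η') with hN
  have hNη : N ⊆ Metric.ball s₀ η := Metric.ball_subset_ball (min_le_left _ _)
  have hNγ : ∀ s ∈ N, dist (γ s) (γ s₀) < r := fun s hs =>
    hsmall (lt_of_lt_of_le (Metric.mem_ball.1 hs) (min_le_right _ _))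
  have himg : (fun s => (γ s).re) '' N ∈ 𝓝 (γ s₀).re := by
    rw [← (hasStrictDerivAt_re han s₀).map_nhds_eq hne]
    exact image_mem_map (Metric.ball_mem_nhds _ (lt_min hη hη'))
  have hnb : re ⁻¹' ((fun s => (γ s).re) '' N) ∩ Metric.ball (γ s₀) r ∈ 𝓝 (γ s₀) :=
    inter_mem (continuous_re.continuousAt.preimage_mem_nhds himg) (Metric.ball_mem_nhds _ hr0)
  have hcl : γ s₀ ∈ closure D := frontier_subset_closure (hrange ▸ mem_range_self s₀)
  obtain ⟨d, ⟨⟨s₁, hs₁, hre⟩, hd⟩, hdD⟩ := mem_closure_iff_nhds.1 hcl _ hnb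
  simp only at hre
  set κ := (d - γ s₁).im with hκ
  have hdeq : d = γ s₁ + I * κ := by
    apply Complex.ext <;> simp [hκ, hre]
  have hκ0 : κ ≠ 0 := by
    intro h0
    rw [h0] at hdeq
    have : d ∈ frontier D := by
      rw [hdeq, ← hrange]
      exact ⟨s₁, by simp⟩
    rw [hD.frontier_eq] at this
    exact this.2 hdD
  have hκr : |κ| < 2 * r := by
    refine (abs_im_le_norm _).trans_lt ?_
    rw [← dist_eq_norm]
    have h1 := hNγ s₁ hs₁
    have h2 : dist d (γ s₀) < r := hd
    rw [dist_comm] at h1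
    linarith [dist_triangle d (γ s₀) (γ s₁)]
  have hsub : (fun s => γ s + I * κ) '' N ⊆ D := by
    refine IsPreconnected.subset_of_closure_inter_subset ?_ hD ⟨d, ⟨s₁, hs₁, hdeq.symm⟩, hdD⟩ ?_
    · exact (convex_ball _ _).isPreconnected.image _ (by fun_prop)
    · rintro _ ⟨hw, s, hs, rfl⟩
      by_contra hwD
      have hfr : γ s + I * κ ∈ range γ := by
        rw [hrange, hD.frontier_eq]
        exact ⟨hw, hwD⟩
      obtain ⟨s', hs'⟩ := hfr
      obtain ⟨s'', hs''η, hs''⟩ := hnear s' (by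
        rw [hs', dist_eq_norm, show γ s + I * κ - γ s₀ = (γ s - γ s₀) + I * κ by ring]
        have h1 := hNγ s hs
        rw [dist_eq_norm] at h1
        have h2 := norm_add_le (γ s - γ s₀) (I * κ)
        rw [norm_mul, norm_I, one_mul, norm_real, Real.norm_eq_abs] at h2
        linarith)
      have he : s'' = s := hρinj hs''η (hNη hs) (by simp [hs'', hs'])
      rw [he, hs'] at hs''
      exact hκ0 (by simpa using hs'')
  exact ⟨κ, by linarith, hsub ⟨s₀, Metric.mem_ball_self (lt_min hη hη'), rfl⟩⟩

lemma exists_deriv_re_ne_zero (hD : IsOpen D) (hb : Bornology.IsBounded D) (hDne : D.Nonempty)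
    (han : ∀ s, AnalyticAt ℝ γ s) (hrange : range γ = frontier D) :
    ∃ s, (deriv γ s).re ≠ 0 := by
  by_contra! hcon
  have hconst : ∀ s, (γ s).re = (γ 0).re := fun s =>
    is_const_of_deriv_eq_zero (f := fun s => (γ s).re)
      (fun s => (hasStrictDerivAt_re han s).hasDerivAt.differentiableAt)
      (fun s => by rw [(hasStrictDerivAt_re han s).hasDerivAt.deriv, hcon]) s 0
  have hfr : ∀ z ∈ frontier D, z.re = (γ 0).re := by
    rw [← hrange]
    rintro _ ⟨s, rfl⟩
    exact hconst s
  have hDre : ∀ p ∈ D, p.re = (γ 0).re := by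
    intro p hp
    have h1 := re_le_of_forall_frontier hb (g := fun z => z) continuousOn_id differentiableOn_id
      (fun z hz => (hfr z hz).le) (subset_closure hp)
    have h2 := re_le_of_forall_frontier hb (g := fun z => -z) continuousOn_id.neg
      differentiableOn_id.neg (C := -(γ 0).re) (fun z hz => by simp [hfr z hz])
      (subset_closure hp)
    simp only [neg_re] at h2
    linarith
  obtain ⟨p, hp⟩ := hDne
  obtain ⟨r, hr, hball⟩ := Metric.isOpen_iff.1 hD p hp
  have h1 : p + (r / 2 : ℝ) ∈ D := hball (by
    rw [Metric.mem_ball, dist_eq_norm, add_sub_cancel_left, norm_real, Real.norm_eq_abs,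
      abs_of_pos (by positivity)]
    linarith)
  have h2 := hDre _ h1
  rw [add_re, ofReal_re, hDre p hp] at h2
  linarith

lemma finite_setOf_not_isVerticallyAccessible (hD : IsOpen D) (hb : Bornology.IsBounded D)
    (hDne : D.Nonempty) (han : ∀ s, AnalyticAt ℝ γ s)
    (hper : Function.Periodic γ (2 * Real.pi)) (hinj : InjOn γ (Ico 0 (2 * Real.pi)))
    (hrange : range γ = frontier D) : {x | ¬IsVerticallyAccessible D x}.Finite := by
  have hfin := finite_zeros_of_analyticAt (h := fun s => (deriv γ s).re)
    (fun s => (reCLM.analyticAt _).comp (han s).deriv)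
    (exists_deriv_re_ne_zero hD hb hDne han hrange) 0 (2 * Real.pi)
  refine (hfin.image fun s => (γ s).re).subset fun x hx => ?_
  by_contra hcon
  refine hx (isVerticallyAccessible_of_forall_deriv_re_ne_zero hD han hper hinj hrange
    fun s hs h0 => hcon ?_)
  have hper2 : Function.Periodic (fun s => (γ s, deriv γ s)) (2 * Real.pi) := by
    intro s
    have : deriv γ (s + 2 * Real.pi) = deriv γ s := by
      rw [← deriv_comp_add_const]
      congr 1
      exact funext hper
    simp only [hper s, this]
  obtain ⟨s', hs', he⟩ := hper2.exists_mem_Ico₀ Real.two_pi_pos s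
  simp only [Prod.mk.injEq] at he
  exact ⟨s', ⟨Ico_subset_Icc_self hs', by rw [← he.2]; exact h0⟩,
    by simp only; rw [← he.1]; exact hs⟩

end Curve

section

variable {D : Set ℂ} {α β a b c d δ : ℝ} {lam : ℝ → ℝ} {f : ℂ → ℂ} {G G' : ℝ → ℂ → ℂ}

lemma Setting.conj (h : Setting D α β a b c d lam δ) :
    Setting (conjCLE '' D) α β c d a b lam δ := by
  refine ⟨conjCLE.toHomeomorph.isOpenMap _ h.isOpen, ?_,
    h.isConnected.image _ conjCLE.continuous.continuousOn, h.continuous, h.pos, ?_, ?_, ?_, ?_, ?_⟩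
  · exact conjCLE.toContinuousLinearMap.lipschitz.isBounded_image h.isBounded
  all_goals
    rw [closure_conj]
    rintro _ ⟨ζ, hζ, rfl⟩
  · simpa using h.re_mem ζ hζ
  · simpa using h.below_conj ζ hζ
  · simpa using h.above_conj ζ hζ
  · simpa using h.below ζ hζ
  · simpa using h.above ζ hζ

lemma conj_conj_image (D : Set ℂ) : conjCLE '' (conjCLE '' D) = D := by
  rw [image_image]
  simp

lemma Setting.exists_translate (h : Setting D α β a b c d lam δ) {z : ℂ}
    (hz : z ∈ interior (⋃ t ∈ Icc a b, (fun ζ => ζ + I * (t : ℂ)) '' frontier D))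
    (hacc : IsVerticallyAccessible D z.re) : ∃ t ∈ Icc a b, z - I * t ∈ D := by
  obtain ⟨r, hr, hball⟩ := Metric.mem_nhds_iff.1 (mem_interior_iff_mem_nhds.1 hz)
  have key : ∀ v : ℝ, 0 < |v| → |v| < r →
      ∃ t ∈ Icc a b, ∃ κ : ℝ, |κ| < |v| ∧ z - I * (t - v - κ : ℝ) ∈ D := by
    intro v hv hvr
    have hmem := hball (show z + I * v ∈ Metric.ball z r by
      rw [Metric.mem_ball, dist_eq_norm, add_sub_cancel_left, norm_mul, norm_I, one_mul, norm_real]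
      exact hvr)
    simp only [mem_iUnion, mem_image] at hmem
    obtain ⟨t, ht, ζ, hζ, he⟩ := hmem
    have hζe : ζ = z + I * v - I * t := by rw [← he]; ring
    obtain ⟨κ, hκ, hκD⟩ := hacc ζ hζ (by simp [hζe]) |v| hv
    refine ⟨t, ht, κ, hκ, ?_⟩
    convert hκD using 1
    rw [hζe]
    push_cast
    ring
  have hr2 : |r / 2| = r / 2 := abs_of_pos (half_pos hr)
  have hr2' : |-(r / 2)| = r / 2 := by rw [abs_neg, hr2]
  obtain ⟨t₁, ht₁, κ₁, hκ₁, h₁⟩ := key (r / 2) (by linarith) (by linarith)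
  obtain ⟨t₂, ht₂, κ₂, hκ₂, h₂⟩ := key (-(r / 2)) (by linarith) (by linarith)
  rw [hr2] at hκ₁
  rw [hr2'] at hκ₂
  rw [abs_lt] at hκ₁ hκ₂
  set s₁ : ℝ := t₁ - r / 2 - κ₁ with hs₁
  set s₂ : ℝ := t₂ - -(r / 2) - κ₂ with hs₂
  have hs₁b : s₁ ≤ b := by linarith [ht₁.2, hκ₁.1]
  have hs₂a : a ≤ s₂ := by linarith [ht₂.1, hκ₂.2]
  by_cases h1 : a ≤ s₁
  · exact ⟨s₁, ⟨h1, hs₁b⟩, h₁⟩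
  by_cases h2 : s₂ ≤ b
  · exact ⟨s₂, ⟨hs₂a, h2⟩, h₂⟩
  have hb := h.below _ (subset_closure h₁)
  have ha := h.above _ (subset_closure h₂)
  simp only [sub_re, sub_im, mul_re, mul_im, I_re, I_im, ofReal_re, ofReal_im, zero_mul, one_mul,
    mul_zero, sub_zero, zero_add] at ha hb
  linarith [h.pos]

lemma Setting.differentiableOn_interior (h : Setting D α β a b c d lam δ)
    (hG : IsFamily D a b f G) (hG' : IsFamily (conjCLE '' D) c d f G')
    (hfr : (frontier D).Nonempty) (hfin : {x | ¬IsVerticallyAccessible D x}.Finite)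
    (hf : ContinuousOn f (⋃ t ∈ Icc a b, (fun ζ => ζ + I * (t : ℂ)) '' frontier D)) :
    DifferentiableOn ℂ f
      (interior (⋃ t ∈ Icc a b, (fun ζ => ζ + I * (t : ℂ)) '' frontier D)) := by
  refine differentiableOn_of_off_finite isOpen_interior (hf.mono interior_subset) hfin
    fun z hz hzre => ?_
  have hacc : IsVerticallyAccessible D z.re := by simpa using hzre
  obtain ⟨t, ht, hzt⟩ := h.exists_translate hz hacc
  have hacc' : IsVerticallyAccessible D (z - I * t).re := by simpa using hacc
  have happ : ∀ p ∈ D, G t p = f (p + I * t) := fun p hp =>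
    hG.apply_eq h.isOpen h.isConnected h.continuous h.pos h.below h.above
      (fun p hp t ht => h.isStationary hG hG' hfr hp ht)
      (hacc'.exists_lowest h.isOpen h.isBounded hzt)
      (hacc'.exists_highest h.isOpen h.isBounded hzt) ht hp
  have hnb : ∀ᶠ w in 𝓝 z, w - I * t ∈ D :=
    (show ContinuousAt (fun w : ℂ => w - I * t) z by fun_prop).preimage_mem_nhds
      (h.isOpen.mem_nhds hzt)
  have hdiff : DifferentiableAt ℂ (fun w => G t (w - I * t)) z :=
    ((hG.differentiableOn t ht).differentiableAt (h.isOpen.mem_nhds hzt)).comp z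
      (by fun_prop : DifferentiableAt ℂ (fun w : ℂ => w - I * t) z)
  refine hdiff.congr_of_eventuallyEq (hnb.mono fun w hw => ?_)
  simp only
  rw [happ _ hw, sub_add_cancel]

lemma exists_setting (hD : IsOpen D) (hDc : IsConnected D) (hb : Bornology.IsBounded D)
    (hlam : Continuous lam) (hre : ∀ ζ ∈ closure D, ζ.re ∈ Icc α β)
    (h1 : ∀ ζ ∈ closure D, ζ.im + a < lam ζ.re) (h2 : ∀ ζ ∈ closure D, lam ζ.re < ζ.im + b)
    (h3 : ∀ ζ ∈ closure D, -ζ.im + c < lam ζ.re) (h4 : ∀ ζ ∈ closure D, lam ζ.re < -ζ.im + d) :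
    ∃ δ, Setting D α β a b c d lam δ := by
  have key : ∀ g : ℂ → ℝ, Continuous g → (∀ ζ ∈ closure D, 0 < g ζ) →
      ∃ δ > 0, ∀ ζ ∈ closure D, δ ≤ g ζ := by
    intro g hg hpos
    obtain ⟨ζ, hζ, hmin⟩ := hb.isCompact_closure.exists_isMinOn hDc.nonempty.closure hg.continuousOn
    exact ⟨g ζ, hpos ζ hζ, fun w hw => hmin hw⟩
  obtain ⟨δ₁, p₁, k₁⟩ := key (fun ζ => lam ζ.re - (ζ.im + a)) (by fun_prop)
    fun ζ hζ => sub_pos.2 (h1 ζ hζ)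
  obtain ⟨δ₂, p₂, k₂⟩ := key (fun ζ => ζ.im + b - lam ζ.re) (by fun_prop)
    fun ζ hζ => sub_pos.2 (h2 ζ hζ)
  obtain ⟨δ₃, p₃, k₃⟩ := key (fun ζ => lam ζ.re - (-ζ.im + c)) (by fun_prop)
    fun ζ hζ => sub_pos.2 (h3 ζ hζ)
  obtain ⟨δ₄, p₄, k₄⟩ := key (fun ζ => -ζ.im + d - lam ζ.re) (by fun_prop)
    fun ζ hζ => sub_pos.2 (h4 ζ hζ)
  have m₁ : min (min δ₁ δ₂) (min δ₃ δ₄) ≤ δ₁ := (min_le_left _ _).trans (min_le_left _ _)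
  have m₂ : min (min δ₁ δ₂) (min δ₃ δ₄) ≤ δ₂ := (min_le_left _ _).trans (min_le_right _ _)
  have m₃ : min (min δ₁ δ₂) (min δ₃ δ₄) ≤ δ₃ := (min_le_right _ _).trans (min_le_left _ _)
  have m₄ : min (min δ₁ δ₂) (min δ₃ δ₄) ≤ δ₄ := (min_le_right _ _).trans (min_le_right _ _)
  exact ⟨min (min δ₁ δ₂) (min δ₃ δ₄), hD, hb, hDc, hlam, by positivity, hre,
    fun ζ hζ => by linarith [k₁ ζ hζ], fun ζ hζ => by linarith [k₂ ζ hζ],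
    fun ζ hζ => by linarith [k₃ ζ hζ], fun ζ hζ => by linarith [k₄ ζ hζ]⟩

end

end TranslateAnalyticity

/-- Theorem 2.2 of Globevnik, "Analyticity on translates of a Jordan curve":
analyticity on vertical translates of a general real-analytically bounded domain
together with vertical translates of its conjugate domain. -/
theorem analyticity_on_translates_general
    (D : Set ℂ) (hDopen : IsOpen D) (hDconn : IsConnected D)
    (hDbdd : Bornology.IsBounded D)
    -- the boundary of D is a real-analytic simple closed curve
    (γ : ℝ → ℂ) (hγan : ∀ s : ℝ, AnalyticAt ℝ γ s)
    (hγper : ∀ s : ℝ, γ (s + 2 * Real.pi) = γ s)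
    (hγinj : Set.InjOn γ (Set.Ico 0 (2 * Real.pi)))
    (hγ' : ∀ s : ℝ, deriv γ s ≠ 0)
    (hγrange : Set.range γ = frontier D)
    -- α and β are the extreme values of Re on D̄
    (α β : ℝ)
    (hα : IsLeast (Complex.re '' closure D) α)
    (hβ : IsGreatest (Complex.re '' closure D) β)
    -- the conjugate domain
    (Dstar : Set ℂ) (hDstar : Dstar = (fun ζ => (starRingEnd ℂ) ζ) '' D)
    -- the continuous function λ on [α, β]
    (lam : ℝ → ℝ) (hlam : ContinuousOn lam (Set.Icc α β))
    (a b c d : ℝ)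
    -- D̄ + ia and D̄* + ic lie below the graph of λ
    (hia : ∀ ζ ∈ closure D, α ≤ (ζ + Complex.I * (a : ℂ)).re ∧
      (ζ + Complex.I * (a : ℂ)).re ≤ β ∧
      (ζ + Complex.I * (a : ℂ)).im < lam (ζ + Complex.I * (a : ℂ)).re)
    (hic : ∀ ζ ∈ closure Dstar, α ≤ (ζ + Complex.I * (c : ℂ)).re ∧
      (ζ + Complex.I * (c : ℂ)).re ≤ β ∧
      (ζ + Complex.I * (c : ℂ)).im < lam (ζ + Complex.I * (c : ℂ)).re)
    -- D̄ + ib and D̄* + id lie above the graph of λ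
    (hib : ∀ ζ ∈ closure D, α ≤ (ζ + Complex.I * (b : ℂ)).re ∧
      (ζ + Complex.I * (b : ℂ)).re ≤ β ∧
      lam (ζ + Complex.I * (b : ℂ)).re < (ζ + Complex.I * (b : ℂ)).im)
    (hid : ∀ ζ ∈ closure Dstar, α ≤ (ζ + Complex.I * (d : ℂ)).re ∧
      (ζ + Complex.I * (d : ℂ)).re ≤ β ∧
      lam (ζ + Complex.I * (d : ℂ)).re < (ζ + Complex.I * (d : ℂ)).im)
    -- Q₁ and Q₂
    (Q₁ Q₂ : Set ℂ)
    (hQ₁ : Q₁ = ⋃ t ∈ Set.Icc a b, (fun ζ => ζ + Complex.I * (t : ℂ)) '' frontier D)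
    (hQ₂ : Q₂ = ⋃ s ∈ Set.Icc c d, (fun ζ => ζ + Complex.I * (s : ℂ)) '' frontier Dstar)
    (f : ℂ → ℂ) (hf : ContinuousOn f (Q₁ ∪ Q₂))
    -- (2.1): for each t ∈ [a, b], f|(bD + it) extends continuously to D̄ + it,
    -- holomorphically on D + it
    (hext₁ : ∀ t ∈ Set.Icc a b, ∃ g : ℂ → ℂ,
      ContinuousOn g ((fun ζ => ζ + Complex.I * (t : ℂ)) '' closure D) ∧
      DifferentiableOn ℂ g ((fun ζ => ζ + Complex.I * (t : ℂ)) '' D) ∧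
      ∀ ζ ∈ (fun ζ => ζ + Complex.I * (t : ℂ)) '' frontier D, g ζ = f ζ)
    -- (2.2): for each s ∈ [c, d], f|(bD* + is) extends continuously to D̄* + is,
    -- holomorphically on D* + is
    (hext₂ : ∀ s ∈ Set.Icc c d, ∃ h : ℂ → ℂ,
      ContinuousOn h ((fun ζ => ζ + Complex.I * (s : ℂ)) '' closure Dstar) ∧
      DifferentiableOn ℂ h ((fun ζ => ζ + Complex.I * (s : ℂ)) '' Dstar) ∧
      ∀ ζ ∈ (fun ζ => ζ + Complex.I * (s : ℂ)) '' frontier Dstar, h ζ = f ζ) :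
    DifferentiableOn ℂ f (interior Q₁ ∪ interior Q₂) := by
  obtain rfl : Dstar = conjCLE '' D :=
    hDstar.trans (image_congr fun ζ _ => (conjCLE_apply ζ).symm)
  subst hQ₁ hQ₂
  have hαβ : α ≤ β := by
    obtain ⟨p, hp⟩ := hDconn.nonempty.closure
    exact (hα.2 ⟨p, hp, rfl⟩).trans (hβ.2 ⟨p, hp, rfl⟩)
  have hre : ∀ ζ ∈ closure D, ζ.re ∈ Icc α β := fun ζ hζ => ⟨hα.2 ⟨ζ, hζ, rfl⟩, hβ.2 ⟨ζ, hζ, rfl⟩⟩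
  have hlam' : Continuous (IccExtend hαβ ((Icc α β).domRestrict lam)) :=
    hlam.domRestrict.Icc_extend'
  have hle : ∀ ζ ∈ closure D, IccExtend hαβ ((Icc α β).domRestrict lam) ζ.re = lam ζ.re :=
    fun ζ hζ => IccExtend_of_mem _ _ (hre ζ hζ)
  have hcl : ∀ ζ ∈ closure D, conjCLE ζ ∈ closure (conjCLE '' D) := fun ζ hζ => by
    rw [TranslateAnalyticity.closure_conj]
    exact mem_image_of_mem _ hζ
  obtain ⟨δ, hset⟩ := TranslateAnalyticity.exists_setting (a := a) (b := b) (c := c) (d := d)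
    hDopen hDconn hDbdd hlam' hre
    (fun ζ hζ => by rw [hle ζ hζ]; simpa using (hia ζ hζ).2.2)
    (fun ζ hζ => by rw [hle ζ hζ]; simpa using (hib ζ hζ).2.2)
    (fun ζ hζ => by rw [hle ζ hζ]; simpa using (hic _ (hcl ζ hζ)).2.2)
    (fun ζ hζ => by rw [hle ζ hζ]; simpa using (hid _ (hcl ζ hζ)).2.2)
  have hfr : (frontier D).Nonempty := hγrange ▸ range_nonempty γ
  have hfin := TranslateAnalyticity.finite_setOf_not_isVerticallyAccessible hDopen hDbdd
    hDconn.nonempty hγan hγper hγinj hγrange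
  have hf₁ := hf.mono subset_union_left
  have hf₂ := hf.mono subset_union_right
  obtain ⟨G, hG⟩ := TranslateAnalyticity.exists_isFamily hDbdd hf₁ hext₁
  obtain ⟨G', hG'⟩ := TranslateAnalyticity.exists_isFamily hset.conj.isBounded hf₂ hext₂
  refine (hset.differentiableOn_interior hG hG' hfr hfin hf₁).union_of_isOpen
    (hset.conj.differentiableOn_interior (G' := G) hG' ?_ ?_ ?_ hf₂) isOpen_interior isOpen_interior
  · rwa [TranslateAnalyticity.conj_conj_image]
  · rw [TranslateAnalyticity.frontier_conj]
    exact hfr.image _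
  · exact hfin.subset fun x hx h => hx h.conj
end

section
/- Let D ⊂ ℂ be a bounded domain with real-analytic simple closed boundary, and for t ∈ ℝ let K(t) = {y ∈ ℝ : t + iy ∈ D̄}. Let H : ℂ × ℝ → ℂ be continuous. Then the function z ↦ ∫_{K(Re z)} H(z, y) dy (Lebesgue integral over the compact set K(Re z) ⊂ ℝ) is continuous on ℂ. -/
open Complex Set MeasureTheory

/-- The frontier of a nonempty bounded open set is not contained in a vertical line. -/
theorem exists_mem_frontier_re_ne {D : Set ℂ} (hDopen : IsOpen D) (hDne : D.Nonempty)
    (hDbdd : Bornology.IsBounded D) (t : ℝ) : ∃ p ∈ frontier D, p.re ≠ t := by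
  obtain ⟨q, hq, hqt⟩ : ∃ q ∈ D, q.re ≠ t := by
    obtain ⟨p, hp⟩ := hDne
    by_cases hpt : p.re = t
    · obtain ⟨ε, hε, hball⟩ := Metric.isOpen_iff.1 hDopen p hp
      refine ⟨p + ((ε / 2 : ℝ) : ℂ), hball ?_, ?_⟩
      · rw [Metric.mem_ball, dist_eq_norm, add_sub_cancel_left, norm_real, Real.norm_eq_abs,
          abs_of_pos (half_pos hε)]
        exact half_lt_self hε
      · rw [add_re, ofReal_re, hpt]
        linarith
    · exact ⟨p, hp, hpt⟩
  let f : ℝ → ℂ := fun y => (q.re : ℂ) + I * (y : ℂ)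
  have hf : Continuous f := by fun_prop
  have hne : (f ⁻¹' D).Nonempty := by
    refine ⟨q.im, ?_⟩
    have hfq : f q.im = q := by simp only [f]; rw [mul_comm, re_add_im]
    rwa [mem_preimage, hfq]
  have huniv : f ⁻¹' D ≠ univ := by
    obtain ⟨R, hR⟩ := hDbdd.exists_norm_le
    intro h
    have hmem : f (R + 1) ∈ D := by
      rw [← mem_preimage, h]
      trivial
    have him : (f (R + 1)).im = R + 1 := by simp [f]
    have := (le_abs_self _).trans ((abs_im_le_norm (f (R + 1))).trans (hR _ hmem))
    linarith
  obtain ⟨y, hy⟩ := nonempty_frontier_iff.2 ⟨hne, huniv⟩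
  refine ⟨f y, hf.frontier_preimage_subset D hy, ?_⟩
  simpa [f] using hqt

/-- A real-analytic curve that is not contained in the vertical line `re = t` meets it in a
countable set. -/
theorem countable_range_inter_re_eq {γ : ℝ → ℂ} (hγ : ∀ s, AnalyticAt ℝ γ s) {t : ℝ}
    (h : ∃ s, (γ s).re ≠ t) : {p ∈ range γ | p.re = t}.Countable := by
  obtain ⟨s, hs⟩ := h
  have han : AnalyticOnNhd ℝ (fun s => (γ s).re - t) univ := fun x _ =>
    ((reCLM.analyticAt (γ x)).comp (hγ x)).sub analyticAt_const
  have hcod := han.preimage_zero_mem_codiscrete (x := s) (sub_ne_zero.2 hs)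
  have hdisc := isDiscrete_of_codiscreteWithin
    (s := (fun s => (γ s).re - t) ⁻¹' {0}) (U := univ) hcod
  refine (((HereditarilyLindelofSpace.isLindelof _).countable_of_isDiscrete hdisc).image γ).mono ?_
  rintro _ ⟨⟨x, rfl⟩, hx⟩
  exact ⟨x, ⟨sub_eq_zero.2 hx, trivial⟩, rfl⟩

/-- The indicator of a function continuous at `x` is continuous at `x` if `x` is not in the
frontier of the set. -/
theorem ContinuousAt.indicator_of_notMem_frontier {X E : Type*} [TopologicalSpace X]
    [TopologicalSpace E] [Zero E] {A : Set X} {f : X → E} {x : X} (hf : ContinuousAt f x)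
    (hx : x ∉ frontier A) : ContinuousAt (A.indicator f) x := by
  by_cases hA : x ∈ interior A
  · refine hf.congr ?_
    filter_upwards [mem_interior_iff_mem_nhds.1 hA] with y hy
    exact (indicator_of_mem hy f).symm
  · have hx' : x ∈ (closure A)ᶜ := fun h => hx ⟨h, hA⟩
    refine (continuousAt_const (y := (0 : E))).congr ?_
    filter_upwards [isClosed_closure.isOpen_compl.mem_nhds hx'] with y hy
    exact (indicator_of_notMem (fun h => hy (subset_closure h)) f).symm

/-- If `S` is compact and almost no point of each vertical line lies in the frontier of `S`, then
integrals of continuous functions over vertical slices of `S` depend continuously on the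
parameter. -/
theorem continuous_integral_slice {E : Type*} [NormedAddCommGroup E] [NormedSpace ℝ E]
    {S : Set ℂ} (hS : IsCompact S)
    (hfr : ∀ t : ℝ, ∀ᵐ y : ℝ, (t : ℂ) + I * (y : ℂ) ∉ frontier S)
    {H : ℂ × ℝ → E} (hH : Continuous H) :
    Continuous fun z : ℂ => ∫ y in {y : ℝ | (z.re : ℂ) + I * (y : ℂ) ∈ S}, H (z, y) := by
  have hmeas : ∀ z : ℂ, MeasurableSet {y : ℝ | (z.re : ℂ) + I * (y : ℂ) ∈ S} := fun z =>
    (hS.isClosed.preimage (f := fun y : ℝ => (z.re : ℂ) + I * (y : ℂ)) (by fun_prop)).measurableSet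
  simp_rw [← integral_indicator (hmeas _)]
  obtain ⟨R, hR⟩ := hS.isBounded.exists_norm_le
  rw [continuous_iff_continuousAt]
  intro z₀
  obtain ⟨C, hC⟩ := ((isCompact_closedBall z₀ 1).prod (isCompact_Icc (a := -R) (b :=
    R))).exists_bound_of_continuousOn hH.continuousOn
  refine continuousAt_of_dominated (bound := (Icc (-R) R).indicator fun _ => C)
    (.of_forall fun z => ?_) ?_ ?_ ?_
  · exact (by fun_prop : Continuous fun y : ℝ => H (z, y)).aestronglyMeasurable.indicator (hmeas z)
  · filter_upwards [Metric.closedBall_mem_nhds z₀ one_pos] with z hz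
    refine .of_forall fun y => ?_
    by_cases hy : y ∈ {y : ℝ | (z.re : ℂ) + I * (y : ℂ) ∈ S}
    · have hyR : y ∈ Icc (-R) R := by
        have h := (abs_im_le_norm _).trans (hR _ hy)
        simpa [abs_le] using h
      rw [indicator_of_mem hy, indicator_of_mem hyR]
      exact hC (z, y) ⟨hz, hyR⟩
    · rw [indicator_of_notMem hy, norm_zero]
      refine indicator_nonneg (fun y hy => ?_) y
      exact (norm_nonneg _).trans (hC (z, y) ⟨hz, hy⟩)
  · exact (integrable_indicator_iff measurableSet_Icc).2
      (integrableOn_const measure_Icc_lt_top.ne)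
  · filter_upwards [hfr z₀.re] with y hy
    let g : ℂ → ℂ := fun z => (z.re : ℂ) + I * (y : ℂ)
    have hg : Continuous g := by fun_prop
    exact ContinuousAt.indicator_of_notMem_frontier (A := g ⁻¹' S) (f := fun z => H (z, y))
      (by fun_prop) fun h => hy (hg.frontier_preimage_subset S h)

/-- Continuity of the integral over the vertical slices K(Re z) of the closure of
a bounded domain with real-analytic simple closed boundary (Section 6 of
Globevnik, "Analyticity on translates of a Jordan curve"). -/
theorem continuity_of_slice_integral
    (D : Set ℂ) (hDopen : IsOpen D) (hDconn : IsConnected D)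
    (hDbdd : Bornology.IsBounded D)
    -- the boundary of D is a real-analytic simple closed curve
    (γ : ℝ → ℂ) (hγan : ∀ s : ℝ, AnalyticAt ℝ γ s)
    (hγper : ∀ s : ℝ, γ (s + 2 * Real.pi) = γ s)
    (hγinj : Set.InjOn γ (Set.Ico 0 (2 * Real.pi)))
    (hγ' : ∀ s : ℝ, deriv γ s ≠ 0)
    (hγrange : Set.range γ = frontier D)
    -- the vertical slices of D̄
    (K : ℝ → Set ℝ)
    (hK : ∀ t : ℝ, K t = {y : ℝ | (t : ℂ) + Complex.I * (y : ℂ) ∈ closure D})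
    (H : ℂ × ℝ → ℂ) (hH : Continuous H) :
    Continuous fun z : ℂ => ∫ y in K z.re, H (z, y) := by
  obtain rfl : K = fun t : ℝ => {y : ℝ | (t : ℂ) + I * (y : ℂ) ∈ closure D} := funext hK
  refine continuous_integral_slice hDbdd.isCompact_closure (fun t => ?_) hH
  have hinj : Function.Injective fun y : ℝ => (t : ℂ) + I * (y : ℂ) := fun a b hab => by
    simpa using hab
  have hne : ∃ s, (γ s).re ≠ t := by
    obtain ⟨p, hp, hpt⟩ := exists_mem_frontier_re_ne hDopen hDconn.nonempty hDbdd t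
    rw [← hγrange] at hp
    obtain ⟨s, rfl⟩ := hp
    exact ⟨s, hpt⟩
  have hcount := (countable_range_inter_re_eq hγan hne).preimage hinj
  filter_upwards [hcount.ae_notMem volume] with y hy hfr
  refine hy ⟨?_, by simp⟩
  rw [hγrange]
  exact frontier_closure_subset hfr
end

section
/- Let D ⊂ ℂ be a bounded domain with real-analytic simple closed boundary, and for t ∈ ℝ let K(t) = {y ∈ ℝ : t + iy ∈ D̄}. Then for every t₀ ∈ ℝ, the one-dimensional Lebesgue measure of the symmetric difference K(t) Δ K(t₀) tends to 0 as t → t₀. -/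
open Complex Set MeasureTheory

/-- A differentiable periodic real function has a critical point. -/
lemma Function.Periodic.exists_deriv_eq_zero {f : ℝ → ℝ} {c : ℝ} (hp : Function.Periodic f c)
    (hc : 0 < c) (hf : Continuous f) : ∃ x, deriv f x = 0 := by
  obtain ⟨x, -, hx⟩ := _root_.exists_deriv_eq_zero (f := f) hc hf.continuousOn (by simpa using (hp 0).symm)
  exact ⟨x, hx⟩

/-- The level sets of a nonconstant real-analytic function on the line are countable. -/
lemma countable_preimage_singleton_of_analytic {f : ℝ → ℝ} (hf : ∀ s, AnalyticAt ℝ f s) (t : ℝ)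
    (hne : ∃ s, f s ≠ t) : (f ⁻¹' {t}).Countable := by
  obtain ⟨s, hs⟩ := hne
  have hg : AnalyticOnNhd ℝ (fun s => f s - t) univ := fun s _ => (hf s).sub analyticAt_const
  have h := hg.preimage_zero_mem_codiscrete (x := s) (sub_ne_zero.2 hs)
  have heq : (fun s => f s - t) ⁻¹' {0}ᶜ = (f ⁻¹' {t})ᶜ := by
    ext; simp [sub_eq_zero]
  rw [heq, compl_mem_codiscrete_iff] at h
  exact (HereditarilyLindelofSpace.isLindelof _).countable_of_isDiscrete h.2

/-- A periodic regular real-analytic plane curve meets each vertical line in a countable set. -/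
lemma countable_vertical_slice_range {γ : ℝ → ℂ} {c : ℝ} (hc : 0 < c)
    (hγan : ∀ s : ℝ, AnalyticAt ℝ γ s) (hγper : Function.Periodic γ c)
    (hγ' : ∀ s : ℝ, deriv γ s ≠ 0) (t : ℝ) :
    {y : ℝ | (t : ℂ) + I * (y : ℂ) ∈ range γ}.Countable := by
  have hre : ∀ s, AnalyticAt ℝ (fun s => (γ s).re) s := fun s =>
    (reCLM.analyticAt _).comp (hγan s)
  have hcount := countable_preimage_singleton_of_analytic hre t <| by
    by_contra! hall
    have hcont : Continuous γ := continuous_iff_continuousAt.2 fun s => (hγan s).continuousAt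
    obtain ⟨s, hs⟩ := Function.Periodic.exists_deriv_eq_zero (f := fun s => (γ s).im)
      (fun s => congrArg im (hγper s)) hc (continuous_im.comp hcont)
    have hd := (hγan s).differentiableAt.hasDerivAt
    have hdre := (reCLM.hasFDerivAt.comp_hasDerivAt s hd).deriv
    have hdim := (imCLM.hasFDerivAt.comp_hasDerivAt s hd).deriv
    have hconst : (reCLM ∘ γ) = fun _ => t := funext hall
    rw [hconst, deriv_const] at hdre
    exact hγ' s (Complex.ext hdre.symm (hdim.symm.trans hs))
  refine (hcount.image fun s => (γ s).im).mono ?_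
  rintro y ⟨s, hs⟩
  exact ⟨s, by simp [hs], by simp [hs]⟩

/-- Off the frontier of an open set, membership in its closure is locally constant. -/
lemma eventually_mem_closure_iff_of_notMem_frontier {X : Type*} [TopologicalSpace X] {D : Set X}
    (hD : IsOpen D) {x : X} (hx : x ∉ frontier D) :
    ∀ᶠ z in nhds x, z ∈ closure D ↔ x ∈ closure D := by
  by_cases h : x ∈ closure D
  · have hxD : x ∈ D := by
      by_contra hn
      exact hx ⟨h, by rwa [hD.interior_eq]⟩
    filter_upwards [hD.mem_nhds hxD] with z hz
    exact iff_of_true (subset_closure hz) h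
  · filter_upwards [isClosed_closure.isOpen_compl.mem_nhds h] with z hz
    exact iff_of_false hz h

open Complex Set MeasureTheory

/-- The vertical slices K(t) of the closure of a bounded domain with real-analytic
simple closed boundary vary continuously in measure: the Lebesgue measure of the
symmetric difference K(t) Δ K(t₀) tends to 0 as t → t₀. -/
theorem slices_continuous_in_measure
    (D : Set ℂ) (hDopen : IsOpen D) (hDconn : IsConnected D)
    (hDbdd : Bornology.IsBounded D)
    -- the boundary of D is a real-analytic simple closed curve
    (γ : ℝ → ℂ) (hγan : ∀ s : ℝ, AnalyticAt ℝ γ s)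
    (hγper : ∀ s : ℝ, γ (s + 2 * Real.pi) = γ s)
    (hγinj : Set.InjOn γ (Set.Ico 0 (2 * Real.pi)))
    (hγ' : ∀ s : ℝ, deriv γ s ≠ 0)
    (hγrange : Set.range γ = frontier D)
    -- the vertical slices of D̄
    (K : ℝ → Set ℝ)
    (hK : ∀ t : ℝ, K t = {y : ℝ | (t : ℂ) + Complex.I * (y : ℂ) ∈ closure D})
    (t₀ : ℝ) :
    Filter.Tendsto (fun t : ℝ => volume (symmDiff (K t) (K t₀))) (nhds t₀) (nhds 0) := by
  have hslice (t : ℝ) : Continuous fun y : ℝ => (t : ℂ) + I * (y : ℂ) := by fun_prop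
  have hKmeas (t : ℝ) : MeasurableSet (K t) := by
    rw [hK]
    exact (isClosed_closure.preimage (hslice t)).measurableSet
  obtain ⟨R, hR⟩ := hDbdd.closure.subset_closedBall 0
  have hKsub (t : ℝ) : K t ⊆ Icc (-R) R := by
    intro y hy
    rw [hK] at hy
    have h := (abs_im_le_norm _).trans (mem_closedBall_zero_iff.1 (hR hy))
    simpa [abs_le] using h
  have hcount := countable_vertical_slice_range Real.two_pi_pos hγan hγper hγ' t₀
  rw [hγrange] at hcount
  rw [← measure_empty (μ := (volume : Measure ℝ))]
  refine tendsto_measure_of_ae_tendsto_indicator (nhds t₀) MeasurableSet.empty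
    (fun t => (hKmeas t).symmDiff (hKmeas t₀)) (measurableSet_Icc (a := -R) (b := R))
    (by simp) (.of_forall fun t => ?_) ?_
  · exact symmDiff_subset_union.trans (union_subset (hKsub t) (hKsub t₀))
  · filter_upwards [compl_mem_ae_iff.2 (hcount.measure_zero volume)] with y hy
    have hcont : Continuous fun t : ℝ => (t : ℂ) + I * (y : ℂ) := by fun_prop
    filter_upwards [hcont.continuousAt.eventually
      (eventually_mem_closure_iff_of_notMem_frontier hDopen hy)] with t ht
    have ht' : y ∈ K t ↔ y ∈ K t₀ := by
      rw [hK, hK]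
      exact ht
    simp [mem_symmDiff, ht']
end
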